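/- The ordered monomials s_{21}^{k_{21}} s_{31}^{k_{31}} s_{32}^{k_{32}} ⋯ s_{n1}^{k_{n1}} ⋯ s_{n,n−1}^{k_{n,n−1}} s_{n+1,1}^{k_{n+1,1}} ⋯ s_{n+1,n}^{k_{n+1,n}} ⋯ s_{2n,1}^{k_{2n,1}} — products of powers of the generators s_{ij} over all pairs (i,j) with 1 ≤ j < i ≤ j′, taken in increasing lexicographic order of (i,j), with arbitrary nonnegative integer exponents k_{ij} — form a basis of U_q^{tw}(gl_n) as an F-vector space. -/

import Mathlib

noncomputable section

set_option synthInstance.maxHeartbeats 1000000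
set_option maxHeartbeats 1000000

namespace CI

/-- The ground field F = ℂ(q). -/
abbrev F : Type := RatFunc ℂ

/-- The formal variable q. -/
def q : F := RatFunc.X

/-- The index involution i ↦ i′ = 2n+1−i (here in 0-based form i ↦ 2n−1−i). -/
def pr (n : ℕ) (i : Fin (2*n)) : Fin (2*n) := ⟨2*n - 1 - i.val, by have := i.isLt; omega⟩

/-- ε_i = 1 for i ≤ n and ε_i = −1 for i > n (1-based). -/
def eps (n : ℕ) (i : Fin (2*n)) : F := if (i : ℕ) < n then 1 else -1

/-- (1̄,…,n̄,(n+1)̄,…,(2n)̄) = (n,…,1,−1,…,−n). -/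
def bar (n : ℕ) (i : Fin (2*n)) : ℤ :=
  if (i : ℕ) < n then (n : ℤ) - (i : ℕ) else (n : ℤ) - (i : ℕ) - 1

/-- The diagonal entries of D = diag(qⁿ,…,q,q⁻¹,…,q⁻ⁿ): D_{ii} = q^{ī}. -/
def dd (n : ℕ) (i : Fin (2*n)) : F := q ^ (bar n i)

/-- The entries of the R-matrix R = Σ_{i,j} q^{δ_{ij}−δ_{ij′}} e_{ii} ⊗ e_{jj}
    + (q−q⁻¹) Σ_{i<j} e_{ij} ⊗ e_{ji}
    − (q−q⁻¹) Σ_{i<j} q^{j̄−ī} ε_i ε_j e_{ij} ⊗ e_{i′j′}. -/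
def Rm (n : ℕ) (p s : Fin (2*n) × Fin (2*n)) : F :=
  (if p.1 = s.1 ∧ p.2 = s.2 then
      q ^ ((if p.1 = p.2 then (1:ℤ) else 0) - (if p.1 = pr n p.2 then (1:ℤ) else 0)) else 0)
  + (if p.1 < p.2 ∧ s.1 = p.2 ∧ s.2 = p.1 then q - q⁻¹ else 0)
  - (if p.1 < s.1 ∧ p.2 = pr n p.1 ∧ s.2 = pr n s.1 then
      (q - q⁻¹) * q ^ (bar n s.1 - bar n p.1) * eps n p.1 * eps n s.1 else 0)

/-- Generators t_{ij}, t̄_{ij} of the extended algebra. -/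
inductive Gen (n : ℕ) : Type
  | t (i j : Fin (2*n)) : Gen n
  | tb (i j : Fin (2*n)) : Gen n

/-- The free F-algebra on the generators. -/
abbrev FA (n : ℕ) : Type := FreeAlgebra F (Gen n)

def tF (n : ℕ) (i j : Fin (2*n)) : FA n := FreeAlgebra.ι F (Gen.t i j)
def tbF (n : ℕ) (i j : Fin (2*n)) : FA n := FreeAlgebra.ι F (Gen.tb i j)

/-- The defining relations of the RTT presentation U_q(sp_{2n}): the triangularity
    and diagonal relations, the entrywise RTT relations R T₁ T₂ = T₂ T₁ R,
    R T̄₁ T̄₂ = T̄₂ T̄₁ R, R T̄₁ T₂ = T₂ T̄₁ R, and the entrywise central relations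
    T D Tᵗ D⁻¹ = T̄ D T̄ᵗ D⁻¹ = I, D Tᵗ D⁻¹ T = D T̄ᵗ D⁻¹ T̄ = I
    (where ᵗ is the twisted transposition e_{ij}ᵗ = ε_i ε_j e_{j′i′}). -/
inductive rel (n : ℕ) : FA n → FA n → Prop
  | t_upper (i j : Fin (2*n)) (h : i < j) : rel n (tF n i j) 0
  | tb_lower (i j : Fin (2*n)) (h : j < i) : rel n (tbF n i j) 0
  | t_tb_diag (i : Fin (2*n)) : rel n (tF n i i * tbF n i i) 1
  | tb_t_diag (i : Fin (2*n)) : rel n (tbF n i i * tF n i i) 1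
  | rtt_tt (i a j b : Fin (2*n)) :
      rel n (∑ k, ∑ c, Rm n (i, a) (k, c) • (tF n k j * tF n c b))
            (∑ c, ∑ l, Rm n (l, c) (j, b) • (tF n a c * tF n i l))
  | rtt_bb (i a j b : Fin (2*n)) :
      rel n (∑ k, ∑ c, Rm n (i, a) (k, c) • (tbF n k j * tbF n c b))
            (∑ c, ∑ l, Rm n (l, c) (j, b) • (tbF n a c * tbF n i l))
  | rtt_bt (i a j b : Fin (2*n)) :
      rel n (∑ k, ∑ c, Rm n (i, a) (k, c) • (tbF n k j * tF n c b))
            (∑ c, ∑ l, Rm n (l, c) (j, b) • (tF n a c * tbF n i l))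
  | cent_t1 (i j : Fin (2*n)) :
      rel n (∑ k, (dd n k * (dd n j)⁻¹ * eps n (pr n k) * eps n (pr n j)) •
              (tF n i k * tF n (pr n j) (pr n k)))
            (if i = j then 1 else 0)
  | cent_tb1 (i j : Fin (2*n)) :
      rel n (∑ k, (dd n k * (dd n j)⁻¹ * eps n (pr n k) * eps n (pr n j)) •
              (tbF n i k * tbF n (pr n j) (pr n k)))
            (if i = j then 1 else 0)
  | cent_t2 (i j : Fin (2*n)) :
      rel n (∑ k, (dd n i * (dd n k)⁻¹ * eps n (pr n i) * eps n (pr n k)) •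
              (tF n (pr n k) (pr n i) * tF n k j))
            (if i = j then 1 else 0)
  | cent_tb2 (i j : Fin (2*n)) :
      rel n (∑ k, (dd n i * (dd n k)⁻¹ * eps n (pr n i) * eps n (pr n k)) •
              (tbF n (pr n k) (pr n i) * tbF n k j))
            (if i = j then 1 else 0)

/-- The RTT presentation U_q(sp_{2n}). -/
abbrev Usp (n : ℕ) : Type := RingQuot (rel n)

/-- The generator t_{ij} of U_q(sp_{2n}). -/
def tU (n : ℕ) (i j : Fin (2*n)) : Usp n := RingQuot.mkAlgHom F (rel n) (tF n i j)

/-- The generator t̄_{ij} of U_q(sp_{2n}). -/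
def tbU (n : ℕ) (i j : Fin (2*n)) : Usp n := RingQuot.mkAlgHom F (rel n) (tbF n i j)

/-- The entries s_{ij} = Σ_{k=j}^{i} ε_k t_{ik} t̄_{jk} of the matrix S = T J T̄^u. -/
def sU (n : ℕ) (i j : Fin (2*n)) : Usp n :=
  ∑ k ∈ Finset.Icc j i, eps n k • (tU n i k * tbU n j k)

/-- The entries s̄_{ij} = ε_i ε_j Σ_{k=j}^{i} ε_{k′} t̄_{i′k′} t_{j′k′} of the
    matrix S̄ = T̄^{ut} Jᵗ Tᵗ. -/
def sbU (n : ℕ) (i j : Fin (2*n)) : Usp n :=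
  (eps n i * eps n j) • ∑ k ∈ Finset.Icc j i,
    eps n (pr n k) • (tbU n (pr n i) (pr n k) * tU n (pr n j) (pr n k))

/-- The twisted quantized enveloping algebra U_q^{tw}(gl_n): the subalgebra of
    U_q(sp_{2n}) generated by the entries of S. -/
def Utw (n : ℕ) : Subalgebra F (Usp n) :=
  Algebra.adjoin F (Set.range fun p : Fin (2*n) × Fin (2*n) => sU n p.1 p.2)

/-- The ordered monomial Π_{(i,j) : j < i ≤ j′, lexicographically} s_{ij}^{k_{ij}}:
    the product is taken over increasing i, and for fixed i over increasing j. -/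
def monomial (n : ℕ) (k : Fin (2*n) × Fin (2*n) → ℕ) : Usp n :=
  ((List.finRange (2*n)).map fun i =>
    ((List.finRange (2*n)).map fun j =>
      if j < i ∧ i ≤ pr n j then sU n i j ^ k (i, j) else 1).prod).prod

set_option linter.unusedSectionVars false
set_option linter.unusedVariables false
set_option linter.unusedSimpArgs false

/-! ### Part 1: elementary facts about the R-matrix -/

section RMatrix

variable {n : ℕ}

/-- The R-matrix with a general parameter. -/
def Rg (n : ℕ) (Q : F) : Matrix (Fin (2*n) × Fin (2*n)) (Fin (2*n) × Fin (2*n)) F := fun p s =>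
  (if p.1 = s.1 ∧ p.2 = s.2 then
      Q ^ ((if p.1 = p.2 then (1:ℤ) else 0) - (if p.1 = pr n p.2 then (1:ℤ) else 0)) else 0)
  + (if p.1 < p.2 ∧ s.1 = p.2 ∧ s.2 = p.1 then Q - Q⁻¹ else 0)
  - (if p.1 < s.1 ∧ p.2 = pr n p.1 ∧ s.2 = pr n s.1 then
      (Q - Q⁻¹) * Q ^ (bar n s.1 - bar n p.1) * eps n p.1 * eps n s.1 else 0)

theorem Rm_eq (p s : Fin (2*n) × Fin (2*n)) : Rm n p s = Rg n q p s := rfl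

theorem pr_val (i : Fin (2*n)) : (pr n i : ℕ) = 2*n - 1 - i := (rfl)

@[simp] theorem pr_pr (i : Fin (2*n)) : pr n (pr n i) = i := by
  apply Fin.ext; simp only [pr_val]; omega

theorem pr_inj {i j : Fin (2*n)} : pr n i = pr n j ↔ i = j :=
  ⟨fun h => by rw [← pr_pr i, h, pr_pr], fun h => by rw [h]⟩

theorem pr_lt {i j : Fin (2*n)} : pr n i < pr n j ↔ j < i := by
  simp only [Fin.lt_def, pr_val]; omega

theorem pr_ne (i : Fin (2*n)) : pr n i ≠ i := by
  intro h; have := congrArg Fin.val h; simp only [pr_val] at this; omega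

theorem eq_pr_comm {i j : Fin (2*n)} : i = pr n j ↔ j = pr n i :=
  ⟨fun h => by rw [h, pr_pr], fun h => by rw [h, pr_pr]⟩

@[simp] theorem eps_pr (i : Fin (2*n)) : eps n (pr n i) = - eps n i := by
  unfold eps; simp only [pr_val]
  by_cases h : (i : ℕ) < n
  · rw [if_neg (by omega), if_pos h]
  · rw [if_pos (by omega), if_neg h, neg_neg]

@[simp] theorem bar_pr (i : Fin (2*n)) : bar n (pr n i) = - bar n i := by
  unfold bar; simp only [pr_val]; split_ifs <;> omega

@[simp] theorem eps_mul_self (i : Fin (2*n)) : eps n i * eps n i = 1 := by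
  unfold eps; split_ifs <;> simp

theorem eps_ne (i : Fin (2*n)) : eps n i ≠ 0 := by
  intro h; have := eps_mul_self i; rw [h] at this; simp at this

/-- p_i = ε_i Q^{-ī}. -/
def pp (n : ℕ) (Q : F) (i : Fin (2*n)) : F := eps n i * Q ^ (-bar n i)

theorem pp_pr (Q : F) (i : Fin (2*n)) : pp n Q (pr n i) = - (eps n i * Q ^ (bar n i)) := by
  simp [pp]

theorem pp_mul_pr {Q : F} (hQ : Q ≠ 0) (i : Fin (2*n)) : pp n Q i * pp n Q (pr n i) = -1 := by
  rw [pp_pr, pp]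
  have h := eps_mul_self i
  have h2 : Q ^ (-bar n i) * Q ^ (bar n i) = 1 := by
    rw [← zpow_add₀ hQ]; simp
  linear_combination (-1) * (Q ^ (-bar n i) * Q ^ (bar n i)) * h - h2

theorem Rg_apply {Q : F} (hQ : Q ≠ 0) (i a j b : Fin (2*n)) : Rg n Q (i, a) (j, b) =
    (if i = j ∧ a = b then
      Q ^ ((if i = a then (1:ℤ) else 0) - (if i = pr n a then (1:ℤ) else 0)) else 0)
    + (if i < a ∧ j = a ∧ b = i then Q - Q⁻¹ else 0)
    + (if i < j ∧ a = pr n i ∧ b = pr n j then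
        (Q - Q⁻¹) * (pp n Q i * pp n Q (pr n j)) else 0) := by
  simp only [Rg]
  rw [sub_eq_add_neg]
  congr 1
  split_ifs
  · rw [pp_pr, pp, zpow_sub₀ hQ, zpow_neg]; field_simp
  · exact neg_zero

/-- e(x,y) = δ_{xy} − δ_{xy'}. -/
def ee (n : ℕ) (x y : Fin (2*n)) : ℤ :=
  (if x = y then (1:ℤ) else 0) - (if x = pr n y then (1:ℤ) else 0)

theorem Rg_mulVec {Q : F} (hQ : Q ≠ 0) (f : Fin (2*n) × Fin (2*n) → F) (x y : Fin (2*n)) :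
    (Rg n Q).mulVec f (x, y) = Q ^ (ee n x y) * f (x, y)
      + (if x < y then (Q - Q⁻¹) * f (y, x) else 0)
      + (if y = pr n x then (Q - Q⁻¹) * pp n Q x *
          ∑ s, (if x < s then pp n Q (pr n s) * f (s, pr n s) else 0) else 0) := by
  simp only [Matrix.mulVec, dotProduct, Fintype.sum_prod_type, Rg_apply hQ, add_mul,
    Finset.sum_add_distrib, ite_mul, zero_mul]
  congr 1
  · congr 1
    · rw [Finset.sum_eq_single x, Finset.sum_eq_single y]
      · simp [ee]
      · intro b _ hb; rw [if_neg (fun h => hb h.2.symm)]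
      · simp
      · intro b _ hb; exact Finset.sum_eq_zero fun c _ => if_neg (fun h => hb h.1.symm)
      · simp
    · by_cases h : x < y
      · simp [h, ite_and]
      · simp [h]
  · by_cases h : y = pr n x
    · simp only [h, true_and, if_true, Finset.mul_sum]
      refine Finset.sum_congr rfl fun s _ => ?_
      by_cases h2 : x < s
      · simp [h2]; ring
      · simp [h2]
    · simp [h]

/-- The predecessor. -/
def pd (x : Fin (2*n)) : Fin (2*n) := ⟨x.val - 1, by omega⟩

theorem pd_val (x : Fin (2*n)) : ((pd x : Fin (2*n)) : ℕ) = x - 1 := (rfl)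

/-- Coefficients of the m-th Chevalley generator. -/
def al (n m : ℕ) (x : Fin (2*n)) : F :=
  (if x.val = m + 1 then 1 else 0) +
    (if x.val + m + 1 = 2*n then (if m + 1 = n then 1 else -1) else 0)

/-- Exponents of the m-th Cartan generator. -/
def ke (n m : ℕ) (x : Fin (2*n)) : ℤ :=
  (if x.val = m then 1 else 0) - (if x.val = m + 1 then 1 else 0)
    - (if x.val + m + 1 = 2*n then 1 else 0) + (if x.val + m + 2 = 2*n then 1 else 0)

/-- The m-th Chevalley generator. -/
def Am (n m : ℕ) : Matrix (Fin (2*n)) (Fin (2*n)) F := fun x y =>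
  if x.val = y.val + 1 then al n m x else 0

/-- The m-th Cartan generator. -/
def Km (n m : ℕ) (Q : F) : Matrix (Fin (2*n)) (Fin (2*n)) F :=
  Matrix.diagonal fun x => Q ^ (ke n m x)

theorem al_supp {m : ℕ} {x : Fin (2*n)} (h : al n m x ≠ 0) :
    x.val = m + 1 ∨ x.val + m + 1 = 2*n := by
  by_contra hc; push Not at hc; exact h (by simp [al, hc.1, hc.2])

theorem Am_sum {m : ℕ} (hm : m + 1 < 2*n) (f : Fin (2*n) → F) (x : Fin (2*n)) :
    ∑ y, Am n m x y * f y = al n m x * f (pd x) := by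
  by_cases hx : x.val = 0
  · have : al n m x = 0 := by
      by_contra h; have := al_supp h; omega
    rw [this]; simp only [Am, this]; simp
  · rw [Finset.sum_eq_single (pd x)]
    · simp only [Am, pd_val]; rw [if_pos (by omega)]
    · intro y _ hy
      simp only [Am]; rw [if_neg, zero_mul]
      intro h; apply hy; apply Fin.ext; simp [pd_val]; omega
    · simp

theorem sum_telescope (N : ℕ) (G : ℕ → F) (x : ℕ) (hx : x < N) :
    ∑ s : Fin N, (if x < s.val then G s.val - G (s.val - 1) else 0) = G (N-1) - G x := by
  rw [Fin.sum_univ_eq_sum_range (fun s => if x < s then G s - G (s-1) else 0)]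
  induction N with
  | zero => omega
  | succ N ih =>
    rw [Finset.sum_range_succ]
    by_cases h : x < N
    · rw [ih h, if_pos h]; simp
    · have : x = N := by omega
      subst this
      rw [if_neg h, Finset.sum_eq_zero]; · simp
      intro s hs; rw [if_neg]; simp at hs; omega

theorem al_ke_ee {m : ℕ} (hm : m + 1 < 2*n) {x : Fin (2*n)} (h : al n m x ≠ 0)
    (y : Fin (2*n)) : ke n m y + ee n x y = ee n (pd x) y := by
  rcases al_supp h with h | h
  · simp only [ke, ee, Fin.ext_iff, pr_val, pd_val]
    split_ifs <;> omega
  · simp only [ke, ee, Fin.ext_iff, pr_val, pd_val]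
    split_ifs <;> omega

theorem ee_comm (x y : Fin (2*n)) : ee n x y = ee n y x := by
  simp only [ee, Fin.ext_iff, pr_val]; split_ifs <;> omega

end RMatrix

section Intertwine

variable {n : ℕ}

theorem bar_pd {s : Fin (2*n)} (hs : 1 ≤ s.val) :
    bar n (pd s) = bar n s + (if s.val = n then 2 else 1) := by
  simp only [bar, pd_val]; split_ifs <;> omega

theorem eps_pd {s : Fin (2*n)} (hs : 1 ≤ s.val) :
    eps n (pd s) = (if s.val = n then - eps n s else eps n s) := by
  simp only [eps, pd_val]
  by_cases h : s.val = n
  · rw [if_pos (by omega), if_pos h, if_neg (by omega), neg_neg]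
  · rw [if_neg h]
    by_cases h2 : s.val < n
    · rw [if_pos (by omega), if_pos h2]
    · rw [if_neg (by omega), if_neg h2]

theorem cap_rel {m : ℕ} {Q : F} (hQ : Q ≠ 0) (hm : m + 1 < 2*n) {s : Fin (2*n)} (hs : 1 ≤ s.val) :
    pp n Q (pr n s) * (al n m s * Q ^ ke n m (pr n s))
      = - (pp n Q (pr n (pd s)) * al n m (pr n (pd s))) := by
  rw [pp_pr, pp_pr, bar_pd hs, eps_pd hs]
  by_cases hmid : m + 1 = n
  · by_cases h : s.val = n
    · have h1 : al n m s = 2 := by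
        simp only [al]; rw [if_pos (by omega), if_pos (by omega), if_pos hmid]; norm_num
      have h2 : al n m (pr n (pd s)) = 2 := by
        simp only [al, pr_val, pd_val]
        rw [if_pos (by omega), if_pos (by omega), if_pos hmid]; norm_num
      have h3 : ke n m (pr n s) = 2 := by
        simp only [ke, pr_val]; split_ifs <;> omega
      rw [h1, h2, h3, if_pos h, if_pos h, zpow_add₀ hQ]; ring
    · have h1 : al n m s = 0 := by
        simp only [al]; rw [if_neg (by omega), if_neg (by omega), add_zero]
      have h2 : al n m (pr n (pd s)) = 0 := by
        simp only [al, pr_val, pd_val]; rw [if_neg (by omega), if_neg (by omega), add_zero]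
      rw [h1, h2]; ring
  · by_cases ha : s.val = m + 1
    · have h1 : al n m s = 1 := by
        simp only [al]; rw [if_pos (by omega), if_neg (by omega), add_zero]
      have h2 : al n m (pr n (pd s)) = -1 := by
        simp only [al, pr_val, pd_val]
        rw [if_neg (by omega), if_pos (by omega), if_neg hmid, zero_add]
      have h3 : ke n m (pr n s) = 1 := by
        simp only [ke, pr_val]; split_ifs <;> omega
      rw [h1, h2, h3, if_neg (by omega), if_neg (by omega), zpow_add₀ hQ]; ring
    · by_cases hb : s.val + m + 1 = 2*n
      · have h1 : al n m s = -1 := by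
          simp only [al]; rw [if_neg (by omega), if_pos (by omega), if_neg hmid, zero_add]
        have h2 : al n m (pr n (pd s)) = 1 := by
          simp only [al, pr_val, pd_val]
          rw [if_pos (by omega), if_neg (by omega), add_zero]
        have h3 : ke n m (pr n s) = 1 := by
          simp only [ke, pr_val]; split_ifs <;> omega
        rw [h1, h2, h3, if_neg (by omega), if_neg (by omega), zpow_add₀ hQ]; ring
      · have h1 : al n m s = 0 := by
          simp only [al]; rw [if_neg (by omega), if_neg (by omega), add_zero]
        have h2 : al n m (pr n (pd s)) = 0 := by
          simp only [al, pr_val, pd_val]; rw [if_neg (by omega), if_neg (by omega), add_zero]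
        rw [h1, h2]; ring

theorem ke_pr (m : ℕ) (hm : m + 1 < 2*n) (x : Fin (2*n)) : ke n m (pr n x) = - ke n m x := by
  simp only [ke, pr_val]; split_ifs <;> omega

theorem cap_rel2 {m : ℕ} {Q : F} (hQ : Q ≠ 0) (hm : m + 1 < 2*n) {x : Fin (2*n)} (hs : 1 ≤ x.val) :
    al n m x * pp n Q (pd x) + Q ^ ke n m x * al n m (pr n (pd x)) * pp n Q x = 0 := by
  have h := cap_rel hQ hm hs
  have h1 := pp_mul_pr hQ x
  have h2 := pp_mul_pr hQ (pd x)
  have h3 : Q ^ ke n m x * Q ^ ke n m (pr n x) = 1 := by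
    rw [← zpow_add₀ hQ, ke_pr m hm]; simp
  linear_combination (-(Q ^ ke n m x * pp n Q x * pp n Q (pd x))) * h
    + al n m x * pp n Q (pd x) * Q ^ ke n m x * Q ^ ke n m (pr n x) * h1
    + Q ^ ke n m x * pp n Q x * al n m (pr n (pd x)) * h2
    - al n m x * pp n Q (pd x) * h3

theorem pp_pd_pr {Q : F} (hQ : Q ≠ 0) {x : Fin (2*n)} (hs : 1 ≤ x.val) :
    pp n Q (pd x) * pp n Q (pr n x) = if x.val = n then Q ^ (-2 : ℤ) else - Q ^ (-1 : ℤ) := by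
  have h := eps_mul_self x
  have h2 : Q ^ (-bar n x) * Q ^ (bar n x) = 1 := by
    rw [← zpow_add₀ hQ]; simp
  rw [pp_pr, pp, bar_pd hs, eps_pd hs, neg_add, zpow_add₀ hQ]
  split_ifs
  · linear_combination Q ^ (-2:ℤ) * h * (Q ^ (-bar n x) * Q ^ (bar n x)) + Q ^ (-2:ℤ) * h2
  · linear_combination -Q ^ (-1:ℤ) * h * (Q ^ (-bar n x) * Q ^ (bar n x)) - Q ^ (-1:ℤ) * h2

theorem scal_id {m : ℕ} {Q : F} (hQ : Q ≠ 0) (hm : m + 1 < 2*n) (x y : Fin (2*n)) :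
    al n m y * (Q ^ ee n x y - Q ^ ke n m x * Q ^ ee n x (pd y))
      + (if y.val = x.val + 1 then (Q - Q⁻¹) * Q ^ ke n m x * al n m y else 0)
      + (if y.val + x.val + 1 = 2 * n then (Q - Q⁻¹) * al n m y else 0)
    = (if x.val = y.val then (Q - Q⁻¹) * al n m x else 0)
      + (if x.val + y.val = 2*n then (Q - Q⁻¹) * al n m x * (pp n Q (pd x) * pp n Q (pr n x))
          else 0) := by
  by_cases hy : al n m y = 0
  · rw [hy]
    have e1 : (if x.val = y.val then (Q - Q⁻¹) * al n m x else 0) = 0 := by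
      split_ifs with h
      · rw [Fin.ext h, hy, mul_zero]
      · rfl
    have e2 : (if x.val + y.val = 2*n then
        (Q - Q⁻¹) * al n m x * (pp n Q (pd x) * pp n Q (pr n x)) else 0) = 0 := by
      split_ifs with h
      · have hx : 1 ≤ x.val := by omega
        have hp : pr n (pd x) = y := by
          apply Fin.ext; simp only [pr_val, pd_val]; omega
        have := cap_rel2 hQ hm hx
        rw [hp, hy] at this
        linear_combination (Q - Q⁻¹) * pp n Q (pr n x) * this
      · rfl
    rw [e1, e2]; simp
  · have hk : Q ^ ke n m x * Q ^ ee n x (pd y) = Q ^ (2 * ke n m x + ee n x y) := by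
      rw [← zpow_add₀ hQ, ee_comm x (pd y), ← al_ke_ee hm hy x, ee_comm x y]; congr 1; ring
    have hp : (if x.val + y.val = 2*n then
        (Q - Q⁻¹) * al n m x * (pp n Q (pd x) * pp n Q (pr n x)) else 0)
      = (if x.val + y.val = 2*n then
        (Q - Q⁻¹) * al n m x * (if x.val = n then Q ^ (-2 : ℤ) else - Q ^ (-1 : ℤ)) else 0) := by
      by_cases h : x.val + y.val = 2*n
      · rw [if_pos h, if_pos h, pp_pd_pr hQ (by omega)]
      · rw [if_neg h, if_neg h]
    rw [hk, hp]
    have hxl := x.isLt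
    have hyl := y.isLt
    simp only [al, ke, ee, Fin.ext_iff, pr_val]
    rcases al_supp hy with hy' | hy'
    all_goals
      by_cases hmid : m + 1 = n
      · by_cases h1 : x.val = m
        · simp (disch := omega) only [if_pos, if_neg]
          norm_num
          field_simp
          try ring
        · by_cases h2 : x.val = m + 1
          · simp (disch := omega) only [if_pos, if_neg]
            norm_num
            field_simp
            try ring
          · simp (disch := omega) only [if_pos, if_neg]
            norm_num
      · by_cases h1 : x.val = m
        · simp (disch := omega) only [if_pos, if_neg]
          norm_num
          try (field_simp; try ring)
        · by_cases h2 : x.val = m + 1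
          · simp (disch := omega) only [if_pos, if_neg]
            norm_num
            try (field_simp; try ring)
          · by_cases h3 : x.val + m + 1 = 2*n
            · simp (disch := omega) only [if_pos, if_neg]
              norm_num
              try (field_simp; try ring)
            · by_cases h4 : x.val + m + 2 = 2*n
              · simp (disch := omega) only [if_pos, if_neg]
                norm_num
                try (field_simp; try ring)
              · simp (disch := omega) only [if_pos, if_neg]
                norm_num

end Intertwine

section Intertwine2

open scoped Kronecker

variable {n : ℕ}

theorem kr_mulVec {ι κ : Type*} [Fintype ι] [Fintype κ] (A : Matrix ι ι F) (B : Matrix κ κ F)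
    (f : ι × κ → F) (x : ι) (y : κ) : (A ⊗ₖ B).mulVec f (x, y)
      = ∑ i, A x i * ∑ j, B y j * f (i, j) := by
  simp only [Matrix.mulVec, dotProduct, Fintype.sum_prod_type, Matrix.kroneckerMap_apply,
    Finset.mul_sum, mul_assoc]

theorem one_sum {ι : Type*} [Fintype ι] [DecidableEq ι] (x : ι) (f : ι → F) :
    ∑ i, (1 : Matrix ι ι F) x i * f i = f x := by
  simp [Matrix.one_apply]

theorem Km_sum (m : ℕ) (Q : F) (x : Fin (2*n)) (f : Fin (2*n) → F) :
    ∑ i, Km n m Q x i * f i = Q ^ ke n m x * f x := by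
  simp [Km, Matrix.diagonal_apply]

/-- The coproduct of the Chevalley generator on functions. -/
theorem Dl_mulVec {m : ℕ} (hm : m + 1 < 2*n) (Q : F) (f : Fin (2*n) × Fin (2*n) → F)
    (x y : Fin (2*n)) :
    (Am n m ⊗ₖ Km n m Q + 1 ⊗ₖ Am n m).mulVec f (x, y)
      = al n m x * Q ^ ke n m y * f (pd x, y) + al n m y * f (x, pd y) := by
  rw [Matrix.add_mulVec, Pi.add_apply, kr_mulVec, kr_mulVec]
  simp only [Am_sum hm, one_sum, Km_sum]
  ring

theorem Dr_mulVec {m : ℕ} (hm : m + 1 < 2*n) (Q : F) (f : Fin (2*n) × Fin (2*n) → F)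
    (x y : Fin (2*n)) :
    (Am n m ⊗ₖ 1 + Km n m Q ⊗ₖ Am n m).mulVec f (x, y)
      = al n m x * f (pd x, y) + Q ^ ke n m x * al n m y * f (x, pd y) := by
  rw [Matrix.add_mulVec, Pi.add_apply, kr_mulVec, kr_mulVec]
  simp only [Am_sum hm, one_sum, Km_sum]
  ring

theorem al_zero {m : ℕ} (hm : m + 1 < 2*n) {x : Fin (2*n)} (hx : x.val = 0) : al n m x = 0 := by
  by_contra h; have := al_supp h; omega

/-- The telescoping sum. -/
theorem tele {m : ℕ} {Q : F} (hQ : Q ≠ 0) (hm : m + 1 < 2*n) (f : Fin (2*n) × Fin (2*n) → F)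
    (x : Fin (2*n)) :
    ∑ s, (if x < s then pp n Q (pr n s) * (al n m s * Q ^ ke n m (pr n s) * f (pd s, pr n s)
        + al n m (pr n s) * f (s, pd (pr n s))) else 0)
      = - (pp n Q (pr n x) * al n m (pr n x) * f (x, pd (pr n x))) := by
  have hx := x.isLt
  let G : ℕ → F := fun r => if h : r < 2*n then
    pp n Q (pr n ⟨r, h⟩) * al n m (pr n ⟨r, h⟩) * f (⟨r, h⟩, pd (pr n ⟨r, h⟩)) else 0
  have hG : ∀ s : Fin (2*n), G s.val = pp n Q (pr n s) * al n m (pr n s) * f (s, pd (pr n s)) := by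
    intro s; simp only [G]; rw [dif_pos s.isLt]
  have := sum_telescope (2*n) G x.val hx
  rw [hG x] at this
  have hl : G (2*n-1) = 0 := by
    have h2 := hG ⟨2*n-1, by omega⟩
    simp only at h2
    rw [h2, al_zero hm (by simp only [pr_val]; omega)]; simp
  rw [hl, zero_sub] at this
  rw [← this]
  refine Finset.sum_congr rfl fun s _ => ?_
  by_cases h : x < s
  · have h' : x.val < s.val := h
    rw [if_pos h, if_pos h', hG]
    have h3 := hG (pd s)
    rw [pd_val] at h3
    have hp : pd (pr n (pd s)) = pr n s := by
      apply Fin.ext; simp only [pr_val, pd_val]; omega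
    rw [h3, hp]
    have := cap_rel hQ hm (show 1 ≤ s.val by omega)
    linear_combination f (pd s, pr n s) * this
  · have h' : ¬ x.val < s.val := h
    rw [if_neg h, if_neg h']

theorem intertwine {m : ℕ} {Q : F} (hQ : Q ≠ 0) (hm : m + 1 < 2*n) :
    Rg n Q * (Am n m ⊗ₖ Km n m Q + 1 ⊗ₖ Am n m)
      = (Am n m ⊗ₖ 1 + Km n m Q ⊗ₖ Am n m) * Rg n Q := by
  apply Matrix.mulVec_injective
  funext f
  rw [← Matrix.mulVec_mulVec, ← Matrix.mulVec_mulVec]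
  funext ⟨x, y⟩
  rw [Rg_mulVec hQ, Dr_mulVec hm]
  simp only [Dl_mulVec hm, Rg_mulVec hQ]
  rw [tele hQ hm]
  have hxl := x.isLt
  have hyl := y.isLt
  -- terms f (pd x, y)
  have e1 : al n m x * Q ^ ke n m y * Q ^ ee n x y = al n m x * Q ^ ee n (pd x) y := by
    by_cases h : al n m x = 0
    · rw [h]; ring
    · rw [← al_ke_ee hm h, zpow_add₀ hQ]; ring
  -- terms f (y, pd x)
  have e2 : al n m x * (if pd x < y then (Q - Q⁻¹) * f (y, pd x) else 0)
      = (if x < y then (Q - Q⁻¹) * (al n m x * f (y, pd x)) else 0)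
        + (if x.val = y.val then (Q - Q⁻¹) * al n m x else 0) * f (x, pd y) := by
    by_cases h : x.val = 0
    · rw [al_zero hm h]; simp
    · simp only [Fin.lt_def, pd_val]
      rcases lt_trichotomy x.val y.val with h1 | h1 | h1
      · rw [if_pos (by omega), if_pos h1, if_neg (by omega)]; ring
      · rw [if_pos (by omega), if_neg (by omega), if_pos h1, Fin.ext h1]; ring
      · rw [if_neg (by omega), if_neg (by omega), if_neg (by omega)]; ring
  -- terms f (pd y, x)
  have e3 : Q ^ ke n m x * al n m y * (if x < pd y then (Q - Q⁻¹) * f (pd y, x) else 0)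
      + (if y.val = x.val + 1 then (Q - Q⁻¹) * Q ^ ke n m x * al n m y else 0) * f (x, pd y)
      = (if x < y then (Q - Q⁻¹) * (al n m y * Q ^ ke n m x * f (pd y, x)) else 0) := by
    simp only [Fin.lt_def, pd_val]
    rcases lt_trichotomy y.val (x.val + 1) with h1 | h1 | h1
    · rw [if_neg (by omega), if_neg (by omega), if_neg (by omega)]; ring
    · rw [if_neg (by omega), if_pos (by omega), if_pos (by omega)]
      have : pd y = x := by apply Fin.ext; rw [pd_val]; omega
      rw [this]; ring
    · rw [if_pos (by omega), if_neg (by omega), if_pos (by omega)]; ring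
  have e4 : (if y = pr n x then (Q - Q⁻¹) * pp n Q x *
        -(pp n Q (pr n x) * al n m (pr n x) * f (x, pd (pr n x))) else 0)
      = (if y.val + x.val + 1 = 2 * n then (Q - Q⁻¹) * al n m y else 0) * f (x, pd y) := by
    by_cases h : y = pr n x
    · have h' : y.val + x.val + 1 = 2*n := by rw [h, pr_val]; omega
      rw [if_pos h, if_pos h', ← h]
      have h2 := pp_mul_pr hQ x
      rw [← h] at h2
      linear_combination (-(Q - Q⁻¹) * al n m y * f (x, pd y)) * h2
    · rw [if_neg h, if_neg, zero_mul]
      intro h'; apply h; apply Fin.ext; rw [pr_val]; omega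
  set Sx := ∑ s, (if x < s then pp n Q (pr n s) * f (s, pr n s) else 0) with hSx
  set Sp := ∑ s, (if pd x < s then pp n Q (pr n s) * f (s, pr n s) else 0) with hSp
  have e5 : al n m x * (if y = pr n (pd x) then (Q - Q⁻¹) * pp n Q (pd x) * Sp else 0)
      + Q ^ ke n m x * al n m y * (if pd y = pr n x then (Q - Q⁻¹) * pp n Q x * Sx else 0)
      = (if x.val + y.val = 2*n then (Q - Q⁻¹) * al n m x * (pp n Q (pd x) * pp n Q (pr n x))
          else 0) * f (x, pd y) := by
    by_cases hx : x.val = 0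
    · have hy2 : Q ^ ke n m x * al n m y *
          (if pd y = pr n x then (Q - Q⁻¹) * pp n Q x * Sx else 0) = 0 := by
        by_cases h : pd y = pr n x
        · have := congrArg Fin.val h
          rw [pd_val, pr_val] at this
          rw [al_zero hm (show y.val = 0 by omega)]; ring
        · rw [if_neg h, mul_zero]
      rw [hy2, al_zero hm hx]; simp
    · by_cases hxy : x.val + y.val = 2*n
      · have h1 : y = pr n (pd x) := by apply Fin.ext; rw [pr_val, pd_val]; omega
        have h2 : pd y = pr n x := by apply Fin.ext; rw [pr_val, pd_val]; omega
        rw [if_pos h1, if_pos h2, if_pos hxy]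
        have hS : Sp = Sx + pp n Q (pr n x) * f (x, pd y) := by
          rw [hSp, hSx, h2]
          have : pp n Q (pr n x) * f (x, pr n x)
              = ∑ s, if s = x then pp n Q (pr n s) * f (s, pr n s) else 0 := by simp
          rw [this, ← Finset.sum_add_distrib]
          refine Finset.sum_congr rfl fun s _ => ?_
          simp only [Fin.lt_def, pd_val, Fin.ext_iff]
          rcases lt_trichotomy x.val s.val with h1 | h1 | h1
          · rw [if_pos (by omega), if_pos h1, if_neg (by omega)]; ring
          · rw [if_pos (by omega), if_neg (by omega), if_pos h1.symm]; ring
          · rw [if_neg (by omega), if_neg (by omega), if_neg (by omega)]; ring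
        have := cap_rel2 hQ hm (show 1 ≤ x.val by omega)
        rw [← h1] at this
        rw [hS]
        linear_combination (Q - Q⁻¹) * Sx * this
      · have h1 : ¬ y = pr n (pd x) := fun h => by
          have := congrArg Fin.val h; rw [pr_val, pd_val] at this; omega
        rw [if_neg h1, if_neg hxy]
        by_cases h2 : pd y = pr n x
        · have := congrArg Fin.val h2
          rw [pd_val, pr_val] at this
          rw [al_zero hm (show y.val = 0 by omega)]; ring
        · rw [if_neg h2]; ring
  have e6 := scal_id hQ hm x y
  rw [e4]
  have e7 : (if x < y then (Q - Q⁻¹) * (al n m y * Q ^ ke n m x * f (pd y, x)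
        + al n m x * f (y, pd x)) else 0)
      = (if x < y then (Q - Q⁻¹) * (al n m y * Q ^ ke n m x * f (pd y, x)) else 0)
        + (if x < y then (Q - Q⁻¹) * (al n m x * f (y, pd x)) else 0) := by
    split_ifs
    · ring
    · ring
  rw [e7]
  linear_combination f (pd x, y) * e1 - e2 - e3 - e5 + f (x, pd y) * e6

end Intertwine2

section Unitarity

open scoped Kronecker

variable {n : ℕ}

theorem Rg_transpose {Q : F} (hQ : Q ≠ 0) (i a j b : Fin (2*n)) :
    Rg n Q (j, b) (i, a) = Rg n Q (a, i) (b, j) := by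
  rw [Rg_apply hQ, Rg_apply hQ]
  congr 1
  · congr 1
    · by_cases h : j = i ∧ b = a
      · obtain ⟨rfl, rfl⟩ := h
        rw [if_pos (c := j = j ∧ b = b) ⟨rfl, rfl⟩, if_pos (c := b = b ∧ j = j) ⟨rfl, rfl⟩]
        have := ee_comm (n := n) j b
        simp only [ee] at this
        rw [this]
      · rw [if_neg h, if_neg fun h' => h ⟨h'.2.symm, h'.1.symm⟩]
    · by_cases h : j < b ∧ i = b ∧ a = j
      · rw [if_pos h, if_pos ⟨by rw [h.2.1, h.2.2]; exact h.1, h.2.1.symm, h.2.2.symm⟩]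
      · rw [if_neg h, if_neg fun h' => h ⟨by rw [h'.2.1, h'.2.2]; exact h'.1,
          h'.2.1.symm, h'.2.2.symm⟩]
  · by_cases h : j < i ∧ b = pr n j ∧ a = pr n i
    · obtain ⟨h1, rfl, rfl⟩ := h
      rw [if_pos ⟨h1, rfl, rfl⟩, if_pos ⟨pr_lt.2 h1, by simp, by simp⟩, pr_pr]; ring
    · rw [if_neg h, if_neg]
      rintro ⟨h1, rfl, rfl⟩
      exact h ⟨pr_lt.1 (by simpa using h1), by simp, by simp⟩

/-- The flip of a matrix on a tensor square. -/
def flip2 {ι : Type*} (M : Matrix (ι × ι) (ι × ι) F) : Matrix (ι × ι) (ι × ι) F :=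
  M.submatrix Prod.swap Prod.swap

theorem flip2_mul {ι : Type*} [Fintype ι] (M N : Matrix (ι × ι) (ι × ι) F) :
    flip2 (M * N) = flip2 M * flip2 N :=
  (Matrix.submatrix_mul_equiv M N Prod.swap (Equiv.prodComm ι ι) Prod.swap).symm

theorem flip2_flip2 {ι : Type*} (M : Matrix (ι × ι) (ι × ι) F) : flip2 (flip2 M) = M := by
  ext ⟨i, a⟩ ⟨j, b⟩; rfl

theorem flip2_one {ι : Type*} [DecidableEq ι] : flip2 (1 : Matrix (ι × ι) (ι × ι) F) = 1 := by
  ext ⟨i, a⟩ ⟨j, b⟩; simp [flip2, Matrix.one_apply, and_comm]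

theorem flip2_kr {ι : Type*} (A B : Matrix ι ι F) : flip2 (A ⊗ₖ B) = B ⊗ₖ A := by
  ext ⟨i, a⟩ ⟨j, b⟩; simp [flip2, mul_comm]

theorem flip2_add {ι : Type*} (M N : Matrix (ι × ι) (ι × ι) F) :
    flip2 (M + N) = flip2 M + flip2 N := rfl

theorem kr_transpose {ι : Type*} (A B : Matrix ι ι F) :
    (A ⊗ₖ B).transpose = A.transpose ⊗ₖ B.transpose := rfl

theorem Rg_transpose' {Q : F} (hQ : Q ≠ 0) : (Rg n Q).transpose = flip2 (Rg n Q) := by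
  ext ⟨i, a⟩ ⟨j, b⟩; exact Rg_transpose hQ i a j b

theorem Km_transpose (m : ℕ) (Q : F) : (Km n m Q).transpose = Km n m Q :=
  Matrix.diagonal_transpose _

theorem intertwine_b {m : ℕ} {Q : F} (hQ : Q ≠ 0) (hm : m + 1 < 2*n) :
    Rg n Q * ((Am n m).transpose ⊗ₖ Km n m Q + 1 ⊗ₖ (Am n m).transpose)
      = ((Am n m).transpose ⊗ₖ 1 + Km n m Q ⊗ₖ (Am n m).transpose) * Rg n Q := by
  have h := congrArg (fun M => flip2 (Matrix.transpose M)) (intertwine hQ hm)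
  simp only [Matrix.transpose_mul, Rg_transpose' hQ, Matrix.transpose_add, flip2_mul, flip2_flip2,
    kr_transpose, flip2_add, flip2_kr, Matrix.transpose_one, Km_transpose] at h
  rw [add_comm, ← h, add_comm]

theorem Rg_K {m : ℕ} {Q : F} (hQ : Q ≠ 0) (hm : m + 1 < 2*n) :
    Rg n Q * (Km n m Q ⊗ₖ Km n m Q) = (Km n m Q ⊗ₖ Km n m Q) * Rg n Q := by
  rw [Km, Matrix.diagonal_kronecker_diagonal]
  ext ⟨i, a⟩ ⟨j, b⟩
  rw [Matrix.mul_diagonal, Matrix.diagonal_mul]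
  simp only [← zpow_add₀ hQ]
  by_cases h : ke n m i + ke n m a = ke n m j + ke n m b
  · rw [h, mul_comm]
  · have : Rg n Q (i, a) (j, b) = 0 := by
      rw [Rg_apply hQ, if_neg, if_neg, if_neg]
      · simp
      · rintro ⟨-, rfl, rfl⟩; apply h; simp [ke_pr m hm]
      · rintro ⟨-, rfl, rfl⟩; apply h; ring
      · rintro ⟨rfl, rfl⟩; exact h rfl
    rw [this]; ring

/-- A pair (A, K) with the intertwining property, i.e. a Chevalley generator. -/
structure Chev (n : ℕ) (Q : F) (A K : Matrix (Fin (2*n)) (Fin (2*n)) F) : Prop where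
  int : Rg n Q * (A ⊗ₖ K + 1 ⊗ₖ A) = (A ⊗ₖ 1 + K ⊗ₖ A) * Rg n Q
  kk : Rg n Q * (K ⊗ₖ K) = (K ⊗ₖ K) * Rg n Q

theorem chev_a {m : ℕ} {Q : F} (hQ : Q ≠ 0) (hm : m + 1 < 2*n) :
    Chev n Q (Am n m) (Km n m Q) := ⟨intertwine hQ hm, Rg_K hQ hm⟩

theorem chev_b {m : ℕ} {Q : F} (hQ : Q ≠ 0) (hm : m + 1 < 2*n) :
    Chev n Q (Am n m).transpose (Km n m Q) := ⟨intertwine_b hQ hm, Rg_K hQ hm⟩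

theorem Km_inv {m : ℕ} {Q : F} (hQ : Q ≠ 0) : Km n m Q * Km n m Q⁻¹ = 1 := by
  rw [Km, Km, Matrix.diagonal_mul_diagonal, ← Matrix.diagonal_one]
  congr 1; funext x; rw [inv_zpow, mul_inv_cancel₀ (zpow_ne_zero _ hQ)]

theorem Km_inv' {m : ℕ} {Q : F} (hQ : Q ≠ 0) : Km n m Q⁻¹ * Km n m Q = 1 :=
  mul_eq_one_comm.1 (Km_inv hQ)

theorem Am_K {m : ℕ} {Q : F} (hQ : Q ≠ 0) (hm : m + 1 < 2*n) : ∃ c : F, c ≠ 0 ∧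
    Am n m * Km n m Q = c • Am n m := by
  refine ⟨Q ^ (if m + 1 = n then (2 : ℤ) else 1), zpow_ne_zero _ hQ, ?_⟩
  ext x y
  rw [Km, Matrix.mul_diagonal, Matrix.smul_apply, smul_eq_mul, mul_comm]
  simp only [Am]
  by_cases h : x.val = y.val + 1
  · rw [if_pos h]
    by_cases ha : al n m x = 0
    · rw [ha]; ring
    · have := al_supp ha
      congr 2
      simp only [ke]; split_ifs <;> omega
  · rw [if_neg h]; ring

theorem Km_A {m : ℕ} {Q : F} (hQ : Q ≠ 0) (hm : m + 1 < 2*n) : ∃ c : F, c ≠ 0 ∧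
    (Am n m).transpose * Km n m Q = c • (Am n m).transpose := by
  refine ⟨Q ^ (if m + 1 = n then (-2 : ℤ) else -1), zpow_ne_zero _ hQ, ?_⟩
  ext y x
  rw [Km, Matrix.mul_diagonal, Matrix.smul_apply, smul_eq_mul, mul_comm]
  simp only [Am, Matrix.transpose_apply]
  by_cases h : x.val = y.val + 1
  · rw [if_pos h]
    by_cases ha : al n m x = 0
    · rw [ha]; ring
    · have := al_supp ha
      congr 2
      simp only [ke]; split_ifs <;> omega
  · rw [if_neg h]; ring

/-- The opposite intertwining for the inverse parameter. -/
theorem int_inv {Q c : F} (hc : c ≠ 0) {A K K' : Matrix (Fin (2*n)) (Fin (2*n)) F}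
    (h1 : K * K' = 1) (h2 : K' * K = 1) (hA : A * K = c • A) (h : Chev n Q A K') :
    Rg n Q * (A ⊗ₖ 1 + K ⊗ₖ A) = (A ⊗ₖ K + 1 ⊗ₖ A) * Rg n Q := by
  have hk : Rg n Q * (K ⊗ₖ K) = (K ⊗ₖ K) * Rg n Q := by
    have e1 : (K ⊗ₖ K) * (K' ⊗ₖ K') = 1 := by
      rw [← Matrix.mul_kronecker_mul, h1, Matrix.one_kronecker_one]
    have e2 : (K' ⊗ₖ K') * (K ⊗ₖ K) = 1 := by
      rw [← Matrix.mul_kronecker_mul, h2, Matrix.one_kronecker_one]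
    calc Rg n Q * (K ⊗ₖ K) = (K ⊗ₖ K) * ((K' ⊗ₖ K') * Rg n Q) * (K ⊗ₖ K) := by
          rw [← mul_assoc, e1, one_mul]
      _ = (K ⊗ₖ K) * Rg n Q := by rw [← h.kk, mul_assoc, mul_assoc, e2, mul_one]
  have e4 : (A ⊗ₖ K' + 1 ⊗ₖ A) * (K ⊗ₖ K) = c • (A ⊗ₖ 1 + K ⊗ₖ A) := by
    rw [add_mul, ← Matrix.mul_kronecker_mul, ← Matrix.mul_kronecker_mul, h2, hA, one_mul,
      Matrix.smul_kronecker, Matrix.kronecker_smul, smul_add]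
  have e5 : (A ⊗ₖ 1 + K' ⊗ₖ A) * (K ⊗ₖ K) = c • (A ⊗ₖ K + 1 ⊗ₖ A) := by
    rw [add_mul, ← Matrix.mul_kronecker_mul, ← Matrix.mul_kronecker_mul, h2, hA, one_mul,
      Matrix.smul_kronecker, Matrix.kronecker_smul, smul_add]
  have h3 := congrArg (· * (K ⊗ₖ K)) h.int
  simp only at h3
  rw [mul_assoc, e4, mul_assoc, hk, ← mul_assoc, e5, Matrix.mul_smul, Matrix.smul_mul] at h3
  exact smul_right_injective _ hc h3

/-- basis vectors -/
def ev {ι : Type*} [DecidableEq ι] (i : ι) : ι → F := Pi.single i 1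

theorem top_of_ev {ι : Type*} [Fintype ι] [DecidableEq ι] (N : Submodule F (ι → F))
    (h : ∀ i, ev i ∈ N) : ∀ v, v ∈ N := by
  intro v
  have : v = ∑ i, v i • ev i := by
    funext j; simp [ev, Pi.single_apply]
  rw [this]
  exact N.sum_mem fun i _ => N.smul_mem _ (h i)

theorem kr_ev {ι κ : Type*} [Fintype ι] [Fintype κ] [DecidableEq ι] [DecidableEq κ]
    (A : Matrix ι ι F) (B : Matrix κ κ F) (i : ι) (j : κ) :
    (A ⊗ₖ B).mulVec (ev (i, j)) = fun p => A.mulVec (ev i) p.1 * B.mulVec (ev j) p.2 := by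
  funext ⟨x, y⟩
  simp [ev]

theorem Am_ev {m : ℕ} (y : Fin (2*n)) (hy : y.val + 1 < 2*n) :
    (Am n m).mulVec (ev y) = al n m ⟨y.val+1, hy⟩ • ev ⟨y.val+1, hy⟩ := by
  funext x
  simp only [ev, Matrix.mulVec_single_one, Matrix.col_apply, Am, Pi.smul_apply, Pi.single_apply,
    Fin.ext_iff, smul_eq_mul]
  by_cases h : x.val = y.val + 1
  · rw [if_pos h, if_pos h]
    have : x = ⟨y.val+1, hy⟩ := Fin.ext h
    rw [← this, mul_one]
  · rw [if_neg h, if_neg h, mul_zero]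

theorem AmT_ev {m : ℕ} (y : Fin (2*n)) (hy : 0 < y.val) :
    (Am n m).transpose.mulVec (ev y) = al n m y • ev (pd y) := by
  funext x
  simp only [ev, Matrix.mulVec_single_one, Matrix.col_apply, Am, Pi.smul_apply, Pi.single_apply,
    Fin.ext_iff, smul_eq_mul, Matrix.transpose_apply, pd_val]
  by_cases h : y.val = x.val + 1
  · rw [if_pos h, if_pos (by omega), mul_one]
  · rw [if_neg h, if_neg (by omega), mul_zero]

theorem AmT_ev0 {m : ℕ} (y : Fin (2*n)) (hy : y.val = 0) :
    (Am n m).transpose.mulVec (ev y) = 0 := by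
  funext x
  simp only [ev, Matrix.mulVec_single_one, Matrix.col_apply, Am, Matrix.transpose_apply]
  rw [if_neg (by omega)]; rfl

theorem Km_ev {m : ℕ} {Q : F} (y : Fin (2*n)) :
    (Km n m Q).mulVec (ev y) = Q ^ ke n m y • ev y := by
  funext x
  simp only [ev, Matrix.mulVec_single_one, Matrix.col_apply, Km, Matrix.diagonal_apply,
    Pi.smul_apply, Pi.single_apply, smul_eq_mul]
  by_cases h : x = y
  · rw [if_pos h, if_pos h, h, mul_one]
  · rw [if_neg h, if_neg h, mul_zero]

theorem one_ev {ι : Type*} [Fintype ι] [DecidableEq ι] (i : ι) :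
    (1 : Matrix ι ι F).mulVec (ev i) = ev i := Matrix.one_mulVec _

theorem ev_mul {ι κ : Type*} [DecidableEq ι] [DecidableEq κ] (i : ι) (j : κ) :
    (fun p : ι × κ => (ev i p.1 : F) * ev j p.2) = ev (i, j) := by
  funext ⟨x, y⟩
  simp only [ev, Pi.single_apply, Prod.mk.injEq]
  by_cases h : x = i <;> simp [h]

theorem al_ne {m : ℕ} (x : Fin (2*n)) (h : x.val = m + 1) : al n m x ≠ 0 := by
  simp only [al]; rw [if_pos h]
  split_ifs with h1 h2
  · norm_num
  · omega
  · norm_num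

/-- Generation of the tensor square. -/
theorem gen2 (hn : 0 < n) {Q : F} (hQ : Q ≠ 0)
    (N : Submodule F (Fin (2*n) × Fin (2*n) → F))
    (hA : ∀ m, m + 1 < 2*n → ∀ v ∈ N, (Am n m ⊗ₖ Km n m Q + 1 ⊗ₖ Am n m).mulVec v ∈ N)
    (hB : ∀ m, m + 1 < 2*n → ∀ v ∈ N, ((Am n m).transpose ⊗ₖ Km n m Q
      + 1 ⊗ₖ (Am n m).transpose).mulVec v ∈ N)
    (h0 : ev (⟨0, by omega⟩, ⟨2*n-1, by omega⟩) ∈ N) : ∀ v, v ∈ N := by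
  have s1 : ∀ k : ℕ, ∀ y : Fin (2*n), y.val + k + 1 = 2*n → ev (⟨0, by omega⟩, y) ∈ N := by
    intro k
    induction k with
    | zero =>
      intro y hy
      have : y = ⟨2*n-1, by omega⟩ := Fin.ext (by simp only; omega)
      rw [this]; exact h0
    | succ k ih =>
      intro y hy
      have h := hB y.val (by omega) _ (ih ⟨y.val+1, by omega⟩ (by simp only; omega))
      rw [Matrix.add_mulVec, kr_ev, kr_ev, AmT_ev0 _ rfl, one_ev, AmT_ev _ (by simp)] at h
      have hp : pd (⟨y.val+1, by omega⟩ : Fin (2*n)) = y := Fin.ext (by simp [pd_val])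
      rw [hp] at h
      have e : ((fun p : Fin (2*n) × Fin (2*n) => (0 : Fin (2*n) → F) p.1 *
            (Km n y.val Q).mulVec (ev ⟨y.val+1, by omega⟩) p.2)
          + fun p : Fin (2*n) × Fin (2*n) => ev (⟨0, by omega⟩ : Fin (2*n)) p.1 *
            (al n y.val ⟨y.val+1, by omega⟩ • ev y) p.2)
          = al n y.val ⟨y.val+1, by omega⟩ • ev (⟨0, by omega⟩, y) := by
        rw [← ev_mul]; funext p; simp; ring
      rw [e] at h
      exact (N.smul_mem_iff (al_ne _ rfl)).1 h
  have s2 : ∀ k : ℕ, ∀ x y : Fin (2*n), x.val = k → ev (x, y) ∈ N := by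
    intro k
    induction k with
    | zero =>
      intro x y hx
      have : x = ⟨0, by omega⟩ := Fin.ext hx
      rw [this]; exact s1 (2*n-1-y.val) y (by omega)
    | succ k ih =>
      intro x y hx
      have h := hA k (by omega) _ (ih ⟨k, by omega⟩ y rfl)
      rw [Matrix.add_mulVec, kr_ev, kr_ev, one_ev, Am_ev _ (by simp only; omega), Km_ev] at h
      have hx' : (⟨k + 1, by omega⟩ : Fin (2*n)) = x := Fin.ext hx.symm
      simp only [hx'] at h
      have h2 : (fun p : Fin (2*n) × Fin (2*n) => ev (⟨k, by omega⟩ : Fin (2*n)) p.1 *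
          (Am n k).mulVec (ev y) p.2) ∈ N := by
        by_cases hy : y.val + 1 < 2*n
        · rw [Am_ev _ hy]
          have := N.smul_mem (al n k ⟨y.val+1, hy⟩) (ih ⟨k, by omega⟩ ⟨y.val+1, hy⟩ rfl)
          rw [← ev_mul] at this
          convert this using 1
          funext p; simp; ring
        · have : (Am n k).mulVec (ev y) = 0 := by
            funext x
            simp only [ev, Matrix.mulVec_single_one, Matrix.col_apply, Am]
            rw [if_neg (by omega)]; rfl
          rw [this]; convert N.zero_mem using 1; funext p; simp
      have h3 := (N.add_mem_iff_left h2).1 h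
      have e : (fun p : Fin (2*n) × Fin (2*n) => (al n k x • ev x) p.1 * (Q ^ ke n k y • ev y) p.2)
          = (al n k x * Q ^ ke n k y) • ev (x, y) := by
        rw [← ev_mul]; funext p; simp; ring
      rw [e] at h3
      exact (N.smul_mem_iff (mul_ne_zero (al_ne _ hx) (zpow_ne_zero _ hQ))).1 h3
  exact top_of_ev N fun ⟨x, y⟩ => s2 _ x y rfl

theorem Rg_ev0 (hn : 0 < n) {Q : F} (hQ : Q ≠ 0) :
    (Rg n Q).mulVec (ev (⟨0, by omega⟩, ⟨2*n-1, by omega⟩))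
      = Q⁻¹ • ev (⟨0, by omega⟩, ⟨2*n-1, by omega⟩) := by
  funext ⟨x, y⟩
  simp only [ev, Matrix.mulVec_single_one, Matrix.col_apply, Pi.smul_apply, smul_eq_mul,
    Pi.single_apply, Prod.mk.injEq]
  have hx := x.isLt
  rw [Rg_apply hQ, if_neg (c := x < y ∧ _), if_neg (c := x < _ ∧ _)]
  · by_cases h : x = ⟨0, by omega⟩ ∧ y = ⟨2*n-1, by omega⟩
    · rw [if_pos h, if_pos h, h.1, h.2, if_neg, if_pos]
      · simp
      · apply Fin.ext; simp [pr_val]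
      · simp only [Fin.mk.injEq]; omega
    · rw [if_neg h, if_neg h]; simp
  · rintro ⟨h, -⟩; simp [Fin.lt_def] at h
  · rintro ⟨h, rfl, rfl⟩; simp [Fin.lt_def] at h

theorem unitarity {Q : F} (hQ : Q ≠ 0) : Rg n Q⁻¹ * Rg n Q = 1 := by
  rcases Nat.eq_zero_or_pos n with rfl | hn
  · ext ⟨x, y⟩; exact absurd x.isLt (by omega)
  have hQi : Q⁻¹ ≠ 0 := inv_ne_zero hQ
  let N : Submodule F (Fin (2*n) × Fin (2*n) → F) :=
    LinearMap.ker (Matrix.toLin' (Rg n Q⁻¹ * Rg n Q - 1))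
  have hN : ∀ v, v ∈ N ↔ (Rg n Q⁻¹ * Rg n Q - 1).mulVec v = 0 := by
    intro v; simp only [N, LinearMap.mem_ker, Matrix.toLin'_apply]
  have key : ∀ D D' : Matrix (Fin (2*n) × Fin (2*n)) (Fin (2*n) × Fin (2*n)) F,
      Rg n Q * D = D' * Rg n Q → Rg n Q⁻¹ * D' = D * Rg n Q⁻¹ →
      ∀ v ∈ N, D.mulVec v ∈ N := by
    intro D D' h1 h2 v hv
    rw [hN] at hv ⊢
    have : (Rg n Q⁻¹ * Rg n Q - 1) * D = D * (Rg n Q⁻¹ * Rg n Q - 1) := by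
      rw [sub_mul, mul_sub, mul_assoc, h1, ← mul_assoc, h2, mul_assoc, one_mul, mul_one]
    rw [Matrix.mulVec_mulVec, this, ← Matrix.mulVec_mulVec, hv, Matrix.mulVec_zero]
  have hall : ∀ v, v ∈ N := by
    apply gen2 hn hQ N
    · intro m hm
      obtain ⟨c, hc, hA⟩ := Am_K (n := n) hQ hm
      exact key _ _ (intertwine hQ hm)
        (int_inv hc (Km_inv hQ) (Km_inv' hQ) hA (chev_a hQi hm))
    · intro m hm
      obtain ⟨c, hc, hA⟩ := Km_A (n := n) hQ hm
      exact key _ _ (intertwine_b hQ hm)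
        (int_inv hc (Km_inv hQ) (Km_inv' hQ) hA (chev_b hQi hm))
    · rw [hN, Matrix.sub_mulVec, ← Matrix.mulVec_mulVec, Rg_ev0 hn hQ, Matrix.mulVec_smul,
        Rg_ev0 hn hQi, smul_smul, inv_inv, inv_mul_cancel₀ hQ, one_smul, Matrix.one_mulVec,
        sub_self]
  have : Rg n Q⁻¹ * Rg n Q - 1 = 0 := by
    apply Matrix.mulVec_injective
    funext v
    rw [(hN v).1 (hall v), Matrix.zero_mulVec]
  exact sub_eq_zero.1 this

end Unitarity


section YBE

open scoped Kronecker

variable {n : ℕ} {ι : Type*} [Fintype ι] [DecidableEq ι]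

/-- Embeddings of matrices on the tensor square into the tensor cube. -/
def e12 (M : Matrix (ι × ι) (ι × ι) F) : Matrix ((ι × ι) × ι) ((ι × ι) × ι) F := M ⊗ₖ 1

def sg13 : ((ι × ι) × ι) ≃ ((ι × ι) × ι) where
  toFun p := ((p.1.1, p.2), p.1.2)
  invFun p := ((p.1.1, p.2), p.1.2)
  left_inv _ := rfl
  right_inv _ := rfl

def sg23 : ((ι × ι) × ι) ≃ ((ι × ι) × ι) where
  toFun p := ((p.1.2, p.2), p.1.1)
  invFun p := ((p.2, p.1.1), p.1.2)
  left_inv _ := rfl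
  right_inv _ := rfl

def e13 (M : Matrix (ι × ι) (ι × ι) F) : Matrix ((ι × ι) × ι) ((ι × ι) × ι) F :=
  (e12 M).submatrix sg13 sg13

def e23 (M : Matrix (ι × ι) (ι × ι) F) : Matrix ((ι × ι) × ι) ((ι × ι) × ι) F :=
  (e12 M).submatrix sg23 sg23

theorem e12_mul (M N : Matrix (ι × ι) (ι × ι) F) : e12 (M * N) = e12 M * e12 N := by
  rw [e12, e12, e12, ← Matrix.mul_kronecker_mul, one_mul]

theorem e13_mul (M N : Matrix (ι × ι) (ι × ι) F) : e13 (M * N) = e13 M * e13 N := by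
  rw [e13, e12_mul, ← Matrix.submatrix_mul_equiv _ _ _ sg13]; rfl

theorem e23_mul (M N : Matrix (ι × ι) (ι × ι) F) : e23 (M * N) = e23 M * e23 N := by
  rw [e23, e12_mul, ← Matrix.submatrix_mul_equiv _ _ _ sg23]; rfl

theorem e12_add (M N : Matrix (ι × ι) (ι × ι) F) : e12 (M + N) = e12 M + e12 N :=
  Matrix.add_kronecker _ _ _
theorem e13_add (M N : Matrix (ι × ι) (ι × ι) F) : e13 (M + N) = e13 M + e13 N := by
  rw [e13, e12_add]; rfl
theorem e23_add (M N : Matrix (ι × ι) (ι × ι) F) : e23 (M + N) = e23 M + e23 N := by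
  rw [e23, e12_add]; rfl

theorem e12_one : e12 (1 : Matrix (ι × ι) (ι × ι) F) = 1 := Matrix.one_kronecker_one
theorem e13_one : e13 (1 : Matrix (ι × ι) (ι × ι) F) = 1 := by
  rw [e13, e12_one, Matrix.submatrix_one_equiv]
theorem e23_one : e23 (1 : Matrix (ι × ι) (ι × ι) F) = 1 := by
  rw [e23, e12_one, Matrix.submatrix_one_equiv]

/-- Single-slot embeddings. -/
def f1 (A : Matrix ι ι F) : Matrix ((ι × ι) × ι) ((ι × ι) × ι) F := (A ⊗ₖ 1) ⊗ₖ 1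
def f2 (A : Matrix ι ι F) : Matrix ((ι × ι) × ι) ((ι × ι) × ι) F := (1 ⊗ₖ A) ⊗ₖ 1
def f3 (A : Matrix ι ι F) : Matrix ((ι × ι) × ι) ((ι × ι) × ι) F := (1 ⊗ₖ 1) ⊗ₖ A

theorem e12_kr (A B : Matrix ι ι F) : e12 (A ⊗ₖ B) = f1 A * f2 B := by
  rw [f1, f2, ← Matrix.mul_kronecker_mul, ← Matrix.mul_kronecker_mul, one_mul, one_mul, mul_one]; rfl

theorem e13_kr (A B : Matrix ι ι F) : e13 (A ⊗ₖ B) = f1 A * f3 B := by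
  rw [f1, f3, ← Matrix.mul_kronecker_mul, ← Matrix.mul_kronecker_mul, one_mul, one_mul, mul_one]
  ext ⟨⟨i, a⟩, x⟩ ⟨⟨j, b⟩, y⟩
  simp [e13, e12, sg13]; ring

theorem e23_kr (A B : Matrix ι ι F) : e23 (A ⊗ₖ B) = f2 A * f3 B := by
  rw [f2, f3, ← Matrix.mul_kronecker_mul, ← Matrix.mul_kronecker_mul, one_mul, one_mul, mul_one]
  ext ⟨⟨i, a⟩, x⟩ ⟨⟨j, b⟩, y⟩
  simp [e23, e12, sg23]; ring

theorem f1_one : f1 (1 : Matrix ι ι F) = 1 := by simp [f1]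
theorem f2_one : f2 (1 : Matrix ι ι F) = 1 := by simp [f2]
theorem f3_one : f3 (1 : Matrix ι ι F) = 1 := by simp [f3]

theorem f12 (A B : Matrix ι ι F) : f1 A * f2 B = f2 B * f1 A := by
  simp only [f1, f2, ← Matrix.mul_kronecker_mul, one_mul, mul_one]
theorem f13 (A B : Matrix ι ι F) : f1 A * f3 B = f3 B * f1 A := by
  simp only [f1, f3, ← Matrix.mul_kronecker_mul, one_mul, mul_one]
theorem f23 (A B : Matrix ι ι F) : f2 A * f3 B = f3 B * f2 A := by
  simp only [f2, f3, ← Matrix.mul_kronecker_mul, one_mul, mul_one]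

theorem e12_f3 (M : Matrix (ι × ι) (ι × ι) F) (A : Matrix ι ι F) :
    e12 M * f3 A = f3 A * e12 M := by
  simp only [e12, f3, ← Matrix.mul_kronecker_mul, Matrix.one_kronecker_one, one_mul, mul_one]

theorem e13_f2 (M : Matrix (ι × ι) (ι × ι) F) (A : Matrix ι ι F) :
    e13 M * f2 A = f2 A * e13 M := by
  have h : f2 A = (f3 A).submatrix sg13 sg13 := by
    ext ⟨⟨i, a⟩, x⟩ ⟨⟨j, b⟩, y⟩
    simp [f2, f3, sg13, Matrix.one_apply]
    split_ifs <;> simp_all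
  rw [h, e13, Matrix.submatrix_mul_equiv, Matrix.submatrix_mul_equiv, e12_f3]

theorem e23_f1 (M : Matrix (ι × ι) (ι × ι) F) (A : Matrix ι ι F) :
    e23 M * f1 A = f1 A * e23 M := by
  have h : f1 A = (f3 A).submatrix sg23 sg23 := by
    ext ⟨⟨i, a⟩, x⟩ ⟨⟨j, b⟩, y⟩
    simp [f1, f3, sg23, Matrix.one_apply]
    split_ifs <;> simp_all
  rw [h, e23, Matrix.submatrix_mul_equiv, Matrix.submatrix_mul_equiv, e12_f3]

/-- The iterated coproduct. -/
def D3 (A K : Matrix ι ι F) : Matrix ((ι × ι) × ι) ((ι × ι) × ι) F :=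
  f1 A * f2 K * f3 K + f2 A * f3 K + f3 A

def D3op (A K : Matrix ι ι F) : Matrix ((ι × ι) × ι) ((ι × ι) × ι) F :=
  f1 A + f1 K * f2 A + f1 K * f2 K * f3 A

theorem ybe_int1 {Q : F} {A K : Matrix (Fin (2*n)) (Fin (2*n)) F} (h : Chev n Q A K) :
    e12 (Rg n Q) * e13 (Rg n Q) * e23 (Rg n Q) * D3 A K
      = D3op A K * (e12 (Rg n Q) * e13 (Rg n Q) * e23 (Rg n Q)) := by
  have i12 := congrArg e12 h.int
  have i13 := congrArg e13 h.int
  have i23 := congrArg e23 h.int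
  have k12 := congrArg e12 h.kk
  have k23 := congrArg e23 h.kk
  simp only [e12_mul, e13_mul, e23_mul, e12_add, e13_add, e23_add, e12_kr, e13_kr, e23_kr, f1_one,
    f2_one, f3_one, one_mul, mul_one] at i12 i13 i23 k12 k23
  set r12 := e12 (Rg n Q)
  set r13 := e13 (Rg n Q)
  set r23 := e23 (Rg n Q)
  have c1 : r23 * f1 A = f1 A * r23 := e23_f1 _ _
  have c2 : r13 * f2 A = f2 A * r13 := e13_f2 _ _
  have c3 : r13 * f2 K = f2 K * r13 := e13_f2 _ _
  have c4 : r12 * f3 A = f3 A * r12 := e12_f3 _ _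
  have s1 : r23 * D3 A K = (f2 K * (f1 A * f3 K + f3 A) + f2 A) * r23 := by
    calc r23 * D3 A K = r23 * f1 A * (f2 K * f3 K) + r23 * (f2 A * f3 K + f3 A) := by
          rw [D3]; noncomm_ring
      _ = f1 A * (r23 * (f2 K * f3 K)) + (f2 A + f2 K * f3 A) * r23 := by rw [c1, i23]; noncomm_ring
      _ = f1 A * f2 K * f3 K * r23 + (f2 A + f2 K * f3 A) * r23 := by rw [k23]; noncomm_ring
      _ = _ := by rw [f12]; noncomm_ring
  have s2 : r13 * (f2 K * (f1 A * f3 K + f3 A) + f2 A)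
      = (f1 A * f2 K + f2 A + f1 K * f2 K * f3 A) * r13 := by
    calc r13 * (f2 K * (f1 A * f3 K + f3 A) + f2 A)
        = r13 * f2 K * (f1 A * f3 K + f3 A) + r13 * f2 A := by noncomm_ring
      _ = f2 K * (r13 * (f1 A * f3 K + f3 A)) + f2 A * r13 := by rw [c2, c3]; noncomm_ring
      _ = f2 K * f1 A * r13 + f2 K * f1 K * f3 A * r13 + f2 A * r13 := by rw [i13]; noncomm_ring
      _ = _ := by rw [← f12, ← f12]; noncomm_ring
  have s3 : r12 * (f1 A * f2 K + f2 A + f1 K * f2 K * f3 A) = D3op A K * r12 := by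
    calc r12 * (f1 A * f2 K + f2 A + f1 K * f2 K * f3 A)
        = r12 * (f1 A * f2 K + f2 A) + r12 * (f1 K * f2 K) * f3 A := by noncomm_ring
      _ = (f1 A + f1 K * f2 A) * r12 + f1 K * f2 K * (r12 * f3 A) := by rw [i12, k12]; noncomm_ring
      _ = _ := by rw [c4, D3op]; noncomm_ring
  rw [mul_assoc, s1, mul_assoc, ← mul_assoc r13, s2, mul_assoc _ r13, ← mul_assoc r12, s3]
  noncomm_ring

theorem ybe_int2 {Q : F} {A K : Matrix (Fin (2*n)) (Fin (2*n)) F} (h : Chev n Q A K) :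
    e23 (Rg n Q) * e13 (Rg n Q) * e12 (Rg n Q) * D3 A K
      = D3op A K * (e23 (Rg n Q) * e13 (Rg n Q) * e12 (Rg n Q)) := by
  have i12 := congrArg e12 h.int
  have i13 := congrArg e13 h.int
  have i23 := congrArg e23 h.int
  have k13 := congrArg e13 h.kk
  simp only [e12_mul, e13_mul, e23_mul, e12_add, e13_add, e23_add, e12_kr, e13_kr, e23_kr, f1_one,
    f2_one, f3_one, one_mul, mul_one] at i12 i13 i23 k13
  set r12 := e12 (Rg n Q)
  set r13 := e13 (Rg n Q)
  set r23 := e23 (Rg n Q)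
  have c1 : r23 * f1 A = f1 A * r23 := e23_f1 _ _
  have c1' : r23 * f1 K = f1 K * r23 := e23_f1 _ _
  have c2 : r13 * f2 A = f2 A * r13 := e13_f2 _ _
  have c4 : r12 * f3 A = f3 A * r12 := e12_f3 _ _
  have c5 : r12 * f3 K = f3 K * r12 := e12_f3 _ _
  have s1 : r12 * D3 A K = (f1 A * f3 K + f3 A + f2 A * (f1 K * f3 K)) * r12 := by
    calc r12 * D3 A K = r12 * (f1 A * f2 K + f2 A) * f3 K + r12 * f3 A := by
          rw [D3]; noncomm_ring
      _ = (f1 A + f1 K * f2 A) * (r12 * f3 K) + f3 A * r12 := by rw [i12, c4]; noncomm_ring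
      _ = _ := by rw [c5, f12]; noncomm_ring
  have s2 : r13 * (f1 A * f3 K + f3 A + f2 A * (f1 K * f3 K))
      = (f1 A + f1 K * (f2 A * f3 K + f3 A)) * r13 := by
    calc r13 * (f1 A * f3 K + f3 A + f2 A * (f1 K * f3 K))
        = r13 * (f1 A * f3 K + f3 A) + r13 * f2 A * (f1 K * f3 K) := by noncomm_ring
      _ = (f1 A + f1 K * f3 A) * r13 + f2 A * (r13 * (f1 K * f3 K)) := by
          rw [c2, i13]; noncomm_ring
      _ = (f1 A + f1 K * f3 A) * r13 + (f2 A * f1 K) * f3 K * r13 := by rw [k13]; noncomm_ring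
      _ = _ := by rw [← f12]; noncomm_ring
  have s3 : r23 * (f1 A + f1 K * (f2 A * f3 K + f3 A)) = D3op A K * r23 := by
    calc r23 * (f1 A + f1 K * (f2 A * f3 K + f3 A))
        = r23 * f1 A + r23 * f1 K * (f2 A * f3 K + f3 A) := by noncomm_ring
      _ = f1 A * r23 + f1 K * (r23 * (f2 A * f3 K + f3 A)) := by rw [c1, c1']; noncomm_ring
      _ = _ := by rw [i23, D3op]; noncomm_ring
  rw [mul_assoc, s1, mul_assoc, ← mul_assoc r13, s2, mul_assoc _ r13, ← mul_assoc r23, s3]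
  noncomm_ring

end YBE

section YBE2

open scoped Kronecker

variable {n : ℕ} {ι : Type*} [Fintype ι] [DecidableEq ι]

theorem D3_kr (A K : Matrix ι ι F) :
    D3 A K = (A ⊗ₖ K) ⊗ₖ K + (1 ⊗ₖ A) ⊗ₖ K + (1 ⊗ₖ 1) ⊗ₖ A := by
  simp only [D3, f1, f2, f3, ← Matrix.mul_kronecker_mul, one_mul, mul_one]

/-- Tensor product of three vectors. -/
def tv (u v w : ι → F) : (ι × ι) × ι → F := fun p => u p.1.1 * v p.1.2 * w p.2

theorem kr_tv (A B C : Matrix ι ι F) (u v w : ι → F) :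
    ((A ⊗ₖ B) ⊗ₖ C).mulVec (tv u v w) = tv (A.mulVec u) (B.mulVec v) (C.mulVec w) := by
  funext ⟨⟨x, y⟩, z⟩
  simp only [Matrix.mulVec, dotProduct, Fintype.sum_prod_type, Matrix.kroneckerMap_apply, tv]
  rw [Finset.sum_mul_sum, Finset.sum_mul]
  refine Finset.sum_congr rfl fun i _ => ?_
  rw [Finset.sum_mul]
  refine Finset.sum_congr rfl fun j _ => ?_
  rw [Finset.mul_sum]
  refine Finset.sum_congr rfl fun k _ => ?_
  ring

theorem tv_ev (x y z : ι) : tv (ev x) (ev y) (ev z) = ev ((x, y), z) := by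
  funext ⟨⟨a, b⟩, c⟩
  simp only [tv, ev, Pi.single_apply, Prod.mk.injEq]
  by_cases h : a = x <;> by_cases h2 : b = y <;> by_cases h3 : c = z <;> simp [h, h2, h3]

theorem tv_mem (N : Submodule F ((ι × ι) × ι → F)) (x : ι)
    (h : ∀ y z, ev ((x, y), z) ∈ N) (v w : ι → F) : tv (ev x) v w ∈ N := by
  have : tv (ev x) v w = ∑ y, ∑ z, (v y * w z) • ev ((x, y), z) := by
    funext ⟨⟨a, b⟩, c⟩
    simp only [← tv_ev, Finset.sum_apply, Pi.smul_apply, smul_eq_mul, tv]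
    simp [ev, Pi.single_apply]
  rw [this]
  exact N.sum_mem fun y _ => N.sum_mem fun z _ => N.smul_mem _ (h y z)

theorem tv_mem2 (N : Submodule F ((ι × ι) × ι → F)) (x z : ι)
    (h : ∀ y, ev ((x, y), z) ∈ N) (v : ι → F) : tv (ev x) v (ev z) ∈ N := by
  have : tv (ev x) v (ev z) = ∑ y, v y • ev ((x, y), z) := by
    funext ⟨⟨a, b⟩, c⟩
    simp only [← tv_ev, Finset.sum_apply, Pi.smul_apply, smul_eq_mul, tv]
    simp [ev, Pi.single_apply]
  rw [this]
  exact N.sum_mem fun y _ => N.smul_mem _ (h y)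

theorem tv_smul1 (c : F) (u v w : ι → F) : tv (c • u) v w = c • tv u v w := by
  funext p; simp only [tv, Pi.smul_apply, smul_eq_mul]; ring
theorem tv_smul2 (c : F) (u v w : ι → F) : tv u (c • v) w = c • tv u v w := by
  funext p; simp only [tv, Pi.smul_apply, smul_eq_mul]; ring
theorem tv_smul3 (c : F) (u v w : ι → F) : tv u v (c • w) = c • tv u v w := by
  funext p; simp only [tv, Pi.smul_apply, smul_eq_mul]; ring
theorem tv_zero1 (v w : ι → F) : tv 0 v w = 0 := by
  funext p; simp [tv]

theorem gen3 (hn : 0 < n) {Q : F} (hQ : Q ≠ 0)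
    (N : Submodule F ((Fin (2*n) × Fin (2*n)) × Fin (2*n) → F))
    (hA : ∀ m, m + 1 < 2*n → ∀ v ∈ N, (D3 (Am n m) (Km n m Q)).mulVec v ∈ N)
    (hB : ∀ m, m + 1 < 2*n → ∀ v ∈ N, (D3 (Am n m).transpose (Km n m Q)).mulVec v ∈ N)
    (h0 : ∀ l, ev ((⟨0, by omega⟩, l), ⟨2*n-1, by omega⟩) ∈ N) : ∀ v, v ∈ N := by
  have s1 : ∀ k : ℕ, ∀ z : Fin (2*n), z.val + k + 1 = 2*n → ∀ l,
      ev ((⟨0, by omega⟩, l), z) ∈ N := by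
    intro k
    induction k with
    | zero =>
      intro z hz
      have : z = ⟨2*n-1, by omega⟩ := Fin.ext (by simp only; omega)
      rw [this]; exact h0
    | succ k ih =>
      intro z hz l
      have hi := ih ⟨z.val+1, by omega⟩ (by simp only; omega)
      have h := hB z.val (by omega) _ (hi l)
      rw [← tv_ev, D3_kr, Matrix.add_mulVec, Matrix.add_mulVec, kr_tv, kr_tv, kr_tv,
        AmT_ev0 _ rfl, one_ev, one_ev, AmT_ev ⟨z.val+1, by omega⟩ (by simp), tv_zero1, zero_add,
        Km_ev, tv_smul3, tv_smul3] at h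
      have hp : pd (⟨z.val+1, by omega⟩ : Fin (2*n)) = z := Fin.ext (by simp [pd_val])
      rw [hp] at h
      have h2 := (N.add_mem_iff_right (N.smul_mem _ (tv_mem2 N _ _ hi _))).1 h
      rw [tv_ev] at h2
      exact (N.smul_mem_iff (al_ne _ rfl)).1 h2
  have s2 : ∀ k : ℕ, ∀ x y z : Fin (2*n), x.val = k → ev ((x, y), z) ∈ N := by
    intro k
    induction k with
    | zero =>
      intro x y z hx
      have : x = ⟨0, by omega⟩ := Fin.ext hx
      rw [this]; exact s1 (2*n-1-z.val) z (by omega) y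
    | succ k ih =>
      intro x y z hx
      have hi : ∀ y z, ev ((⟨k, by omega⟩, y), z) ∈ N := fun y z => ih ⟨k, by omega⟩ y z rfl
      have h := hA k (by omega) _ (hi y z)
      rw [← tv_ev, D3_kr, Matrix.add_mulVec, Matrix.add_mulVec, kr_tv, kr_tv, kr_tv,
        one_ev, add_assoc] at h
      have h2 := (N.add_mem_iff_left (N.add_mem (tv_mem N _ hi _ _) (tv_mem N _ hi _ _))).1 h
      rw [Am_ev _ (by simp only; omega), Km_ev, Km_ev, tv_smul1, tv_smul2, tv_smul3] at h2
      have hx' : (⟨k + 1, by omega⟩ : Fin (2*n)) = x := Fin.ext hx.symm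
      simp only [hx'] at h2
      rw [tv_ev, N.smul_mem_iff (al_ne _ hx), N.smul_mem_iff (zpow_ne_zero _ hQ),
        N.smul_mem_iff (zpow_ne_zero _ hQ)] at h2
      exact h2
  exact top_of_ev N fun ⟨⟨x, y⟩, z⟩ => s2 _ x y z rfl

theorem Rg_evL (hn : 0 < n) {Q : F} (hQ : Q ≠ 0) (l : Fin (2*n)) :
    (Rg n Q).mulVec (ev (⟨0, by omega⟩, l))
      = Q ^ (ee n ⟨0, by omega⟩ l) • ev (⟨0, by omega⟩, l) := by
  funext ⟨x, y⟩
  simp only [ev, Matrix.mulVec_single_one, Matrix.col_apply, Pi.smul_apply, smul_eq_mul,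
    Pi.single_apply, Prod.mk.injEq]
  rw [Rg_apply hQ, if_neg (c := x < y ∧ _), if_neg (c := x < _ ∧ _)]
  · by_cases h : x = ⟨0, by omega⟩ ∧ y = l
    · rw [if_pos h, if_pos h, h.1, h.2]; simp [ee]
    · rw [if_neg h, if_neg h]; simp
  · rintro ⟨h, -⟩; simp [Fin.lt_def] at h
  · rintro ⟨h, h2, -⟩; rw [← h2] at h; simp [Fin.lt_def] at h

theorem Rg_evR (hn : 0 < n) {Q : F} (hQ : Q ≠ 0) (l : Fin (2*n)) :
    (Rg n Q).mulVec (ev (l, ⟨2*n-1, by omega⟩))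
      = Q ^ (ee n l ⟨2*n-1, by omega⟩) • ev (l, ⟨2*n-1, by omega⟩) := by
  funext ⟨x, y⟩
  simp only [ev, Matrix.mulVec_single_one, Matrix.col_apply, Pi.smul_apply, smul_eq_mul,
    Pi.single_apply, Prod.mk.injEq]
  rw [Rg_apply hQ, if_neg (c := x < y ∧ _), if_neg (c := x < _ ∧ _)]
  · by_cases h : x = l ∧ y = ⟨2*n-1, by omega⟩
    · rw [if_pos h, if_pos h, h.1, h.2]; simp [ee]
    · rw [if_neg h, if_neg h]; simp
  · rintro ⟨h, -, h2⟩
    have := congrArg Fin.val h2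
    simp only [pr_val] at this
    simp only [Fin.lt_def] at h
    have := l.isLt
    omega
  · rintro ⟨h, -, h2⟩
    have := congrArg Fin.val h2
    simp only [Fin.lt_def] at h this
    have := y.isLt
    omega

theorem e12_ev {M : Matrix (ι × ι) (ι × ι) F} {c : F} {i a : ι} (x : ι)
    (h : M.mulVec (ev (i, a)) = c • ev (i, a)) :
    (e12 M).mulVec (ev ((i, a), x)) = c • ev ((i, a), x) := by
  rw [e12, kr_ev, h, one_ev, ← ev_mul (i, a) x]
  funext p; simp only [Pi.smul_apply, smul_eq_mul]; ring

theorem sub_ev {κ : Type*} [Fintype κ] [DecidableEq κ] {M : Matrix κ κ F} {c : F} (σ : κ ≃ κ)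
    {p : κ} (h : M.mulVec (ev (σ p)) = c • ev (σ p)) :
    (M.submatrix σ σ).mulVec (ev p) = c • ev p := by
  funext x
  have h2 := congrFun h (σ x)
  simp only [ev, Matrix.mulVec_single_one, Matrix.col_apply, Pi.smul_apply, smul_eq_mul,
    Pi.single_apply, Matrix.submatrix_apply] at h2 ⊢
  rw [h2]; simp

theorem e13_ev {M : Matrix (ι × ι) (ι × ι) F} {c : F} {i x : ι} (a : ι)
    (h : M.mulVec (ev (i, x)) = c • ev (i, x)) :
    (e13 M).mulVec (ev ((i, a), x)) = c • ev ((i, a), x) :=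
  sub_ev sg13 (e12_ev a h)

theorem e23_ev {M : Matrix (ι × ι) (ι × ι) F} {c : F} {a x : ι} (i : ι)
    (h : M.mulVec (ev (a, x)) = c • ev (a, x)) :
    (e23 M).mulVec (ev ((i, a), x)) = c • ev ((i, a), x) :=
  sub_ev sg23 (e12_ev i h)

theorem ybe {Q : F} (hQ : Q ≠ 0) : e12 (Rg n Q) * e13 (Rg n Q) * e23 (Rg n Q)
    = e23 (Rg n Q) * e13 (Rg n Q) * e12 (Rg n Q) := by
  rcases Nat.eq_zero_or_pos n with rfl | hn
  · ext ⟨⟨x, y⟩, z⟩; exact absurd x.isLt (by omega)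
  set L := e12 (Rg n Q) * e13 (Rg n Q) * e23 (Rg n Q) with hL
  set L' := e23 (Rg n Q) * e13 (Rg n Q) * e12 (Rg n Q) with hL'
  let N : Submodule F ((Fin (2*n) × Fin (2*n)) × Fin (2*n) → F) :=
    LinearMap.ker (Matrix.toLin' (L - L'))
  have hN : ∀ v, v ∈ N ↔ (L - L').mulVec v = 0 := by
    intro v; simp only [N, LinearMap.mem_ker, Matrix.toLin'_apply]
  have key : ∀ A K : Matrix (Fin (2*n)) (Fin (2*n)) F, Chev n Q A K →
      ∀ v ∈ N, (D3 A K).mulVec v ∈ N := by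
    intro A K h v hv
    rw [hN] at hv ⊢
    have : (L - L') * D3 A K = D3op A K * (L - L') := by
      rw [sub_mul, mul_sub, hL, hL', ybe_int1 h, ybe_int2 h]
    rw [Matrix.mulVec_mulVec, this, ← Matrix.mulVec_mulVec, hv, Matrix.mulVec_zero]
  have hall : ∀ v, v ∈ N := by
    apply gen3 hn hQ N
    · intro m hm; exact key _ _ (chev_a hQ hm)
    · intro m hm; exact key _ _ (chev_b hQ hm)
    · intro l
      have a1 := e12_ev (⟨2*n-1, by omega⟩ : Fin (2*n)) (Rg_evL hn hQ l)
      have a2 := e13_ev l (Rg_ev0 hn hQ)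
      have a3 := e23_ev (⟨0, by omega⟩ : Fin (2*n)) (Rg_evR hn hQ l)
      rw [hN, Matrix.sub_mulVec, hL, hL']
      simp only [← Matrix.mulVec_mulVec, a1, a2, a3, Matrix.mulVec_smul]
      rw [sub_eq_zero]
      simp only [smul_smul]
      congr 1; ring
  have : L - L' = 0 := by
    apply Matrix.mulVec_injective
    funext v
    rw [(hN v).1 (hall v), Matrix.zero_mulVec]
  exact sub_eq_zero.1 this

end YBE2

section YBE3

variable {n : ℕ} {ι : Type*} [Fintype ι] [DecidableEq ι]

theorem e12_apply (M : Matrix (ι × ι) (ι × ι) F) (i a x j b y : ι) :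
    e12 M ((i, a), x) ((j, b), y) = if x = y then M (i, a) (j, b) else 0 := by
  simp [e12, Matrix.one_apply]
theorem e13_apply (M : Matrix (ι × ι) (ι × ι) F) (i a x j b y : ι) :
    e13 M ((i, a), x) ((j, b), y) = if a = b then M (i, x) (j, y) else 0 := by
  simp only [e13, Matrix.submatrix_apply, sg13, Equiv.coe_fn_mk, e12_apply]
theorem e23_apply (M : Matrix (ι × ι) (ι × ι) F) (i a x j b y : ι) :
    e23 M ((i, a), x) ((j, b), y) = if i = j then M (a, x) (b, y) else 0 := by
  simp only [e23, Matrix.submatrix_apply, sg23, Equiv.coe_fn_mk, e12_apply]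

/-- The general braid-type relation. -/
def Brd (A B C : Matrix (ι × ι) (ι × ι) F) : Prop :=
  e12 A * e13 B * e23 C = e23 C * e13 B * e12 A

def sg312 : ((ι × ι) × ι) ≃ ((ι × ι) × ι) where
  toFun p := ((p.2, p.1.1), p.1.2)
  invFun p := ((p.1.2, p.2), p.1.1)
  left_inv _ := rfl
  right_inv _ := rfl

theorem brd_entry {A B C : Matrix (ι × ι) (ι × ι) F} (h : Brd A B C) (i a m j b r : ι) :
    ∑ k, ∑ c, A (i, a) (k, c) * ∑ s, B (k, m) (j, s) * C (c, s) (b, r)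
      = ∑ c, ∑ l, A (l, c) (j, b) * ∑ s, C (a, m) (c, s) * B (i, s) (l, r) := by
  have h2 := congrFun (congrFun h ((i, a), m)) ((j, b), r)
  rw [mul_assoc, Matrix.mul_apply, Matrix.mul_apply] at h2
  simp only [Matrix.mul_apply, Fintype.sum_prod_type, e12_apply, e13_apply, e23_apply,
    mul_ite, ite_mul, zero_mul, mul_zero, Finset.sum_ite_eq, Finset.sum_ite_eq', Finset.mem_univ,
    if_true] at h2
  simp only [Finset.sum_ite_irrel, Finset.sum_const_zero, Finset.sum_ite_eq, Finset.sum_ite_eq',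
    Finset.mem_univ, if_true] at h2
  rw [h2, Finset.sum_comm]
  refine Finset.sum_congr rfl fun _ _ => Finset.sum_congr rfl fun _ _ => mul_comm _ _

variable {Q : F}

theorem unit' (hQ : Q ≠ 0) : Rg n Q * Rg n Q⁻¹ = 1 := mul_eq_one_comm.1 (unitarity hQ)

theorem brd1 (hQ : Q ≠ 0) : Brd (Rg n Q) (Rg n Q) (Rg n Q) := ybe hQ

theorem brd2 (hQ : Q ≠ 0) : Brd (Rg n Q) (Rg n Q) (flip2 (Rg n Q⁻¹)) := by
  have h := congrArg (fun M => Matrix.submatrix M sg13 sg13) (ybe (n := n) hQ)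
  simp only [← Matrix.submatrix_mul_equiv _ _ _ sg13] at h
  have h1 : (e12 (Rg n Q)).submatrix sg13 sg13 = e13 (Rg n Q) := rfl
  have h2 : (e13 (Rg n Q)).submatrix sg13 sg13 = e12 (Rg n Q) := rfl
  have h3 : (e23 (Rg n Q)).submatrix sg13 sg13 = e23 (flip2 (Rg n Q)) := rfl
  rw [h1, h2, h3] at h
  have u1 : e23 (flip2 (Rg n Q)) * e23 (flip2 (Rg n Q⁻¹)) = 1 := by
    rw [← e23_mul, ← flip2_mul, unit' hQ, flip2_one, e23_one]
  have u2 : e23 (flip2 (Rg n Q⁻¹)) * e23 (flip2 (Rg n Q)) = 1 := mul_eq_one_comm.1 u1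
  unfold Brd
  calc e12 (Rg n Q) * e13 (Rg n Q) * e23 (flip2 (Rg n Q⁻¹))
      = e23 (flip2 (Rg n Q⁻¹)) * (e23 (flip2 (Rg n Q)) * e12 (Rg n Q) * e13 (Rg n Q))
        * e23 (flip2 (Rg n Q⁻¹)) := by
          rw [← mul_assoc, ← mul_assoc, u2, one_mul]
    _ = _ := by
      rw [← h, mul_assoc, mul_assoc _ (e23 (flip2 (Rg n Q))), u1, mul_one, mul_assoc]

theorem brd3 (hQ : Q ≠ 0) : Brd (Rg n Q) (flip2 (Rg n Q⁻¹)) (flip2 (Rg n Q⁻¹)) := by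
  have h := congrArg (fun M => Matrix.submatrix M sg312 sg312) (ybe (n := n) hQ)
  simp only [← Matrix.submatrix_mul_equiv _ _ _ sg312] at h
  have h1 : (e12 (Rg n Q)).submatrix sg312 sg312 = e13 (flip2 (Rg n Q)) := rfl
  have h2 : (e13 (Rg n Q)).submatrix sg312 sg312 = e23 (flip2 (Rg n Q)) := rfl
  have h3 : (e23 (Rg n Q)).submatrix sg312 sg312 = e12 (Rg n Q) := rfl
  rw [h1, h2, h3] at h
  have u1 : e23 (flip2 (Rg n Q)) * e23 (flip2 (Rg n Q⁻¹)) = 1 := by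
    rw [← e23_mul, ← flip2_mul, unit' hQ, flip2_one, e23_one]
  have u2 : e23 (flip2 (Rg n Q⁻¹)) * e23 (flip2 (Rg n Q)) = 1 := mul_eq_one_comm.1 u1
  have v1 : e13 (flip2 (Rg n Q)) * e13 (flip2 (Rg n Q⁻¹)) = 1 := by
    rw [← e13_mul, ← flip2_mul, unit' hQ, flip2_one, e13_one]
  have v2 : e13 (flip2 (Rg n Q⁻¹)) * e13 (flip2 (Rg n Q)) = 1 := mul_eq_one_comm.1 v1
  unfold Brd
  set A := e12 (Rg n Q)
  set b := e13 (flip2 (Rg n Q))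
  set c := e23 (flip2 (Rg n Q))
  set b' := e13 (flip2 (Rg n Q⁻¹))
  set c' := e23 (flip2 (Rg n Q⁻¹))
  calc A * b' * c' = c' * (b' * b) * c * A * b' * c' := by rw [v2, mul_one, u2, one_mul]
    _ = c' * b' * (b * c * A) * b' * c' := by simp only [mul_assoc]
    _ = c' * b' * A * (c * (b * b') * c') := by rw [h]; simp only [mul_assoc]
    _ = _ := by rw [v1, mul_one, u1, mul_one]

end YBE3
section Framework

variable {n : ℕ} {B : Type*} [Ring B] [Algebra F B]

/-- Slot embeddings. -/
def E1 (T : Matrix (Fin (2*n)) (Fin (2*n)) B) :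
    Matrix (Fin (2*n) × Fin (2*n)) (Fin (2*n) × Fin (2*n)) B :=
  fun p s => if p.2 = s.2 then T p.1 s.1 else 0

def E2 (T : Matrix (Fin (2*n)) (Fin (2*n)) B) :
    Matrix (Fin (2*n) × Fin (2*n)) (Fin (2*n) × Fin (2*n)) B :=
  fun p s => if p.1 = s.1 then T p.2 s.2 else 0

/-- The R-matrix over B -/
def RB (n : ℕ) (B : Type*) [Ring B] [Algebra F B] :
    Matrix (Fin (2*n) × Fin (2*n)) (Fin (2*n) × Fin (2*n)) B :=
  (Rg n q).map (algebraMap F B)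

variable (T U : Matrix (Fin (2*n)) (Fin (2*n)) B)

theorem E1_mul : E1 (T * U) = E1 T * E1 U := by
  ext ⟨i, a⟩ ⟨j, b⟩
  simp only [E1, Matrix.mul_apply, Fintype.sum_prod_type, mul_ite, ite_mul, zero_mul, mul_zero,
    Finset.sum_ite_eq, Finset.sum_ite_eq', Finset.mem_univ, if_true]
  split_ifs <;> simp

theorem E2_mul : E2 (T * U) = E2 T * E2 U := by
  ext ⟨i, a⟩ ⟨j, b⟩
  simp only [E2, Matrix.mul_apply, Fintype.sum_prod_type, mul_ite, ite_mul, zero_mul, mul_zero,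
    Finset.sum_ite_irrel, Finset.sum_const_zero,
    Finset.sum_ite_eq, Finset.sum_ite_eq', Finset.mem_univ, if_true]

theorem E1E2_apply (i a j b : Fin (2*n)) : (E1 T * E2 U) (i, a) (j, b) = T i j * U a b := by
  simp only [E1, E2, Matrix.mul_apply, Fintype.sum_prod_type, mul_ite, ite_mul, zero_mul, mul_zero,
    Finset.sum_ite_irrel, Finset.sum_const_zero,
    Finset.sum_ite_eq, Finset.sum_ite_eq', Finset.mem_univ, if_true]

theorem E2E1_apply (i a j b : Fin (2*n)) : (E2 U * E1 T) (i, a) (j, b) = U a b * T i j := by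
  simp only [E1, E2, Matrix.mul_apply, Fintype.sum_prod_type, mul_ite, ite_mul, zero_mul, mul_zero,
    Finset.sum_ite_irrel, Finset.sum_const_zero,
    Finset.sum_ite_eq, Finset.sum_ite_eq', Finset.mem_univ, if_true]

theorem E1E2_comm (h : ∀ i j a b, T i j * U a b = U a b * T i j) : E1 T * E2 U = E2 U * E1 T := by
  ext ⟨i, a⟩ ⟨j, b⟩; rw [E1E2_apply, E2E1_apply, h]

/-- The RTT relation. -/
def RTT (T U : Matrix (Fin (2*n)) (Fin (2*n)) B) : Prop :=
  RB n B * (E1 T * E2 U) = E2 U * E1 T * RB n B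

theorem RTT_iff : RTT T U ↔ ∀ i a j b, ∑ k, ∑ c, Rm n (i, a) (k, c) • (T k j * U c b)
    = ∑ c, ∑ l, Rm n (l, c) (j, b) • (U a c * T i l) := by
  have hL : ∀ i a j b, (RB n B * (E1 T * E2 U)) (i, a) (j, b)
      = ∑ k, ∑ c, Rm n (i, a) (k, c) • (T k j * U c b) := by
    intro i a j b
    rw [Matrix.mul_apply, Fintype.sum_prod_type]
    simp only [E1E2_apply, RB, Matrix.map_apply, Algebra.smul_def]; rfl
  have hR : ∀ i a j b, (E2 U * E1 T * RB n B) (i, a) (j, b)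
      = ∑ c, ∑ l, Rm n (l, c) (j, b) • (U a c * T i l) := by
    intro i a j b
    rw [Matrix.mul_apply, Fintype.sum_prod_type, Finset.sum_comm]
    simp only [E2E1_apply, RB, Matrix.map_apply, Algebra.smul_def, Algebra.commutes]; rfl
  constructor
  · intro h i a j b; rw [← hL, ← hR, h]
  · intro h; ext ⟨i, a⟩ ⟨j, b⟩; rw [hL, hR, h]

/-- The twisted transpose. -/
def tw (T : Matrix (Fin (2*n)) (Fin (2*n)) B) : Matrix (Fin (2*n)) (Fin (2*n)) B := fun k j =>
  (dd n k * (dd n j)⁻¹ * eps n (pr n k) * eps n (pr n j)) • T (pr n j) (pr n k)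

structure IsRTT (T Tb : Matrix (Fin (2*n)) (Fin (2*n)) B) : Prop where
  t_upper : ∀ i j, i < j → T i j = 0
  tb_lower : ∀ i j, j < i → Tb i j = 0
  d1 : ∀ i, T i i * Tb i i = 1
  d2 : ∀ i, Tb i i * T i i = 1
  tt : RTT T T
  bb : RTT Tb Tb
  bt : RTT Tb T
  c1 : T * tw T = 1
  c2 : tw T * T = 1
  cb1 : Tb * tw Tb = 1
  cb2 : tw Tb * Tb = 1

theorem q_ne : q ≠ 0 := RatFunc.X_ne_zero

theorem dd_ne (i : Fin (2*n)) : dd n i ≠ 0 := zpow_ne_zero _ q_ne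

theorem tw_mul (h : ∀ i j a b, T i j * U a b = U a b * T i j) : tw (T * U) = tw U * tw T := by
  ext k j
  simp only [tw, Matrix.mul_apply, Finset.smul_sum]
  rw [← (Equiv.sum_comp (⟨pr n, pr n, pr_pr, pr_pr⟩ : Fin (2*n) ≃ Fin (2*n)))]
  refine Finset.sum_congr rfl fun s _ => ?_
  simp only [Equiv.coe_fn_mk]
  rw [h, smul_mul_smul_comm]
  congr 1
  have := eps_mul_self (pr n s)
  have h2 := dd_ne s
  field_simp
  linear_combination (-(dd n k * eps n (pr n k) * eps n (pr n j) * (dd n j)⁻¹)) * this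

theorem RTT.mul {A C A' C' : Matrix (Fin (2*n)) (Fin (2*n)) B} (h1 : RTT A A') (h2 : RTT C C')
    (h3 : ∀ i j a b, A i j * C' a b = C' a b * A i j)
    (h4 : ∀ i j a b, C i j * A' a b = A' a b * C i j) : RTT (A * C) (A' * C') := by
  have h5 := E1E2_comm _ _ h3
  have h6 := E1E2_comm _ _ h4
  unfold RTT at *
  rw [E1_mul, E2_mul]
  calc RB n B * (E1 A * E1 C * (E2 A' * E2 C'))
      = RB n B * (E1 A * (E1 C * E2 A') * E2 C') := by simp only [mul_assoc]
    _ = (RB n B * (E1 A * E2 A')) * (E1 C * E2 C') := by rw [h6]; simp only [mul_assoc]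
    _ = E2 A' * E1 A * (RB n B * (E1 C * E2 C')) := by rw [h1]; simp only [mul_assoc]
    _ = E2 A' * (E1 A * E2 C') * E1 C * RB n B := by rw [h2]; simp only [mul_assoc]
    _ = _ := by rw [h5]; simp only [mul_assoc]

theorem IsRTT.mul {A Ab C Cb : Matrix (Fin (2*n)) (Fin (2*n)) B} (h1 : IsRTT A Ab)
    (h2 : IsRTT C Cb)
    (k1 : ∀ i j a b, A i j * C a b = C a b * A i j)
    (k2 : ∀ i j a b, A i j * Cb a b = Cb a b * A i j)
    (k3 : ∀ i j a b, Ab i j * C a b = C a b * Ab i j)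
    (k4 : ∀ i j a b, Ab i j * Cb a b = Cb a b * Ab i j) : IsRTT (A * C) (Ab * Cb) where
  t_upper i j hij := by
    rw [Matrix.mul_apply]
    refine Finset.sum_eq_zero fun k _ => ?_
    by_cases h : i < k
    · rw [h1.t_upper i k h, zero_mul]
    · rw [h2.t_upper k j (lt_of_le_of_lt (not_lt.1 h) hij), mul_zero]
  tb_lower i j hij := by
    rw [Matrix.mul_apply]
    refine Finset.sum_eq_zero fun k _ => ?_
    by_cases h : k < i
    · rw [h1.tb_lower i k h, zero_mul]
    · rw [h2.tb_lower k j (lt_of_lt_of_le hij (not_lt.1 h)), mul_zero]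
  d1 i := by
    have e1 : (A * C) i i = A i i * C i i := by
      rw [Matrix.mul_apply]
      refine Finset.sum_eq_single _ (fun k _ hk => ?_) (by simp)
      rcases lt_or_gt_of_ne hk with h | h
      · rw [h2.t_upper k i h, mul_zero]
      · rw [h1.t_upper i k h, zero_mul]
    have e2 : (Ab * Cb) i i = Ab i i * Cb i i := by
      rw [Matrix.mul_apply]
      refine Finset.sum_eq_single _ (fun k _ hk => ?_) (by simp)
      rcases lt_or_gt_of_ne hk with h | h
      · rw [h1.tb_lower i k h, zero_mul]
      · rw [h2.tb_lower k i h, mul_zero]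
    rw [e1, e2, k4, mul_assoc, ← mul_assoc (C i i), h2.d1, one_mul, h1.d1]
  d2 i := by
    have e1 : (A * C) i i = A i i * C i i := by
      rw [Matrix.mul_apply]
      refine Finset.sum_eq_single _ (fun k _ hk => ?_) (by simp)
      rcases lt_or_gt_of_ne hk with h | h
      · rw [h2.t_upper k i h, mul_zero]
      · rw [h1.t_upper i k h, zero_mul]
    have e2 : (Ab * Cb) i i = Ab i i * Cb i i := by
      rw [Matrix.mul_apply]
      refine Finset.sum_eq_single _ (fun k _ hk => ?_) (by simp)
      rcases lt_or_gt_of_ne hk with h | h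
      · rw [h1.tb_lower i k h, zero_mul]
      · rw [h2.tb_lower k i h, mul_zero]
    rw [e1, e2, k1, mul_assoc, ← mul_assoc (Cb i i), h2.d2, one_mul, h1.d2]
  tt := h1.tt.mul h2.tt k1 fun i j a b => (k1 a b i j).symm
  bb := h1.bb.mul h2.bb k4 fun i j a b => (k4 a b i j).symm
  bt := h1.bt.mul h2.bt k3 fun i j a b => (k2 a b i j).symm
  c1 := by rw [tw_mul _ _ k1, mul_assoc, ← mul_assoc C, h2.c1, one_mul, h1.c1]
  c2 := by rw [tw_mul _ _ k1, mul_assoc, ← mul_assoc (tw A), h1.c2, one_mul, h2.c2]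
  cb1 := by rw [tw_mul _ _ k4, mul_assoc, ← mul_assoc Cb, h2.cb1, one_mul, h1.cb1]
  cb2 := by rw [tw_mul _ _ k4, mul_assoc, ← mul_assoc (tw Ab), h1.cb2, one_mul, h2.cb2]

end Framework

section Reps

variable {n : ℕ} {B : Type*} [Ring B] [Algebra F B]

/-- The algebra map determined by a solution of the RTT relations. -/
def liftU {T Tb : Matrix (Fin (2*n)) (Fin (2*n)) B} (h : IsRTT T Tb) : Usp n →ₐ[F] B :=
  RingQuot.liftAlgHom F ⟨FreeAlgebra.lift F (fun g : Gen n => match g with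
    | Gen.t i j => T i j
    | Gen.tb i j => Tb i j), by
    intro x y hxy
    have et : ∀ i j, (FreeAlgebra.lift F (fun g : Gen n => match g with
      | Gen.t i j => T i j
      | Gen.tb i j => Tb i j)) (tF n i j) = T i j := fun i j => by
        rw [tF, FreeAlgebra.lift_ι_apply]
    have eb : ∀ i j, (FreeAlgebra.lift F (fun g : Gen n => match g with
      | Gen.t i j => T i j
      | Gen.tb i j => Tb i j)) (tbF n i j) = Tb i j := fun i j => by
        rw [tbF, FreeAlgebra.lift_ι_apply]
    cases hxy with
    | t_upper i j hij => rw [et, map_zero, h.t_upper i j hij]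
    | tb_lower i j hij => rw [eb, map_zero, h.tb_lower i j hij]
    | t_tb_diag i => rw [map_mul, et, eb, map_one, h.d1]
    | tb_t_diag i => rw [map_mul, et, eb, map_one, h.d2]
    | rtt_tt i a j b =>
      simp only [map_sum, map_smul, map_mul, et, eb]
      exact (RTT_iff _ _).1 h.tt i a j b
    | rtt_bb i a j b =>
      simp only [map_sum, map_smul, map_mul, et, eb]
      exact (RTT_iff _ _).1 h.bb i a j b
    | rtt_bt i a j b =>
      simp only [map_sum, map_smul, map_mul, et, eb]
      exact (RTT_iff _ _).1 h.bt i a j b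
    | cent_t1 i j =>
      have h2 := congrFun (congrFun h.c1 i) j
      rw [Matrix.mul_apply, Matrix.one_apply] at h2
      simp only [map_sum, map_smul, map_mul, et, eb]
      simp only [tw, mul_smul_comm] at h2
      rw [h2]; split_ifs <;> simp
    | cent_tb1 i j =>
      have h2 := congrFun (congrFun h.cb1 i) j
      rw [Matrix.mul_apply, Matrix.one_apply] at h2
      simp only [map_sum, map_smul, map_mul, et, eb]
      simp only [tw, mul_smul_comm] at h2
      rw [h2]; split_ifs <;> simp
    | cent_t2 i j =>
      have h2 := congrFun (congrFun h.c2 i) j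
      rw [Matrix.mul_apply, Matrix.one_apply] at h2
      simp only [map_sum, map_smul, map_mul, et, eb]
      simp only [tw, smul_mul_assoc] at h2
      rw [h2]; split_ifs <;> simp
    | cent_tb2 i j =>
      have h2 := congrFun (congrFun h.cb2 i) j
      rw [Matrix.mul_apply, Matrix.one_apply] at h2
      simp only [map_sum, map_smul, map_mul, et, eb]
      simp only [tw, smul_mul_assoc] at h2
      rw [h2]; split_ifs <;> simp⟩

theorem liftU_t {T Tb : Matrix (Fin (2*n)) (Fin (2*n)) B} (h : IsRTT T Tb) (i j : Fin (2*n)) :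
    liftU h (tU n i j) = T i j := by
  rw [liftU, tU, RingQuot.liftAlgHom_mkAlgHom_apply, tF, FreeAlgebra.lift_ι_apply]

theorem liftU_tb {T Tb : Matrix (Fin (2*n)) (Fin (2*n)) B} (h : IsRTT T Tb) (i j : Fin (2*n)) :
    liftU h (tbU n i j) = Tb i j := by
  rw [liftU, tbU, RingQuot.liftAlgHom_mkAlgHom_apply, tbF, FreeAlgebra.lift_ι_apply]

/-- The generator matrices. -/
def TU (n : ℕ) : Matrix (Fin (2*n)) (Fin (2*n)) (Usp n) := tU n
def TbU (n : ℕ) : Matrix (Fin (2*n)) (Fin (2*n)) (Usp n) := tbU n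

theorem U_isRTT (n : ℕ) : IsRTT (TU n) (TbU n) where
  t_upper i j h := by
    have := RingQuot.mkAlgHom_rel F (rel.t_upper (n := n) i j h)
    rwa [map_zero] at this
  tb_lower i j h := by
    have := RingQuot.mkAlgHom_rel F (rel.tb_lower (n := n) i j h)
    rwa [map_zero] at this
  d1 i := by
    have := RingQuot.mkAlgHom_rel F (rel.t_tb_diag (n := n) i)
    rwa [map_one, map_mul] at this
  d2 i := by
    have := RingQuot.mkAlgHom_rel F (rel.tb_t_diag (n := n) i)
    rwa [map_one, map_mul] at this
  tt := by
    rw [RTT_iff]; intro i a j b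
    have := RingQuot.mkAlgHom_rel F (rel.rtt_tt (n := n) i a j b)
    simp only [map_sum, map_smul, map_mul] at this
    exact this
  bb := by
    rw [RTT_iff]; intro i a j b
    have := RingQuot.mkAlgHom_rel F (rel.rtt_bb (n := n) i a j b)
    simp only [map_sum, map_smul, map_mul] at this
    exact this
  bt := by
    rw [RTT_iff]; intro i a j b
    have := RingQuot.mkAlgHom_rel F (rel.rtt_bt (n := n) i a j b)
    simp only [map_sum, map_smul, map_mul] at this
    exact this
  c1 := by
    ext i j
    have := RingQuot.mkAlgHom_rel F (rel.cent_t1 (n := n) i j)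
    simp only [map_sum, map_smul, map_mul, apply_ite (RingQuot.mkAlgHom F (rel n)), map_one,
      map_zero] at this
    rw [Matrix.mul_apply, Matrix.one_apply, ← this]
    simp only [tw, mul_smul_comm]; rfl
  c2 := by
    ext i j
    have := RingQuot.mkAlgHom_rel F (rel.cent_t2 (n := n) i j)
    simp only [map_sum, map_smul, map_mul, apply_ite (RingQuot.mkAlgHom F (rel n)), map_one,
      map_zero] at this
    rw [Matrix.mul_apply, Matrix.one_apply, ← this]
    simp only [tw, smul_mul_assoc]; rfl
  cb1 := by
    ext i j
    have := RingQuot.mkAlgHom_rel F (rel.cent_tb1 (n := n) i j)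
    simp only [map_sum, map_smul, map_mul, apply_ite (RingQuot.mkAlgHom F (rel n)), map_one,
      map_zero] at this
    rw [Matrix.mul_apply, Matrix.one_apply, ← this]
    simp only [tw, mul_smul_comm]; rfl
  cb2 := by
    ext i j
    have := RingQuot.mkAlgHom_rel F (rel.cent_tb2 (n := n) i j)
    simp only [map_sum, map_smul, map_mul, apply_ite (RingQuot.mkAlgHom F (rel n)), map_one,
      map_zero] at this
    rw [Matrix.mul_apply, Matrix.one_apply, ← this]
    simp only [tw, smul_mul_assoc]; rfl

/-- The trivial solution. -/
theorem triv_isRTT (n : ℕ) : IsRTT (1 : Matrix (Fin (2*n)) (Fin (2*n)) F) 1 := by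
  have hE1 : E1 (1 : Matrix (Fin (2*n)) (Fin (2*n)) F) = 1 := by
    ext ⟨i, a⟩ ⟨j, b⟩; simp only [E1, Matrix.one_apply, Prod.mk.injEq]
    by_cases h : a = b <;> simp [h]
  have hE2 : E2 (1 : Matrix (Fin (2*n)) (Fin (2*n)) F) = 1 := by
    ext ⟨i, a⟩ ⟨j, b⟩; simp only [E2, Matrix.one_apply, Prod.mk.injEq]
    by_cases h : i = j <;> simp [h]
  have hR : RTT (1 : Matrix (Fin (2*n)) (Fin (2*n)) F) 1 := by
    unfold RTT; rw [hE1, hE2]; simp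
  have htw : tw (1 : Matrix (Fin (2*n)) (Fin (2*n)) F) = 1 := by
    ext i j
    simp only [tw, Matrix.one_apply, pr_inj]
    by_cases h : i = j
    · subst h
      have := dd_ne i
      have h2 := eps_mul_self (pr n i)
      simp only [if_true, smul_eq_mul, mul_one, mul_inv_cancel₀ this, one_mul, h2]
    · rw [if_neg h, if_neg (Ne.symm h), smul_zero]
  exact ⟨fun i j h => Matrix.one_apply_ne h.ne, fun i j h => Matrix.one_apply_ne h.ne',
    fun i => by simp, fun i => by simp, hR, hR, hR, by rw [htw, mul_one], by rw [htw, mul_one],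
    by rw [htw, mul_one], by rw [htw, mul_one]⟩

/-- The counit. -/
def cou (n : ℕ) : Usp n →ₐ[F] F := liftU (triv_isRTT n)

/-- A matrix on the tensor square as a matrix of matrices. -/
def slot (X : Matrix (Fin (2*n) × Fin (2*n)) (Fin (2*n) × Fin (2*n)) F) :
    Matrix (Fin (2*n)) (Fin (2*n)) (Matrix (Fin (2*n)) (Fin (2*n)) F) :=
  Matrix.of fun i j => Matrix.of fun m r => X (i, m) (j, r)

theorem slot_apply (X : Matrix (Fin (2*n) × Fin (2*n)) (Fin (2*n) × Fin (2*n)) F)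
    (i j m r : Fin (2*n)) : slot X i j m r = X (i, m) (j, r) := rfl

theorem slot_mul (X Y : Matrix (Fin (2*n) × Fin (2*n)) (Fin (2*n) × Fin (2*n)) F) :
    slot X * slot Y = slot (X * Y) := by
  ext i j m r
  rw [Matrix.mul_apply, Matrix.sum_apply, slot_apply, Matrix.mul_apply, Fintype.sum_prod_type]
  simp only [Matrix.mul_apply, slot_apply]

theorem slot_one : slot (1 : Matrix (Fin (2*n) × Fin (2*n)) (Fin (2*n) × Fin (2*n)) F) = 1 := by
  ext i j m r
  have h : (1 : Matrix (Fin (2*n)) (Fin (2*n)) (Matrix (Fin (2*n)) (Fin (2*n)) F)) i j m r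
      = if i = j then (if m = r then 1 else 0) else 0 := by
    by_cases h3 : i = j
    · subst h3; rw [Matrix.one_apply_eq, if_pos rfl, Matrix.one_apply]
    · rw [Matrix.one_apply_ne h3, if_neg h3]; rfl
  rw [slot_apply, h, Matrix.one_apply]
  simp only [Prod.mk.injEq]
  by_cases h3 : i = j <;> by_cases h4 : m = r <;> simp [h3, h4]

/-- The fundamental representation. -/
def rT (n : ℕ) : Matrix (Fin (2*n)) (Fin (2*n)) (Matrix (Fin (2*n)) (Fin (2*n)) F) :=
  slot (flip2 (Rg n q⁻¹))
def rTb (n : ℕ) : Matrix (Fin (2*n)) (Fin (2*n)) (Matrix (Fin (2*n)) (Fin (2*n)) F) :=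
  slot (Rg n q)

theorem rT_apply (i j m r : Fin (2*n)) : rT n i j m r = Rg n q⁻¹ (m, i) (r, j) := rfl
theorem rTb_apply (i j m r : Fin (2*n)) : rTb n i j m r = Rg n q (i, m) (j, r) := rfl

theorem qi_ne : (q⁻¹ : F) ≠ 0 := inv_ne_zero q_ne

theorem crossing1 (k j x r : Fin (2*n)) :
    (dd n k * (dd n j)⁻¹ * eps n k * eps n j) * Rg n q (pr n j, x) (pr n k, r)
      = Rg n q⁻¹ (k, x) (j, r) := by
  have hd : ∀ k : Fin (2*n), dd n k = - (eps n k * pp n q (pr n k)) := by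
    intro k; rw [pp_pr, mul_neg, neg_neg, ← mul_assoc, eps_mul_self, one_mul]; rfl
  have hpi : ∀ k : Fin (2*n), pp n q⁻¹ k = - pp n q (pr n k) := by
    intro k; rw [pp_pr, neg_neg, pp, inv_zpow, zpow_neg, inv_inv]
  have hdi : ∀ j : Fin (2*n), (dd n j)⁻¹ = eps n j * pp n q j := by
    intro j
    rw [pp, ← mul_assoc, eps_mul_self, one_mul, zpow_neg]; rfl
  have hc : dd n k * (dd n j)⁻¹ * eps n k * eps n j = - (pp n q (pr n k) * pp n q j) := by
    rw [hd, hdi]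
    have h1 := eps_mul_self k
    have h2 := eps_mul_self j
    linear_combination (-(pp n q (pr n k) * pp n q j * eps n j * eps n j)) * h1
      - (pp n q (pr n k) * pp n q j) * h2
  rw [hc, Rg_apply q_ne, Rg_apply qi_ne, inv_inv]
  have a1 : (if k = j ∧ x = r then
      (q⁻¹ : F) ^ ((if k = x then (1:ℤ) else 0) - (if k = pr n x then (1:ℤ) else 0)) else 0)
      = - (pp n q (pr n k) * pp n q j) * (if pr n j = pr n k ∧ x = r then
      q ^ ((if pr n j = x then (1:ℤ) else 0) - (if pr n j = pr n x then (1:ℤ) else 0)) else 0) := by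
    by_cases h : k = j ∧ x = r
    · obtain ⟨rfl, rfl⟩ := h
      rw [if_pos (c := k = k ∧ x = x) ⟨rfl, rfl⟩,
        if_pos (c := pr n k = pr n k ∧ x = x) ⟨rfl, rfl⟩]
      have h1 := pp_mul_pr q_ne k
      have h2 : ((if k = x then (1:ℤ) else 0) - (if k = pr n x then (1:ℤ) else 0))
          = -((if pr n k = x then (1:ℤ) else 0) - (if pr n k = pr n x then (1:ℤ) else 0)) := by
        simp only [Fin.ext_iff, pr_val]; split_ifs <;> omega
      rw [h2, inv_zpow, zpow_neg, inv_inv, mul_comm (pp n q (pr n k)), h1]; ring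
    · rw [if_neg h, if_neg, mul_zero]
      rintro ⟨h1, h2⟩; exact h ⟨(pr_inj.1 h1).symm, h2⟩
  have a2 : (if k < x ∧ j = x ∧ r = k then q⁻¹ - q else 0)
      = - (pp n q (pr n k) * pp n q j) * (if pr n j < pr n k ∧ x = pr n (pr n j) ∧
          r = pr n (pr n k) then (q - q⁻¹) * (pp n q (pr n j) * pp n q (pr n (pr n k))) else 0) := by
    rw [pr_pr, pr_pr]
    by_cases h : k < x ∧ j = x ∧ r = k
    · obtain ⟨h1, rfl, rfl⟩ := h
      rw [if_pos ⟨h1, rfl, rfl⟩, if_pos ⟨pr_lt.2 h1, rfl, rfl⟩]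
      have h1 := pp_mul_pr q_ne j
      have h2 := pp_mul_pr q_ne r
      linear_combination (pp n q j * pp n q (pr n j) * (q - q⁻¹)) * h2 - (q - q⁻¹) * h1
    · rw [if_neg h, if_neg, mul_zero]
      rintro ⟨h1, rfl, rfl⟩; exact h ⟨pr_lt.1 h1, rfl, rfl⟩
  have a3 : (if k < j ∧ x = pr n k ∧ r = pr n j then
        (q⁻¹ - q) * (pp n q⁻¹ k * pp n q⁻¹ (pr n j)) else 0)
      = - (pp n q (pr n k) * pp n q j) *
        (if pr n j < x ∧ pr n k = x ∧ r = pr n j then q - q⁻¹ else 0) := by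
    by_cases h : k < j ∧ x = pr n k ∧ r = pr n j
    · obtain ⟨h1, rfl, rfl⟩ := h
      rw [if_pos ⟨h1, rfl, rfl⟩, if_pos ⟨pr_lt.2 h1, rfl, rfl⟩, hpi, hpi, pr_pr]; ring
    · rw [if_neg h, if_neg, mul_zero]
      rintro ⟨h1, rfl, rfl⟩; exact h ⟨pr_lt.1 h1, rfl, rfl⟩
  rw [a1, a2, a3]; ring

theorem crossing2 (k j x r : Fin (2*n)) :
    (dd n k * (dd n j)⁻¹ * eps n k * eps n j) * Rg n q⁻¹ (x, pr n j) (r, pr n k)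
      = Rg n q (x, k) (r, j) := by
  have h := crossing1 (pr n k) (pr n j) r x
  rw [pr_pr, pr_pr] at h
  rw [Rg_transpose q_ne, Rg_transpose qi_ne] at h
  rw [← h]
  have hd : ∀ k : Fin (2*n), dd n (pr n k) = (dd n k)⁻¹ := by
    intro k; rw [dd, bar_pr, zpow_neg]; rfl
  rw [hd, hd, inv_inv, eps_pr, eps_pr]
  have h1 := eps_mul_self k
  have h2 := eps_mul_self j
  have h3 : dd n j * (dd n j)⁻¹ = 1 := mul_inv_cancel₀ (dd_ne j)
  have h4 : dd n k * (dd n k)⁻¹ = 1 := mul_inv_cancel₀ (dd_ne k)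
  calc _ = (dd n k * (dd n k)⁻¹) * (dd n j * (dd n j)⁻¹) * (eps n k * eps n k) * (eps n j * eps n j)
        * Rg n q (x, k) (r, j) := by ring
    _ = _ := by rw [h1, h2, h3, h4]; ring

theorem rRTT {X Y : Matrix (Fin (2*n) × Fin (2*n)) (Fin (2*n) × Fin (2*n)) F}
    (h : Brd (Rg n q) X Y) : RTT (slot X) (slot Y) := by
  rw [RTT_iff]
  intro i a j b
  ext m r
  simp only [Matrix.sum_apply, Matrix.smul_apply, Matrix.mul_apply, smul_eq_mul, slot_apply]
  exact brd_entry h i a m j b r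

theorem tw_rT : tw (rT n) = slot (flip2 (Rg n q)) := by
  ext k j x r
  rw [tw, Matrix.smul_apply, rT_apply, smul_eq_mul, eps_pr, eps_pr]
  rw [show slot (flip2 (Rg n q)) k j x r = Rg n q (x, k) (r, j) from rfl, ← crossing2 k j x r]
  ring
theorem tw_rTb : tw (rTb n) = slot (Rg n q⁻¹) := by
  ext k j x r
  rw [tw, Matrix.smul_apply, rTb_apply, smul_eq_mul, eps_pr, eps_pr, slot_apply,
    ← crossing1 k j x r]
  ring

theorem fund_isRTT (n : ℕ) : IsRTT (rT n) (rTb n) where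
  t_upper i j h := by
    ext m r
    rw [rT_apply, Rg_apply qi_ne, if_neg, if_neg, if_neg]
    · simp
    · rintro ⟨h1, rfl, rfl⟩; exact absurd h (pr_lt.2 h1).le.not_gt
    · rintro ⟨h1, rfl, rfl⟩; exact absurd h h1.le.not_gt
    · rintro ⟨h1, h2⟩; exact h.ne h2
  tb_lower i j h := by
    ext m r
    rw [rTb_apply, Rg_apply q_ne, if_neg, if_neg, if_neg]
    · simp
    · rintro ⟨h1, -⟩; exact absurd h h1.le.not_gt
    · rintro ⟨h1, rfl, rfl⟩; exact absurd h h1.le.not_gt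
    · rintro ⟨h1, h2⟩; exact h.ne' h1
  d1 i := by
    have h1 : rT n i i = Matrix.diagonal fun m => q⁻¹ ^ ee n m i := by
      ext m r
      rw [rT_apply, Rg_apply qi_ne, Matrix.diagonal_apply, if_neg (c := m < i ∧ _), if_neg (c := m < r ∧ _)]
      · simp [ee]
      · rintro ⟨h1, rfl, h3⟩; exact h1.ne (pr_inj.1 h3)
      · rintro ⟨h1, -, h3⟩; exact h1.ne' h3
    have h2 : rTb n i i = Matrix.diagonal fun m => q ^ ee n m i := by
      ext m r
      rw [rTb_apply, Rg_apply q_ne, Matrix.diagonal_apply, if_neg (c := i < m ∧ _), if_neg (c := i < i ∧ _)]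
      · have := ee_comm i m
        simp only [ee] at this
        simp [ee, this]
      · rintro ⟨h1, -⟩; exact absurd h1 (lt_irrefl _)
      · rintro ⟨h1, h2, h3⟩; exact h1.ne h2
    rw [h1, h2, Matrix.diagonal_mul_diagonal, ← Matrix.diagonal_one]
    congr 1; funext m; rw [inv_zpow, inv_mul_cancel₀ (zpow_ne_zero _ q_ne)]
  d2 i := by
    have h1 : rT n i i = Matrix.diagonal fun m => q⁻¹ ^ ee n m i := by
      ext m r
      rw [rT_apply, Rg_apply qi_ne, Matrix.diagonal_apply, if_neg (c := m < i ∧ _), if_neg (c := m < r ∧ _)]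
      · simp [ee]
      · rintro ⟨h1, rfl, h3⟩; exact h1.ne (pr_inj.1 h3)
      · rintro ⟨h1, -, h3⟩; exact h1.ne' h3
    have h2 : rTb n i i = Matrix.diagonal fun m => q ^ ee n m i := by
      ext m r
      rw [rTb_apply, Rg_apply q_ne, Matrix.diagonal_apply, if_neg (c := i < m ∧ _), if_neg (c := i < i ∧ _)]
      · have := ee_comm i m
        simp only [ee] at this
        simp [ee, this]
      · rintro ⟨h1, -⟩; exact absurd h1 (lt_irrefl _)
      · rintro ⟨h1, h2, h3⟩; exact h1.ne h2
    rw [h1, h2, Matrix.diagonal_mul_diagonal, ← Matrix.diagonal_one]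
    congr 1; funext m; rw [inv_zpow, mul_inv_cancel₀ (zpow_ne_zero _ q_ne)]
  tt := rRTT (brd3 q_ne)
  bb := rRTT (brd1 q_ne)
  bt := rRTT (brd2 q_ne)
  c1 := by rw [tw_rT, rT, slot_mul, ← flip2_mul, unitarity q_ne, flip2_one, slot_one]
  c2 := by rw [tw_rT, rT, slot_mul, ← flip2_mul, unit' q_ne, flip2_one, slot_one]
  cb1 := by rw [tw_rTb, rTb, slot_mul, unit' q_ne, slot_one]
  cb2 := by rw [tw_rTb, rTb, slot_mul, unitarity q_ne, slot_one]

end Reps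

section Delta

variable {n : ℕ} {B C : Type*} [Ring B] [Algebra F B] [Ring C] [Algebra F C]

theorem RTT.map {T U : Matrix (Fin (2*n)) (Fin (2*n)) B} (h : RTT T U) (f : B →ₐ[F] C) :
    RTT (T.map f) (U.map f) := by
  rw [RTT_iff] at h ⊢
  intro i a j b
  have := congrArg f (h i a j b)
  simpa only [map_sum, map_smul, map_mul, Matrix.map_apply] using this

theorem tw_map (T : Matrix (Fin (2*n)) (Fin (2*n)) B) (f : B →ₐ[F] C) :
    tw (T.map f) = (tw T).map f := by
  ext i j
  simp only [tw, Matrix.map_apply, map_smul]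

theorem IsRTT.map {T Tb : Matrix (Fin (2*n)) (Fin (2*n)) B} (h : IsRTT T Tb) (f : B →ₐ[F] C) :
    IsRTT (T.map f) (Tb.map f) := by
  have hm : ∀ X Y : Matrix (Fin (2*n)) (Fin (2*n)) B, X * Y = 1 → X.map f * Y.map f = 1 := by
    intro X Y hXY
    have := congrArg (fun M => M.map f) hXY
    simp only [Matrix.map_mul] at this
    rw [this]; exact Matrix.map_one _ (map_zero f) (map_one f)
  exact
  { t_upper := fun i j hij => by rw [Matrix.map_apply, h.t_upper i j hij, map_zero]
    tb_lower := fun i j hij => by rw [Matrix.map_apply, h.tb_lower i j hij, map_zero]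
    d1 := fun i => by rw [Matrix.map_apply, Matrix.map_apply, ← map_mul, h.d1, map_one]
    d2 := fun i => by rw [Matrix.map_apply, Matrix.map_apply, ← map_mul, h.d2, map_one]
    tt := h.tt.map f
    bb := h.bb.map f
    bt := h.bt.map f
    c1 := by rw [tw_map]; exact hm _ _ h.c1
    c2 := by rw [tw_map]; exact hm _ _ h.c2
    cb1 := by rw [tw_map]; exact hm _ _ h.cb1
    cb2 := by rw [tw_map]; exact hm _ _ h.cb2 }

/-- Scalar matrices over `U`. -/
def embM (n : ℕ) : Matrix (Fin (2*n)) (Fin (2*n)) F →ₐ[F] Matrix (Fin (2*n)) (Fin (2*n)) (Usp n) :=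
  (Algebra.ofId F (Usp n)).mapMatrix

def embS (n : ℕ) : Usp n →ₐ[F] Matrix (Fin (2*n)) (Fin (2*n)) (Usp n) :=
  AlgHom.ofLinearMap
    { toFun := fun x => Matrix.diagonal fun _ => x
      map_add' := fun x y => by simp
      map_smul' := fun c x => by ext i j; simp [Matrix.diagonal_apply] } (by simp) (by simp)

theorem embM_apply (M : Matrix (Fin (2*n)) (Fin (2*n)) F) (m r : Fin (2*n)) :
    embM n M m r = algebraMap F (Usp n) (M m r) := rfl

theorem embS_apply (x : Usp n) : embS n x = Matrix.diagonal fun _ => x := rfl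

theorem emb_comm (M : Matrix (Fin (2*n)) (Fin (2*n)) F) (x : Usp n) :
    embM n M * embS n x = embS n x * embM n M := by
  ext m r
  rw [embS_apply, Matrix.mul_diagonal, Matrix.diagonal_mul, embM_apply, Algebra.commutes]

theorem delta_isRTT (n : ℕ) : IsRTT ((rT n).map (embM n) * (TU n).map (embS n))
    ((rTb n).map (embM n) * (TbU n).map (embS n)) := by
  refine IsRTT.mul ((fund_isRTT n).map _) ((U_isRTT n).map _) ?_ ?_ ?_ ?_ <;>
  · intro i j a b
    simp only [Matrix.map_apply]
    exact emb_comm _ _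

/-- The coaction of the fundamental representation. -/
def dlt (n : ℕ) : Usp n →ₐ[F] Matrix (Fin (2*n)) (Fin (2*n)) (Usp n) := liftU (delta_isRTT n)

theorem emb_mul_apply (M : Matrix (Fin (2*n)) (Fin (2*n)) F) (x : Usp n) (m r : Fin (2*n)) :
    (embM n M * embS n x) m r = M m r • x := by
  rw [embS_apply, Matrix.mul_diagonal, embM_apply, Algebra.smul_def]

theorem dlt_t (i j : Fin (2*n)) :
    dlt n (tU n i j) = ∑ a, embM n (rT n i a) * embS n (tU n a j) := by
  rw [dlt, liftU_t, Matrix.mul_apply]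
  simp only [Matrix.map_apply]
  rfl

theorem dlt_tb (i j : Fin (2*n)) :
    dlt n (tbU n i j) = ∑ a, embM n (rTb n i a) * embS n (tbU n a j) := by
  rw [dlt, liftU_tb, Matrix.mul_apply]
  simp only [Matrix.map_apply]
  rfl

theorem tU_zero {i j : Fin (2*n)} (h : i < j) : tU n i j = 0 := (U_isRTT n).t_upper i j h
theorem tbU_zero {i j : Fin (2*n)} (h : j < i) : tbU n i j = 0 := (U_isRTT n).tb_lower i j h

theorem sU_eq (i j : Fin (2*n)) : sU n i j = ∑ k, eps n k • (tU n i k * tbU n j k) := by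
  rw [sU]
  refine Finset.sum_subset (Finset.subset_univ _) fun k _ hk => ?_
  rw [Finset.mem_Icc, not_and_or, not_le, not_le] at hk
  rcases hk with h | h
  · rw [tbU_zero h, mul_zero, smul_zero]
  · rw [tU_zero h, zero_mul, smul_zero]

theorem sU_zero {i j : Fin (2*n)} (h : i < j) : sU n i j = 0 := by
  rw [sU, Finset.Icc_eq_empty (not_le.2 h), Finset.sum_empty]

theorem sU_diag (i : Fin (2*n)) : sU n i i = eps n i • 1 := by
  rw [sU, Finset.Icc_self, Finset.sum_singleton]
  have := (U_isRTT n).d1 i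
  rw [show tU n i i * tbU n i i = 1 from this]

/-- The coaction on the `s`-generators. -/
theorem dlt_s (i j : Fin (2*n)) :
    dlt n (sU n i j) = ∑ a, ∑ b, embM n (rT n i a * rTb n j b) * embS n (sU n a b) := by
  rw [sU_eq]
  simp only [map_sum, map_smul, map_mul, dlt_t, dlt_tb]
  simp only [sU_eq, map_sum, map_smul, map_mul, Finset.mul_sum, Finset.sum_mul, Finset.smul_sum]
  have hc : ∀ k a b, (embM n (rT n i a) * embS n (tU n a k)) * (embM n (rTb n j b) * embS n (tbU n b k))
      = embM n (rT n i a) * embM n (rTb n j b) * (embS n (tU n a k) * embS n (tbU n b k)) := by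
    intro k a b
    rw [mul_assoc, ← mul_assoc (embS n (tU n a k)), ← emb_comm]
    simp only [mul_assoc]
  simp only [hc, mul_smul_comm]
  rw [Finset.sum_comm]
  conv_rhs => rw [Finset.sum_comm]
  refine Finset.sum_congr rfl fun a _ => ?_
  rw [Finset.sum_comm]

theorem dlt_s_apply (i j m r : Fin (2*n)) :
    dlt n (sU n i j) m r = ∑ a, ∑ b, (rT n i a * rTb n j b) m r • sU n a b := by
  rw [dlt_s, Matrix.sum_apply]
  refine Finset.sum_congr rfl fun a _ => ?_
  rw [Matrix.sum_apply]
  exact Finset.sum_congr rfl fun b _ => emb_mul_apply _ _ _ _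

theorem cou_s (i j : Fin (2*n)) : cou n (sU n i j) = if i = j then eps n i else 0 := by
  rw [sU_eq]
  simp only [map_sum, map_smul, map_mul, cou, liftU_t, liftU_tb, Matrix.one_apply]
  by_cases h : i = j
  · subst h; simp
  · simp [h]

end Delta

section Refl

variable {n : ℕ}

/-- The partial transpose of R. -/
def Xg (n : ℕ) : Matrix (Fin (2*n) × Fin (2*n)) (Fin (2*n) × Fin (2*n)) F :=
  fun p s => Rg n q (s.1, p.2) (p.1, s.2)

theorem Xg_apply (i a j b : Fin (2*n)) : Xg n (i, a) (j, b) =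
    (if i = j ∧ a = b then q ^ ee n i a else 0)
    + (if j < a ∧ i = a ∧ b = j then q - q⁻¹ else 0)
    + (if j < i ∧ a = pr n j ∧ b = pr n i then (q - q⁻¹) * (pp n q j * pp n q (pr n i)) else 0) := by
  have h : Xg n (i, a) (j, b) = Rg n q (j, a) (i, b) := rfl
  rw [h, Rg_apply q_ne]
  congr 2
  by_cases h : i = j ∧ a = b
  · obtain ⟨rfl, rfl⟩ := h; simp [ee]
  · rw [if_neg h, if_neg]; rintro ⟨h1, h2⟩; exact h ⟨h1.symm, h2⟩

theorem Xg_mulVec (f : Fin (2*n) × Fin (2*n) → F) (x y : Fin (2*n)) :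
    (Xg n).mulVec f (x, y) = q ^ ee n x y * f (x, y)
      + (if x = y then (q - q⁻¹) * ∑ s, (if s < x then f (s, s) else 0) else 0)
      + (if pr n y < x then (q - q⁻¹) * (pp n q (pr n y) * pp n q (pr n x)) * f (pr n y, pr n x)
          else 0) := by
  rw [Matrix.mulVec, dotProduct, Fintype.sum_prod_type]
  simp only [Xg_apply, add_mul, Finset.sum_add_distrib]
  congr 1
  · congr 1
    · rw [Finset.sum_eq_single x, Finset.sum_eq_single y]
      · rw [if_pos ⟨rfl, rfl⟩]
      · intro b _ hb; rw [if_neg, zero_mul]; rintro ⟨_, h⟩; exact hb h.symm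
      · simp
      · intro b _ hb; refine Finset.sum_eq_zero fun c _ => ?_
        rw [if_neg, zero_mul]; rintro ⟨h, _⟩; exact hb h.symm
      · simp
    · by_cases h : x = y
      · subst h
        rw [if_pos rfl, Finset.mul_sum]
        refine Finset.sum_congr rfl fun s _ => ?_
        rw [Finset.sum_eq_single s]
        · by_cases h2 : s < x
          · rw [if_pos ⟨h2, rfl, rfl⟩, if_pos h2]
          · rw [if_neg (fun h => h2 h.1), if_neg h2]; simp
        · intro b _ hb; rw [if_neg, zero_mul]; rintro ⟨_, _, h⟩; exact hb h
        · simp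
      · rw [if_neg h]
        refine Finset.sum_eq_zero fun b _ => Finset.sum_eq_zero fun c _ => ?_
        rw [if_neg, zero_mul]; rintro ⟨_, h2, _⟩; exact h h2
  · rw [Finset.sum_eq_single (pr n y), Finset.sum_eq_single (pr n x)]
    · simp only [pr_pr, and_true]
      split_ifs <;> simp
    · intro b _ hb; rw [if_neg, zero_mul]; rintro ⟨_, _, h⟩; exact hb h
    · simp
    · intro b _ hb; refine Finset.sum_eq_zero fun c _ => ?_
      rw [if_neg, zero_mul]; rintro ⟨_, h, _⟩; exact hb (eq_pr_comm.1 h)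
    · simp

/-- J in the two slots. -/
def Jd1 (n : ℕ) : Matrix (Fin (2*n) × Fin (2*n)) (Fin (2*n) × Fin (2*n)) F :=
  Matrix.diagonal fun p => eps n p.1
def Jd2 (n : ℕ) : Matrix (Fin (2*n) × Fin (2*n)) (Fin (2*n) × Fin (2*n)) F :=
  Matrix.diagonal fun p => eps n p.2

theorem JRel : Rg n q * Jd1 n * Xg n * Jd2 n = Jd2 n * Xg n * Jd1 n * Rg n q := by
  apply Matrix.ext_of_mulVec_single
  intro p
  generalize (Pi.single p 1 : Fin (2*n) × Fin (2*n) → F) = f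
  simp only [← Matrix.mulVec_mulVec]
  have hJ1 : ∀ (g : Fin (2*n) × Fin (2*n) → F) x y, (Jd1 n).mulVec g (x, y) = eps n x * g (x, y) := by
    intro g x y; rw [Jd1, Matrix.mulVec_diagonal]
  have hJ2 : ∀ (g : Fin (2*n) × Fin (2*n) → F) x y, (Jd2 n).mulVec g (x, y) = eps n y * g (x, y) := by
    intro g x y; rw [Jd2, Matrix.mulVec_diagonal]
  funext ⟨x, y⟩
  have eL : ∀ x y, (Jd1 n).mulVec ((Xg n).mulVec ((Jd2 n).mulVec f)) (x, y)
      = eps n x * (q ^ ee n x y * (eps n y * f (x, y))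
      + (if x = y then (q - q⁻¹) * ∑ s, (if s < x then eps n s * f (s, s) else 0) else 0)
      + (if pr n y < x then (q - q⁻¹) * (pp n q (pr n y) * pp n q (pr n x)) *
        (eps n (pr n x) * f (pr n y, pr n x)) else 0)) := by
    intro x y; rw [hJ1, Xg_mulVec]; simp only [hJ2]
  have eR : (Jd2 n).mulVec ((Xg n).mulVec ((Jd1 n).mulVec ((Rg n q).mulVec f))) (x, y)
      = eps n y * (q ^ ee n x y * (eps n x * (Rg n q).mulVec f (x, y))
      + (if x = y then (q - q⁻¹) * ∑ s, (if s < x then eps n s * (Rg n q).mulVec f (s, s) else 0) else 0)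
      + (if pr n y < x then (q - q⁻¹) * (pp n q (pr n y) * pp n q (pr n x)) *
        (eps n (pr n y) * (Rg n q).mulVec f (pr n y, pr n x)) else 0)) := by
    rw [hJ2, Xg_mulVec]; simp only [hJ1]
  rw [eR, Rg_mulVec q_ne]
  simp only [eL]
  have hRd : ∀ s, (Rg n q).mulVec f (s, s) = q * f (s, s) := by
    intro s
    rw [Rg_mulVec q_ne, if_neg (lt_irrefl _), if_neg (fun h => pr_ne s h.symm), ee, if_pos rfl,
      if_neg (fun h => pr_ne s h.symm)]
    simp
  have eed : ee n x x = 1 := by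
    rw [ee, if_pos rfl, if_neg (fun h => pr_ne x h.symm)]; norm_num
  have eep : ∀ s, ee n s (pr n s) = -1 := by
    intro s
    rw [ee, pr_pr, if_pos rfl, if_neg (fun h => pr_ne s h.symm)]; norm_num
  by_cases hxy : x = y
  · subst hxy
    simp only [hRd, if_neg (lt_irrefl x), if_neg (fun h : x = pr n x => pr_ne x h.symm), eed,
      if_true, zpow_one, eps_pr]
    have e1 : ∑ s, (if s < x then eps n s * (q * f (s, s)) else 0)
        = q * ∑ s, (if s < x then eps n s * f (s, s) else 0) := by
      rw [Finset.mul_sum]; refine Finset.sum_congr rfl fun s _ => ?_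
      split_ifs <;> ring
    rw [e1]
    split_ifs <;> ring
  by_cases hp : y = pr n x
  · subst hp
    have eep2 : ee n (pr n x) x = -1 := by rw [ee_comm, eep]
    have e2 : ∀ s : Fin (2*n), s ≠ pr n s := fun s h => pr_ne s h.symm
    simp only [pr_pr, lt_irrefl, if_false, if_neg (e2 _), if_neg (pr_ne _), eep, eep2, if_true,
      eps_pr, add_zero]
    rw [Rg_mulVec q_ne, if_pos rfl, eep]
    have e1 : ∑ s, (if x < s then pp n q (pr n s) * (eps n s * (q ^ (-1:ℤ) * (-eps n s * f (s, pr n s)))) else 0)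
        = - q ^ (-1:ℤ) * ∑ s, (if x < s then pp n q (pr n s) * f (s, pr n s) else 0) := by
      rw [Finset.mul_sum]; refine Finset.sum_congr rfl fun s _ => ?_
      have := eps_mul_self s
      split_ifs
      · linear_combination (-pp n q (pr n s) * q ^ (-1:ℤ) * f (s, pr n s)) * this
      · ring
    rw [e1]
    have := eps_mul_self x
    generalize (∑ s, (if x < s then pp n q (pr n s) * f (s, pr n s) else 0)) = S
    split_ifs
    · linear_combination ((q - q⁻¹) * pp n q x * q ^ (-1:ℤ) * S) * this
    · linear_combination ((q - q⁻¹) * pp n q x * q ^ (-1:ℤ) * S) * this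
  have hyx : y ≠ x := fun h => hxy h.symm
  have hp2 : x ≠ pr n y := fun h => hp (eq_pr_comm.1 h)
  have ee1 : ee n x y = 0 := by rw [ee, if_neg hxy, if_neg hp2]; norm_num
  have ee2 : ee n y x = 0 := by rw [ee_comm, ee1]
  have hR1 : (Rg n q).mulVec f (x, y) = f (x, y) + (if x < y then (q - q⁻¹) * f (y, x) else 0) := by
    rw [Rg_mulVec q_ne, if_neg hp, ee1]; simp
  have hR2 : (Rg n q).mulVec f (pr n y, pr n x) = f (pr n y, pr n x)
      + (if x < y then (q - q⁻¹) * f (pr n x, pr n y) else 0) := by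
    rw [Rg_mulVec q_ne, if_neg (c := pr n x = pr n (pr n y)) (fun h => hp (by rw [pr_pr] at h; exact h.symm)), ee,
      if_neg (fun h => hyx (pr_inj.1 h)), if_neg (fun h => hp (by rw [pr_pr] at h; rw [← h, pr_pr]))]
    simp [pr_lt]
  simp only [hR1, hR2, if_neg hp, if_neg hxy, if_neg hyx, ee1, ee2]
  simp only [eps_pr]
  have h3 : pr n x < y ↔ pr n y < x := by
    simp only [Fin.lt_def, pr_val]; omega
  simp only [h3, zpow_zero]
  have hx := eps_mul_self x
  have hy := eps_mul_self y
  by_cases h5 : pr n y < x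
  · by_cases h4 : x < y <;> simp only [h4, h5, if_true, if_false] <;>
    linear_combination ((q - q⁻¹) * (pp n q (pr n y) * pp n q (pr n x)) * f (pr n y, pr n x)) * (hy - hx)
  · by_cases h4 : x < y <;> simp only [h4, h5, if_true, if_false] <;> ring

/-- The matrices over `U`. -/
def SU (n : ℕ) : Matrix (Fin (2*n)) (Fin (2*n)) (Usp n) := Matrix.of fun i j => sU n i j
def JU (n : ℕ) : Matrix (Fin (2*n)) (Fin (2*n)) (Usp n) :=
  Matrix.diagonal fun i => algebraMap F (Usp n) (eps n i)
def XB (n : ℕ) : Matrix (Fin (2*n) × Fin (2*n)) (Fin (2*n) × Fin (2*n)) (Usp n) :=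
  (Xg n).map (algebraMap F (Usp n))

theorem SU_eq : SU n = TU n * JU n * (TbU n).transpose := by
  ext i j
  rw [Matrix.mul_apply]
  simp only [JU, Matrix.mul_diagonal, Matrix.transpose_apply]
  rw [show SU n i j = sU n i j from rfl, sU_eq]
  refine Finset.sum_congr rfl fun k _ => ?_
  rw [Algebra.smul_def, ← mul_assoc, Algebra.commutes]; rfl

theorem E1_JU : E1 (JU n) = (Jd1 n).map (algebraMap F (Usp n)) := by
  ext ⟨i, a⟩ ⟨j, b⟩
  simp only [E1, JU, Jd1, Matrix.map_apply, Matrix.diagonal_apply, Prod.mk.injEq]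
  by_cases h : i = j <;> by_cases h2 : a = b <;> simp [h, h2]

theorem E2_JU : E2 (JU n) = (Jd2 n).map (algebraMap F (Usp n)) := by
  ext ⟨i, a⟩ ⟨j, b⟩
  simp only [E2, JU, Jd2, Matrix.map_apply, Matrix.diagonal_apply, Prod.mk.injEq]
  by_cases h : i = j <;> by_cases h2 : a = b <;> simp [h, h2]

theorem JRelB : RB n (Usp n) * E1 (JU n) * XB n * E2 (JU n)
    = E2 (JU n) * XB n * E1 (JU n) * RB n (Usp n) := by
  have h := congrArg (fun M => M.map (algebraMap F (Usp n))) (JRel (n := n))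
  simp only [Matrix.map_mul] at h
  rw [E1_JU, E2_JU]; exact h

theorem bbT : RTT (TbU n).transpose (TbU n).transpose := by
  have h := (RTT_iff _ _).1 (U_isRTT n).bb
  rw [RTT_iff]
  intro i a j b
  have h2 := h b j a i
  rw [Finset.sum_comm] at h2
  simp only [Matrix.transpose_apply]
  simp only [Rm_eq] at h2 ⊢
  have e1 : ∀ k c, Rg n q (i, a) (k, c) = Rg n q (c, k) (a, i) := fun k c => Rg_transpose q_ne _ _ _ _
  have e2 : ∀ l c, Rg n q (l, c) (j, b) = Rg n q (b, j) (c, l) := fun k c => Rg_transpose q_ne _ _ _ _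
  simp only [e1, e2]
  rw [← h2, Finset.sum_comm]

section
variable {B : Type*} [Ring B] [Algebra F B] (T : Matrix (Fin (2*n)) (Fin (2*n)) B)
  (M : Matrix (Fin (2*n) × Fin (2*n)) (Fin (2*n) × Fin (2*n)) B)

theorem E1M (i a j b : Fin (2*n)) : (E1 T * M) (i, a) (j, b) = ∑ k, T i k * M (k, a) (j, b) := by
  rw [Matrix.mul_apply, Fintype.sum_prod_type]
  simp only [E1, ite_mul, zero_mul, Finset.sum_ite_eq, Finset.mem_univ, if_true]
theorem E2M (i a j b : Fin (2*n)) : (E2 T * M) (i, a) (j, b) = ∑ k, T a k * M (i, k) (j, b) := by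
  rw [Matrix.mul_apply, Fintype.sum_prod_type]
  simp only [E2, ite_mul, zero_mul, Finset.sum_ite_irrel, Finset.sum_const_zero,
    Finset.sum_ite_eq, Finset.mem_univ, if_true]
theorem ME1 (i a j b : Fin (2*n)) : (M * E1 T) (i, a) (j, b) = ∑ k, M (i, a) (k, b) * T k j := by
  rw [Matrix.mul_apply, Fintype.sum_prod_type]
  simp only [E1, mul_ite, mul_zero, Finset.sum_ite_eq', Finset.mem_univ, if_true]
theorem ME2 (i a j b : Fin (2*n)) : (M * E2 T) (i, a) (j, b) = ∑ k, M (i, a) (j, k) * T k b := by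
  rw [Matrix.mul_apply, Fintype.sum_prod_type]
  simp only [E2, mul_ite, mul_zero, Finset.sum_ite_irrel, Finset.sum_const_zero,
    Finset.sum_ite_eq', Finset.mem_univ, if_true]
end

theorem XB_apply (i a j b : Fin (2*n)) :
    XB n (i, a) (j, b) = algebraMap F (Usp n) (Rg n q (j, a) (i, b)) := rfl

theorem bX1 : E1 (TbU n).transpose * XB n * E2 (TU n) = E2 (TU n) * XB n * E1 (TbU n).transpose := by
  have h := (RTT_iff _ _).1 (U_isRTT n).bt
  ext ⟨i, a⟩ ⟨j, b⟩
  have h2 := h j a i b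
  simp only [ME2, E1M, ME1, E2M, XB_apply, Finset.sum_mul, Matrix.transpose_apply]
  simp only [Algebra.smul_def, Rm_eq] at h2
  rw [Finset.sum_comm]
  refine Eq.trans ?_ (h2.trans ?_)
  · refine Finset.sum_congr rfl fun k _ => Finset.sum_congr rfl fun c _ => ?_
    rw [← mul_assoc, Algebra.commutes]
  · rw [Finset.sum_comm]
    refine Finset.sum_congr rfl fun k _ => Finset.sum_congr rfl fun c _ => ?_
    rw [← mul_assoc, Algebra.commutes]

theorem bX2 : E1 (TU n) * XB n * E2 (TbU n).transpose = E2 (TbU n).transpose * XB n * E1 (TU n) := by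
  have h := (RTT_iff _ _).1 (U_isRTT n).bt
  ext ⟨i, a⟩ ⟨j, b⟩
  have h2 := h b i a j
  simp only [ME2, E1M, ME1, E2M, XB_apply, Finset.sum_mul, Matrix.transpose_apply]
  simp only [Algebra.smul_def, Rm_eq] at h2
  symm
  refine Eq.trans ?_ (h2.trans ?_)
  · rw [Finset.sum_comm]
    refine Finset.sum_congr rfl fun k _ => Finset.sum_congr rfl fun c _ => ?_
    rw [← mul_assoc, Algebra.commutes, Rg_transpose q_ne]
  · rw [Finset.sum_comm]
    refine Finset.sum_congr rfl fun k _ => Finset.sum_congr rfl fun c _ => ?_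
    rw [← mul_assoc, Algebra.commutes, Rg_transpose q_ne]

/-- The reflection equation. -/
theorem REq : RB n (Usp n) * E1 (SU n) * XB n * E2 (SU n)
    = E2 (SU n) * XB n * E1 (SU n) * RB n (Usp n) := by
  have hc : ∀ (T : Matrix (Fin (2*n)) (Fin (2*n)) (Usp n)), E1 T * E2 (JU n) = E2 (JU n) * E1 T := by
    intro T
    ext ⟨i, a⟩ ⟨j, b⟩; rw [E1E2_apply, E2E1_apply, JU, Matrix.diagonal_apply]
    split_ifs
    · rw [Algebra.commutes]
    · simp
  have hc' : ∀ (T : Matrix (Fin (2*n)) (Fin (2*n)) (Usp n)), E1 (JU n) * E2 T = E2 T * E1 (JU n) := by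
    intro T
    ext ⟨i, a⟩ ⟨j, b⟩; rw [E1E2_apply, E2E1_apply, JU, Matrix.diagonal_apply]
    split_ifs
    · rw [Algebra.commutes]
    · simp
  have h1 := bX1 (n := n)
  have h2 := bX2 (n := n)
  have h3 := (U_isRTT n).tt
  have h4 := bbT (n := n)
  have h5 := JRelB (n := n)
  unfold RTT at h3 h4
  rw [SU_eq, E1_mul, E1_mul, E2_mul, E2_mul]
  have c1 := hc (TbU n).transpose
  have c2 := hc' (TU n)
  have c3 := hc (TU n)
  have c4 := hc' (TbU n).transpose
  set R := RB n (Usp n)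
  set X := XB n
  set T1 := E1 (TU n)
  set T2 := E2 (TU n)
  set B1 := E1 (TbU n).transpose
  set B2 := E2 (TbU n).transpose
  set J1 := E1 (JU n)
  set J2 := E2 (JU n)
  calc R * (T1 * J1 * B1) * X * (T2 * J2 * B2) = R * T1 * J1 * (B1 * X * T2) * J2 * B2 := by
        simp only [mul_assoc]
    _ = R * T1 * (J1 * T2) * X * (B1 * J2) * B2 := by rw [h1]; simp only [mul_assoc]
    _ = (R * (T1 * T2)) * J1 * X * J2 * B1 * B2 := by rw [c1, c2]; simp only [mul_assoc]
    _ = T2 * T1 * (R * J1 * X * J2) * B1 * B2 := by rw [h3]; simp only [mul_assoc]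
    _ = T2 * T1 * J2 * X * J1 * (R * (B1 * B2)) := by rw [h5]; simp only [mul_assoc]
    _ = T2 * (T1 * J2) * X * (J1 * B2) * B1 * R := by rw [h4]; simp only [mul_assoc]
    _ = T2 * J2 * (T1 * X * B2) * J1 * B1 * R := by rw [c3, c4]; simp only [mul_assoc]
    _ = _ := by rw [h2]; simp only [mul_assoc]

end Refl

section Val

open Polynomial

/-- The point q = 1. -/
def hs : IsDedekindDomain.HeightOneSpectrum ℂ[X] where
  asIdeal := Ideal.span {X - C (1:ℂ)}
  isPrime := by
    rw [Ideal.span_singleton_prime (X_sub_C_ne_zero _)]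
    exact prime_X_sub_C _
  ne_bot := by
    rw [Ne, Ideal.span_singleton_eq_bot]
    exact X_sub_C_ne_zero _

/-- The valuation at q = 1. -/
def vv : Valuation F (WithZero (Multiplicative ℤ)) := hs.valuation F

theorem vv_alg_le (p : ℂ[X]) : vv (algebraMap ℂ[X] F p) ≤ 1 := hs.valuation_le_one p

theorem vv_alg_lt (p : ℂ[X]) : vv (algebraMap ℂ[X] F p) < 1 ↔ p.eval 1 = 0 := by
  rw [vv, hs.valuation_lt_one_iff_mem]
  rw [hs, Ideal.mem_span_singleton, dvd_iff_isRoot, IsRoot.def]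

theorem vv_alg_eq (p : ℂ[X]) (h : p.eval 1 ≠ 0) : vv (algebraMap ℂ[X] F p) = 1 :=
  le_antisymm (vv_alg_le p) (not_lt.1 fun h2 => h ((vv_alg_lt p).1 h2))

theorem q_alg : q = algebraMap ℂ[X] F X := RatFunc.algebraMap_X.symm

theorem vq : vv q = 1 := by rw [q_alg]; exact vv_alg_eq _ (by simp)

theorem vq1 : vv (q + 1) = 1 := by
  rw [q_alg, ← map_one (algebraMap ℂ[X] F), ← map_add]
  exact vv_alg_eq _ (by simp)

theorem vqm : vv (q - 1) < 1 := by
  rw [q_alg, ← map_one (algebraMap ℂ[X] F), ← map_sub, vv_alg_lt]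
  simp

theorem vnat (m : ℕ) (h : m ≠ 0) : vv (m : F) = 1 := by
  rw [← map_natCast (algebraMap ℂ[X] F)]
  exact vv_alg_eq _ (by simpa using h)

/-- ζ = q − q⁻¹. -/
def zt : F := q - q⁻¹

theorem q1_ne : q + 1 ≠ 0 := fun h => by have := vq1; rw [h, map_zero] at this; exact zero_ne_one this

theorem qm_ne : q - 1 ≠ 0 := by
  rw [q_alg, ← map_one (algebraMap ℂ[X] F), ← map_sub]
  have := (X_sub_C_ne_zero (1:ℂ))
  rw [Ne, map_eq_zero_iff _ (RatFunc.algebraMap_injective ℂ)]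
  simpa using this

theorem zt_eq : zt = (q - 1) * (q + 1) * q⁻¹ := by
  have := q_ne
  rw [zt]; field_simp; ring

theorem zt_ne : zt ≠ 0 := by
  rw [zt_eq]; exact mul_ne_zero (mul_ne_zero qm_ne q1_ne) (inv_ne_zero q_ne)

theorem vzt : vv zt < 1 := by
  rw [zt_eq, map_mul, map_mul, map_inv₀, vq, vq1]; simpa using vqm

theorem veps {n : ℕ} (i : Fin (2*n)) : vv (eps n i) = 1 := by
  unfold eps; split_ifs <;> simp

theorem vqz (m : ℤ) : vv (q ^ m) = 1 := by rw [map_zpow₀, vq, one_zpow]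
theorem vqiz (m : ℤ) : vv (q⁻¹ ^ m) = 1 := by rw [map_zpow₀, map_inv₀, vq, inv_one, one_zpow]

theorem vpp {n : ℕ} (i : Fin (2*n)) : vv (pp n q i) = 1 := by
  rw [pp, map_mul, veps, vqz, one_mul]
theorem vppi {n : ℕ} (i : Fin (2*n)) : vv (pp n q⁻¹ i) = 1 := by
  rw [pp, map_mul, veps, vqiz, one_mul]

theorem vdd {n : ℕ} (i : Fin (2*n)) : vv (dd n i) = 1 := vqz _

/-- The local ring. -/
def Oo : Subring F := vv.integer

theorem mem_Oo (x : F) : x ∈ Oo ↔ vv x ≤ 1 := Iff.rfl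

/-- congruence to 1: (q^m - 1)/ζ is integral -/
theorem vqm1 (m : ℤ) : vv (zt⁻¹ * (q ^ m - 1)) ≤ 1 := by
  have hn : ∀ m : ℕ, vv (zt⁻¹ * (q ^ m - 1)) ≤ 1 := by
    intro m
    have : zt⁻¹ * (q ^ m - 1) = (q + 1)⁻¹ * q * ∑ i ∈ Finset.range m, q ^ i := by
      rw [← mul_geom_sum, zt_eq]
      have h1 := q_ne; have h2 := q1_ne; have h3 := qm_ne
      field_simp
    rw [this, map_mul, map_mul, map_inv₀, vq1, vq, inv_one, one_mul, one_mul]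
    refine Valuation.map_sum_le vv fun i _ => ?_
    rw [map_pow, vq, one_pow]
  obtain ⟨k, rfl | rfl⟩ := m.eq_nat_or_neg
  · rw [zpow_natCast]; exact hn k
  · have : zt⁻¹ * (q ^ (-(k:ℤ)) - 1) = - (q ^ (-(k:ℤ))) * (zt⁻¹ * (q ^ k - 1)) := by
      rw [zpow_neg, zpow_natCast]
      have := pow_ne_zero k q_ne
      field_simp; ring
    rw [this, map_mul, Valuation.map_neg, vqz, one_mul]; exact hn k

theorem vdd1 {n : ℕ} (i j : Fin (2*n)) : vv (zt⁻¹ * (dd n i * (dd n j)⁻¹ - 1)) ≤ 1 := by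
  rw [dd, dd, ← zpow_neg, ← zpow_add₀ q_ne]; exact vqm1 _

theorem vRg1 {n : ℕ} (i a j b : Fin (2*n)) :
    vv (zt⁻¹ * (Rg n q (i, a) (j, b) - if i = j ∧ a = b then 1 else 0)) ≤ 1 := by
  rw [Rg_apply q_ne]
  have : zt⁻¹ * ((if i = j ∧ a = b then
      q ^ ((if i = a then (1:ℤ) else 0) - (if i = pr n a then (1:ℤ) else 0)) else 0)
    + (if i < a ∧ j = a ∧ b = i then q - q⁻¹ else 0)
    + (if i < j ∧ a = pr n i ∧ b = pr n j then
        (q - q⁻¹) * (pp n q i * pp n q (pr n j)) else 0) - if i = j ∧ a = b then 1 else 0)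
      = (if i = j ∧ a = b then zt⁻¹ * (
      q ^ ((if i = a then (1:ℤ) else 0) - (if i = pr n a then (1:ℤ) else 0)) - 1) else 0)
    + (if i < a ∧ j = a ∧ b = i then 1 else 0)
    + (if i < j ∧ a = pr n i ∧ b = pr n j then (pp n q i * pp n q (pr n j)) else 0) := by
    have hz := zt_ne
    rw [show q - q⁻¹ = zt from rfl]
    split_ifs <;> field_simp <;> ring
  rw [this]
  refine Valuation.map_add_le _ (Valuation.map_add_le _ ?_ ?_) ?_
  · by_cases h : i = j ∧ a = b
    · rw [if_pos h]; exact vqm1 _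
    · rw [if_neg h, map_zero]; exact zero_le_one
  · split_ifs <;> simp
  · split_ifs
    · rw [map_mul, vpp, vpp]; simp
    · simp

theorem vRgi1 {n : ℕ} (i a j b : Fin (2*n)) :
    vv (zt⁻¹ * (Rg n q⁻¹ (i, a) (j, b) - if i = j ∧ a = b then 1 else 0)) ≤ 1 := by
  rw [Rg_apply qi_ne, inv_inv]
  have : zt⁻¹ * ((if i = j ∧ a = b then
      q⁻¹ ^ ((if i = a then (1:ℤ) else 0) - (if i = pr n a then (1:ℤ) else 0)) else 0)
    + (if i < a ∧ j = a ∧ b = i then q⁻¹ - q else 0)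
    + (if i < j ∧ a = pr n i ∧ b = pr n j then
        (q⁻¹ - q) * (pp n q⁻¹ i * pp n q⁻¹ (pr n j)) else 0) - if i = j ∧ a = b then 1 else 0)
      = (if i = j ∧ a = b then zt⁻¹ * (
      q⁻¹ ^ ((if i = a then (1:ℤ) else 0) - (if i = pr n a then (1:ℤ) else 0)) - 1) else 0)
    + (if i < a ∧ j = a ∧ b = i then -1 else 0)
    + (if i < j ∧ a = pr n i ∧ b = pr n j then -(pp n q⁻¹ i * pp n q⁻¹ (pr n j)) else 0) := by
    have hz := zt_ne
    rw [show q⁻¹ - q = -zt by rw [zt]; ring]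
    split_ifs <;> field_simp <;> ring
  rw [this]
  refine Valuation.map_add_le _ (Valuation.map_add_le _ ?_ ?_) ?_
  · by_cases h : i = j ∧ a = b
    · rw [if_pos h, inv_zpow, ← zpow_neg]; exact vqm1 _
    · rw [if_neg h, map_zero]; exact zero_le_one
  · split_ifs <;> simp
  · split_ifs
    · rw [Valuation.map_neg, map_mul, vppi, vppi]; simp
    · simp

theorem Rg_wt {n : ℕ} {Q : F} (hQ : Q ≠ 0) (i a j b : Fin (2*n)) (h : Rg n Q (i, a) (j, b) ≠ 0) :
    (i : ℕ) + a = j + b := by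
  by_contra hne
  apply h
  rw [Rg_apply hQ, if_neg, if_neg, if_neg]
  · simp
  · rintro ⟨h1, rfl, rfl⟩; simp only [pr_val] at hne; omega
  · rintro ⟨h1, rfl, rfl⟩; omega
  · rintro ⟨rfl, rfl⟩; omega

end Val

section Filt
variable {n : ℕ}

/-- The renormalized generators. -/
def yy (n : ℕ) (i j : Fin (2*n)) : Usp n :=
  zt⁻¹ • (sU n i j - if i = j then eps n i • 1 else 0)

theorem yy_zero {i j : Fin (2*n)} (h : ¬ j < i) : yy n i j = 0 := by
  unfold yy
  by_cases e : i = j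
  · subst e; rw [if_pos rfl, sU_diag, sub_self, smul_zero]
  · rw [if_neg e, sU_zero (lt_of_le_of_ne (not_lt.1 h) e), sub_zero, smul_zero]

theorem sU_yy (i j : Fin (2*n)) :
    sU n i j = (if i = j then eps n i • 1 else 0) + zt • yy n i j := by
  rw [yy, smul_smul, mul_inv_cancel₀ zt_ne, one_smul]; abel

theorem sU_yy' {i j : Fin (2*n)} (h : j < i) : sU n i j = zt • yy n i j := by
  rw [sU_yy, if_neg (ne_of_gt h), zero_add]

/-- Words. -/
abbrev Wd (n : ℕ) := List (Fin (2*n) × Fin (2*n))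

/-- The product of a word. -/
def wy (w : Wd n) : Usp n := (w.map fun p => yy n p.1 p.2).prod

/-- The weight of a word. -/
def wt (w : Wd n) : ℤ := (w.map fun p => ((p.1 : ℕ) : ℤ) - ((p.2 : ℕ) : ℤ)).sum

/-- All letters are strictly lower triangular. -/
def good (w : Wd n) : Prop := ∀ p ∈ w, p.2 < p.1

theorem wy_nil : wy ([] : Wd n) = 1 := (rfl)
theorem wy_cons (p) (w : Wd n) : wy (p :: w) = yy n p.1 p.2 * wy w := by simp [wy]
theorem wy_append (u w : Wd n) : wy (u ++ w) = wy u * wy w := by simp [wy]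
theorem wt_nil : wt ([] : Wd n) = 0 := (rfl)
theorem wt_cons (p) (w : Wd n) : wt (p :: w) = ((p.1 : ℕ) : ℤ) - ((p.2 : ℕ) : ℤ) + wt w := by simp [wt]
theorem wt_append (u w : Wd n) : wt (u ++ w) = wt u + wt w := by simp [wt]
theorem good_append {u w : Wd n} (hu : good u) (hw : good w) : good (u ++ w) := by
  intro p hp; rcases List.mem_append.1 hp with h | h
  exacts [hu p h, hw p h]

theorem len_le_wt (w : Wd n) (h : good w) : (w.length : ℤ) ≤ wt w := by
  induction w with
  | nil => simp [wt_nil]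
  | cons p w ih =>
    have h1 := ih fun p hp => h p (List.mem_cons_of_mem _ hp)
    have h2 : (p.2 : ℕ) < p.1 := h p List.mem_cons_self
    rw [wt_cons, List.length_cons]; push_cast; omega

theorem Oo_smul_def (c : Oo) (x : Usp n) : c • x = (c : F) • x := rfl

/-- Span of words with bounded weight and length. -/
def Wm (n : ℕ) (d : ℤ) (l : ℕ) : Submodule Oo (Usp n) :=
  Submodule.span Oo {x | ∃ w : Wd n, good w ∧ wt w ≤ d ∧ w.length ≤ l ∧ wy w = x}

/-- Span of words with bounded weight. -/
def Md (n : ℕ) (d : ℤ) : Submodule Oo (Usp n) :=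
  Submodule.span Oo {x | ∃ w : Wd n, good w ∧ wt w ≤ d ∧ wy w = x}

theorem Wm_le_Md (d : ℤ) (l : ℕ) : Wm n d l ≤ Md n d :=
  Submodule.span_mono fun _ ⟨w, h1, h2, _, h4⟩ => ⟨w, h1, h2, h4⟩

theorem Wm_mono {d d' : ℤ} {l l' : ℕ} (hd : d ≤ d') (hl : l ≤ l') : Wm n d l ≤ Wm n d' l' :=
  Submodule.span_mono fun _ ⟨w, h1, h2, h3, h4⟩ => ⟨w, h1, h2.trans hd, h3.trans hl, h4⟩

theorem wy_mem {w : Wd n} (h : good w) : wy w ∈ Wm n (wt w) w.length :=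
  Submodule.subset_span ⟨w, h, le_rfl, le_rfl, rfl⟩

theorem F_smul_mem {M : Submodule Oo (Usp n)} {c : F} (hc : vv c ≤ 1) {x : Usp n} (hx : x ∈ M) :
    c • x ∈ M := M.smul_mem (⟨c, hc⟩ : Oo) hx

theorem Wm_mul {d d' : ℤ} {l l' : ℕ} {x y : Usp n} (hx : x ∈ Wm n d l) (hy : y ∈ Wm n d' l') :
    x * y ∈ Wm n (d + d') (l + l') := by
  refine Submodule.span_induction (p := fun x _ => x * y ∈ Wm n (d + d') (l + l')) ?_ ?_ ?_ ?_ hx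
  · rintro _ ⟨u, u1, u2, u3, rfl⟩
    refine Submodule.span_induction (p := fun y _ => wy u * y ∈ Wm n (d + d') (l + l')) ?_ ?_ ?_ ?_ hy
    · rintro _ ⟨w, w1, w2, w3, rfl⟩
      rw [← wy_append]
      refine Wm_mono ?_ ?_ (wy_mem (good_append u1 w1))
      · rw [wt_append]; omega
      · rw [List.length_append]; omega
    · rw [mul_zero]; exact zero_mem _
    · intro a b _ _ ha hb; rw [mul_add]; exact add_mem ha hb
    · intro c a _ ha
      rw [Oo_smul_def, mul_smul_comm]; exact F_smul_mem c.2 ha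
  · rw [zero_mul]; exact zero_mem _
  · intro a b _ _ ha hb; rw [add_mul]; exact add_mem ha hb
  · intro c a _ ha
    rw [Oo_smul_def, smul_mul_assoc]; exact F_smul_mem c.2 ha

theorem Md_mul {d d' : ℤ} {x y : Usp n} (hx : x ∈ Md n d) (hy : y ∈ Md n d') :
    x * y ∈ Md n (d + d') := by
  refine Submodule.span_induction (p := fun x _ => x * y ∈ Md n (d + d')) ?_ ?_ ?_ ?_ hx
  · rintro _ ⟨u, u1, u2, rfl⟩
    refine Submodule.span_induction (p := fun y _ => wy u * y ∈ Md n (d + d')) ?_ ?_ ?_ ?_ hy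
    · rintro _ ⟨w, w1, w2, rfl⟩
      rw [← wy_append]
      refine Submodule.subset_span ⟨_, good_append u1 w1, ?_, rfl⟩
      rw [wt_append]; omega
    · rw [mul_zero]; exact zero_mem _
    · intro a b _ _ ha hb; rw [mul_add]; exact add_mem ha hb
    · intro c a _ ha
      rw [Oo_smul_def, mul_smul_comm]; exact F_smul_mem c.2 ha
  · rw [zero_mul]; exact zero_mem _
  · intro a b _ _ ha hb; rw [add_mul]; exact add_mem ha hb
  · intro c a _ ha
    rw [Oo_smul_def, smul_mul_assoc]; exact F_smul_mem c.2 ha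

theorem one_mem_Wm {d : ℤ} (hd : 0 ≤ d) (l : ℕ) : (1 : Usp n) ∈ Wm n d l :=
  Submodule.subset_span ⟨[], by simp [good], by simpa [wt_nil] using hd, by simp, rfl⟩

theorem yy_mem (i j : Fin (2*n)) : yy n i j ∈ Wm n (((i:ℕ):ℤ) - ((j:ℕ):ℤ)) 1 := by
  by_cases h : j < i
  · exact Submodule.subset_span ⟨[(i, j)], by simpa [good] using h, by simp [wt], by simp,
      by simp [wy]⟩
  · rw [yy_zero h]; exact zero_mem _

abbrev MM (n : ℕ) := Matrix (Fin (2*n) × Fin (2*n)) (Fin (2*n) × Fin (2*n)) (Usp n)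

/-- Filtered matrices. -/
def Cl (l : ℕ) (A : MM n) : Prop :=
  ∀ i a j b : Fin (2*n), A (i, a) (j, b) ∈
    Wm n ((((i:ℕ):ℤ) + ((a:ℕ):ℤ)) - (((j:ℕ):ℤ) + ((b:ℕ):ℤ))) l

theorem Cl.add {l : ℕ} {A B : MM n} (hA : Cl l A) (hB : Cl l B) : Cl l (A + B) :=
  fun i a j b => add_mem (hA i a j b) (hB i a j b)
theorem Cl.sub {l : ℕ} {A B : MM n} (hA : Cl l A) (hB : Cl l B) : Cl l (A - B) :=
  fun i a j b => sub_mem (hA i a j b) (hB i a j b)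
theorem Cl.neg {l : ℕ} {A : MM n} (hA : Cl l A) : Cl l (-A) :=
  fun i a j b => neg_mem (hA i a j b)
theorem Cl.mul {l l' : ℕ} {A B : MM n} (hA : Cl l A) (hB : Cl l' B) : Cl (l + l') (A * B) := by
  intro i a j b
  rw [Matrix.mul_apply]
  refine sum_mem ?_
  rintro ⟨k, c⟩ _
  refine Wm_mono ?_ le_rfl (Wm_mul (hA i a k c) (hB k c j b))
  omega

/-- Scalar matrices. -/
def Sc (M : Matrix (Fin (2*n) × Fin (2*n)) (Fin (2*n) × Fin (2*n)) F) : MM n :=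
  M.map (algebraMap F (Usp n))

theorem Cl_Sc {M : Matrix (Fin (2*n) × Fin (2*n)) (Fin (2*n) × Fin (2*n)) F}
    (h : ∀ i a j b, vv (M (i, a) (j, b)) ≤ 1)
    (h2 : ∀ i a j b : Fin (2*n), M (i, a) (j, b) ≠ 0 → (j:ℕ) + (b:ℕ) ≤ i + a) : Cl 0 (Sc M) := by
  intro i a j b
  rw [Sc, Matrix.map_apply, Algebra.algebraMap_eq_smul_one]
  by_cases e : M (i, a) (j, b) = 0
  · rw [e, zero_smul]; exact zero_mem _
  · have := h2 i a j b e
    exact F_smul_mem (h i a j b) (one_mem_Wm (by omega) _)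

theorem Cl.mono {l l' : ℕ} {A : MM n} (h : l ≤ l') (hA : Cl l A) : Cl l' A :=
  fun i a j b => Wm_mono le_rfl h (hA i a j b)

/-- The matrix Y. -/
def YU (n : ℕ) : Matrix (Fin (2*n)) (Fin (2*n)) (Usp n) := Matrix.of fun i j => yy n i j

theorem YU_apply (i j : Fin (2*n)) : YU n i j = yy n i j := rfl

theorem E1_apply (T : Matrix (Fin (2*n)) (Fin (2*n)) (Usp n)) (i a j b : Fin (2*n)) :
   E1 T (i,a) (j,b) = if a = b then T i j else 0 := (rfl)
theorem E2_apply (T : Matrix (Fin (2*n)) (Fin (2*n)) (Usp n)) (i a j b : Fin (2*n)) :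
   E2 T (i,a) (j,b) = if i = j then T a b else 0 := (rfl)

theorem Cl_E1Y : Cl 1 (E1 (YU n)) := by
  intro i a j b
  rw [E1_apply]
  split_ifs with h
  · subst h; exact Wm_mono (by omega) le_rfl (yy_mem i j)
  · exact zero_mem _
theorem Cl_E2Y : Cl 1 (E2 (YU n)) := by
  intro i a j b
  rw [E2_apply]
  split_ifs with h
  · subst h; exact Wm_mono (by omega) le_rfl (yy_mem a b)
  · exact zero_mem _

theorem JU_apply (i j : Fin (2*n)) : JU n i j = if i = j then algebraMap F (Usp n) (eps n i) else 0 := by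
  rw [JU, Matrix.diagonal_apply]

theorem Cl_E1J : Cl 0 (E1 (JU n)) := by
  intro i a j b
  rw [E1_apply, JU_apply]
  split_ifs with h h'
  · subst h; subst h'; rw [Algebra.algebraMap_eq_smul_one]
    exact F_smul_mem (veps _).le (one_mem_Wm (by omega) _)
  · exact zero_mem _
  · exact zero_mem _
theorem Cl_E2J : Cl 0 (E2 (JU n)) := by
  intro i a j b
  rw [E2_apply, JU_apply]
  split_ifs with h h'
  · subst h; subst h'; rw [Algebra.algebraMap_eq_smul_one]
    exact F_smul_mem (veps _).le (one_mem_Wm (by omega) _)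
  · exact zero_mem _
  · exact zero_mem _

theorem SU_YU : SU n = JU n + zt • YU n := by
  ext i j
  rw [Matrix.add_apply, Matrix.smul_apply, JU_apply, YU_apply]
  refine (sU_yy i j).trans ?_
  rw [Algebra.algebraMap_eq_smul_one]

theorem E1_SU : E1 (SU n) = E1 (JU n) + zt • E1 (YU n) := by
  rw [SU_YU]; ext ⟨i, a⟩ ⟨j, b⟩
  rw [Matrix.add_apply, Matrix.smul_apply, E1_apply, E1_apply, E1_apply]
  split_ifs
  · rfl
  · simp
theorem E2_SU : E2 (SU n) = E2 (JU n) + zt • E2 (YU n) := by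
  rw [SU_YU]; ext ⟨i, a⟩ ⟨j, b⟩
  rw [Matrix.add_apply, Matrix.smul_apply, E2_apply, E2_apply, E2_apply]
  split_ifs
  · rfl
  · simp

/-- r = (R-1)/ζ -/
def rr (n : ℕ) : Matrix (Fin (2*n) × Fin (2*n)) (Fin (2*n) × Fin (2*n)) F :=
  Matrix.of fun p s => zt⁻¹ * (Rg n q p s - if p.1 = s.1 ∧ p.2 = s.2 then 1 else 0)
/-- x = (X-1)/ζ -/
def xx (n : ℕ) : Matrix (Fin (2*n) × Fin (2*n)) (Fin (2*n) × Fin (2*n)) F :=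
  Matrix.of fun p s => rr n (s.1, p.2) (p.1, s.2)

theorem rr_apply (i a j b : Fin (2*n)) : rr n (i,a) (j,b) =
  zt⁻¹ * (Rg n q (i,a) (j,b) - if i = j ∧ a = b then 1 else 0) := (rfl)
theorem xx_apply (i a j b : Fin (2*n)) : xx n (i,a) (j,b) = rr n (j,a) (i,b) := (rfl)

theorem rr_ne {i a j b : Fin (2*n)} (h : rr n (i,a) (j,b) ≠ 0) : (i:ℕ) + a = j + b := by
  by_contra hn
  apply h
  rw [rr_apply, if_neg (by rintro ⟨rfl, rfl⟩; omega), sub_zero]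
  by_contra h2
  exact hn (Rg_wt q_ne i a j b (fun h => h2 (by rw [h, mul_zero])))

theorem Cl_r : Cl 0 (Sc (rr n)) := by
  refine Cl_Sc (fun i a j b => vRg1 i a j b) fun i a j b h => ?_
  rw [rr_ne h]

theorem xx_ne {i a j b : Fin (2*n)} (h : xx n (i,a) (j,b) ≠ 0) : (j:ℕ) + b ≤ i + a := by
  by_contra hn
  apply h
  rw [xx_apply, rr_apply, Rg_apply q_ne, if_neg, if_neg, if_neg, if_neg]
  · simp
  · rintro ⟨rfl, rfl⟩; omega
  · rintro ⟨h1, rfl, rfl⟩; simp only [pr_val] at hn; omega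
  · rintro ⟨h1, rfl, rfl⟩; omega
  · rintro ⟨rfl, rfl⟩; omega

theorem Cl_x : Cl 0 (Sc (xx n)) :=
  Cl_Sc (fun i a j b => vRg1 j a i b) fun i a j b h => xx_ne h

theorem RB_eq : RB n (Usp n) = 1 + zt • Sc (rr n) := by
  ext ⟨i, a⟩ ⟨j, b⟩
  have : RB n (Usp n) (i,a) (j,b) = algebraMap F _ (Rg n q (i,a) (j,b)) := by
    rw [← Rm_eq]; rfl
  rw [this, Matrix.add_apply, Matrix.smul_apply, Sc, Matrix.map_apply, rr_apply, Algebra.smul_def,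
    ← map_mul, ← mul_assoc, mul_inv_cancel₀ zt_ne, one_mul, Matrix.one_apply, map_sub]
  by_cases h : i = j ∧ a = b
  · rw [if_pos h, if_pos (by rw [h.1, h.2]), map_one]; abel
  · rw [if_neg h, if_neg (by rintro h'; simp at h'; exact h h'), map_zero]; abel

theorem XB_eq : XB n = 1 + zt • Sc (xx n) := by
  ext ⟨i, a⟩ ⟨j, b⟩
  rw [XB_apply, Matrix.add_apply, Matrix.smul_apply, Sc, Matrix.map_apply, xx_apply, rr_apply,
    Algebra.smul_def,
    ← map_mul, ← mul_assoc, mul_inv_cancel₀ zt_ne, one_mul, Matrix.one_apply, map_sub]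
  by_cases h : j = i ∧ a = b
  · rw [if_pos h, if_pos (by rw [h.1, h.2]), map_one]; abel
  · rw [if_neg h, if_neg (by rintro h'; simp at h'; exact h ⟨h'.1.symm, h'.2⟩), map_zero]; abel

theorem comm_alg {A : Type*} [Ring A] [Algebra F A] {R X r x J1 J2 Y1 Y2 : A} {z : F} (hz : z ≠ 0)
    (hR : R = 1 + z • r) (hX : X = 1 + z • x)
    (h1 : R * (J1 + z • Y1) * X * (J2 + z • Y2) = (J2 + z • Y2) * X * (J1 + z • Y1) * R)
    (h2 : R * J1 * X * J2 = J2 * X * J1 * R) (c1 : Y1 * J2 = J2 * Y1) (c2 : J1 * Y2 = Y2 * J1) :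
    Y1 * Y2 - Y2 * Y1 = -(r * Y1 * X * J2 + Y1 * x * J2 - J2 * x * Y1 * R - J2 * Y1 * r
      + r * J1 * X * Y2 + J1 * x * Y2 - Y2 * x * J1 * R - Y2 * J1 * r)
      + z • (-(r * Y1 * X * Y2 + Y1 * x * Y2 - Y2 * x * Y1 * R - Y2 * Y1 * r)) := by
  have h3 : R * Y1 * X * J2 + R * J1 * X * Y2 + z • (R * Y1 * X * Y2)
      = Y2 * X * J1 * R + J2 * X * Y1 * R + z • (Y2 * X * Y1 * R) := by
    apply smul_right_injective A hz
    simp only [mul_add, add_mul, smul_mul_assoc, mul_smul_comm] at h1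
    simp only [smul_add]
    rw [h2] at h1
    simp only [smul_add] at h1
    rw [← sub_eq_zero] at h1 ⊢
    rw [← h1]
    abel
  have e1 : ∀ a b, R * a * X * b = a * b + z • (r * a * X * b + a * x * b) := by
    intro a b; rw [hR]
    simp only [add_mul, one_mul, smul_mul_assoc, smul_add, add_assoc]
    rw [hX]
    simp only [add_mul, mul_add, mul_one, one_mul, smul_mul_assoc, mul_smul_comm, smul_add, mul_assoc]
    abel
  have e2 : ∀ a b, a * X * b * R = a * b + z • (a * x * b * R + a * b * r) := by
    intro a b; rw [hX]
    simp only [mul_add, mul_one, add_mul, smul_mul_assoc, mul_smul_comm, smul_add, add_assoc]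
    rw [hR]
    simp only [add_mul, mul_add, mul_one, one_mul, smul_mul_assoc, mul_smul_comm, smul_add, mul_assoc]
    abel
  rw [e1, e1, e1, e2, e2, e2, c1, c2] at h3
  apply smul_right_injective A hz
  dsimp only
  simp only [smul_add, smul_sub, smul_neg] at h3 ⊢
  rw [← sub_eq_zero] at h3 ⊢
  rw [← h3]
  abel

theorem Cl.l {l : ℕ} {A B : MM n} (hA : Cl 0 A) (hB : Cl l B) : Cl l (A * B) := by
  have := hA.mul hB; rwa [zero_add] at this
theorem Cl.r {l : ℕ} {A B : MM n} (hA : Cl l A) (hB : Cl 0 B) : Cl l (A * B) := by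
  have := hA.mul hB; rwa [add_zero] at this
theorem Cl.m {A B : MM n} (hA : Cl 1 A) (hB : Cl 1 B) : Cl 2 (A * B) := by
  have := hA.mul hB; rwa [one_add_one_eq_two] at this

theorem Cl_big {R X r x J1 J2 Y1 Y2 : MM n} (hR : Cl 0 R) (hX : Cl 0 X) (hr : Cl 0 r) (hx : Cl 0 x)
    (hJ1 : Cl 0 J1) (hJ2 : Cl 0 J2) (h1 : Cl 1 Y1) (h2 : Cl 1 Y2) :
    Cl 1 (-(r * Y1 * X * J2 + Y1 * x * J2 - J2 * x * Y1 * R - J2 * Y1 * r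
      + r * J1 * X * Y2 + J1 * x * Y2 - Y2 * x * J1 * R - Y2 * J1 * r)) ∧
    Cl 2 (-(r * Y1 * X * Y2 + Y1 * x * Y2 - Y2 * x * Y1 * R - Y2 * Y1 * r)) := by
  constructor
  · refine Cl.neg (Cl.sub (Cl.sub (Cl.add (Cl.add (Cl.sub (Cl.sub (Cl.add ?_ ?_) ?_) ?_) ?_) ?_) ?_) ?_)
    · exact ((hr.l h1).r hX).r hJ2
    · exact (h1.r hx).r hJ2
    · exact ((hJ2.l hx).l h1).r hR
    · exact (hJ2.l h1).r hr
    · exact ((hr.l hJ1).l hX).l h2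
    · exact (hJ1.l hx).l h2
    · exact ((h2.r hx).r hJ1).r hR
    · exact (h2.r hJ1).r hr
  · refine Cl.neg (Cl.sub (Cl.sub (Cl.add ?_ ?_) ?_) ?_)
    · exact ((hr.l h1).r hX).m h2
    · exact (h1.r hx).m h2
    · exact ((h2.r hx).m h1).r hR
    · exact (h2.m h1).r hr

theorem yy_comm (i a j b : Fin (2*n)) : ∃ m1 ∈ Wm n ((((i:ℕ):ℤ) + ((a:ℕ):ℤ)) - (((j:ℕ):ℤ) + ((b:ℕ):ℤ))) 1,
    ∃ m2 ∈ Wm n ((((i:ℕ):ℤ) + ((a:ℕ):ℤ)) - (((j:ℕ):ℤ) + ((b:ℕ):ℤ))) 2,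
    yy n i j * yy n a b - yy n a b * yy n i j = m1 + zt • m2 := by
  have h1 := REq (n := n)
  rw [E1_SU, E2_SU] at h1
  have c1 : E1 (YU n) * E2 (JU n) = E2 (JU n) * E1 (YU n) := E1E2_comm _ _ (by
    intro i j a b; rw [JU_apply]; split_ifs
    · rw [Algebra.commutes]
    · simp)
  have c2 : E1 (JU n) * E2 (YU n) = E2 (YU n) * E1 (JU n) := E1E2_comm _ _ (by
    intro i j a b; rw [JU_apply]; split_ifs
    · rw [Algebra.commutes]
    · simp)
  have h := comm_alg zt_ne RB_eq XB_eq h1 JRelB c1 c2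
  have hh := congrFun (congrFun h (i, a)) (j, b)
  rw [Matrix.sub_apply, E1E2_apply, E2E1_apply, Matrix.add_apply, Matrix.smul_apply, YU_apply, YU_apply] at hh
  have ho : Cl 0 (1 : MM n) := by
    intro i a j b
    rw [Matrix.one_apply]; split_ifs with h
    · simp at h; obtain ⟨rfl, rfl⟩ := h; exact one_mem_Wm (by omega) _
    · exact zero_mem _
  have hz : ∀ (l : ℕ) {A : MM n}, Cl l A → Cl l (zt • A) := fun l A hA i a j b =>
    F_smul_mem vzt.le (hA i a j b)
  have hR : Cl 0 (RB n (Usp n)) := by rw [RB_eq]; exact ho.add (hz 0 Cl_r)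
  have hX : Cl 0 (XB n) := by rw [XB_eq]; exact ho.add (hz 0 Cl_x)
  have hm := Cl_big hR hX Cl_r Cl_x Cl_E1J Cl_E2J Cl_E1Y Cl_E2Y (n := n)
  exact ⟨_, hm.1 i a j b, _, hm.2 i a j b, hh⟩

end Filt

section SymRel
variable {n : ℕ}

/-- z_{ia} = Σ ε_k t̄_{ik} t_{ak} -/
def zz (n : ℕ) (i a : Fin (2*n)) : Usp n := ∑ k, eps n k • (tbU n i k * tU n a k)

theorem Rg_kk {Q : F} (hQ : Q ≠ 0) (l c k : Fin (2*n)) :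
    Rg n Q (l, c) (k, k) = if l = k ∧ c = k then Q else 0 := by
  rw [Rg_apply hQ]
  rw [if_neg (c := l < c ∧ k = c ∧ k = l) (by rintro ⟨h, rfl, rfl⟩; exact lt_irrefl _ h),
    if_neg (c := l < k ∧ c = pr n l ∧ k = pr n k) (by rintro ⟨h, _, h2⟩; exact pr_ne k h2.symm)]
  by_cases h : l = k ∧ c = k
  · rw [if_pos h, if_pos h]; obtain ⟨rfl, rfl⟩ := h
    rw [if_pos rfl, if_neg (fun h => pr_ne _ h.symm)]; simp
  · rw [if_neg h, if_neg h]; simp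

theorem zz_rel (i a : Fin (2*n)) :
    ∑ k, ∑ c, Rg n q (i, a) (k, c) • zz n k c = q • sU n a i := by
  have h := (RTT_iff _ _).1 (U_isRTT n).bt
  have h2 : ∀ m, ∑ k, ∑ c, Rg n q (i, a) (k, c) • (tbU n k m * tU n c m)
      = q • (tU n a m * tbU n i m) := by
    intro m
    refine Eq.trans ?_ ((h i a m m).trans ?_)
    · simp only [Rm_eq]; rfl
    · simp only [Rm_eq, Rg_kk q_ne]
      rw [Finset.sum_eq_single m, Finset.sum_eq_single m]
      · rw [if_pos ⟨rfl, rfl⟩]; rfl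
      · intro b _ hb; rw [if_neg (fun h => hb h.1), zero_smul]
      · simp
      · intro b _ hb; exact Finset.sum_eq_zero fun l _ => by rw [if_neg (fun h => hb h.2), zero_smul]
      · simp
  rw [sU_eq, Finset.smul_sum]
  simp only [zz, Finset.smul_sum]
  have e : ∀ k, ∑ c, ∑ m, Rg n q (i, a) (k, c) • eps n m • (tbU n k m * tU n c m)
     = ∑ m, ∑ c, Rg n q (i, a) (k, c) • eps n m • (tbU n k m * tU n c m) := fun k => Finset.sum_comm
  simp only [e]
  rw [Finset.sum_comm]
  refine Finset.sum_congr rfl fun m _ => ?_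
  rw [smul_comm, ← h2 m]
  simp only [Finset.smul_sum]
  refine Finset.sum_congr rfl fun k _ => Finset.sum_congr rfl fun c _ => smul_comm _ _ _

theorem zz_eq (i a : Fin (2*n)) :
    zz n i a = q • ∑ k, ∑ c, Rg n q⁻¹ (i, a) (k, c) • sU n c k := by
  have h : ∀ k c, q • sU n c k = ∑ s : Fin (2*n) × Fin (2*n), Rg n q (k, c) s • zz n s.1 s.2 := by
    intro k c; rw [← zz_rel, Fintype.sum_prod_type]
  rw [Finset.smul_sum]
  simp only [Finset.smul_sum]
  have e : ∀ k c, q • Rg n q⁻¹ (i, a) (k, c) • sU n c k =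
     ∑ s : Fin (2*n) × Fin (2*n), (Rg n q⁻¹ (i, a) (k, c) * Rg n q (k, c) s) • zz n s.1 s.2 := by
    intro k c; rw [smul_comm, h, Finset.smul_sum]; simp only [smul_smul]
  simp only [e]
  rw [← Fintype.sum_prod_type' (f := fun k c => ∑ s : Fin (2*n) × Fin (2*n),
    (Rg n q⁻¹ (i, a) (k, c) * Rg n q (k, c) s) • zz n s.1 s.2), Finset.sum_comm]
  simp only [← Finset.sum_smul]
  have u := unitarity (n := n) q_ne
  have : ∀ s, ∑ x : Fin (2*n) × Fin (2*n), Rg n q⁻¹ (i, a) (x.1, x.2) * Rg n q (x.1, x.2) s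
     = if (i, a) = s then 1 else 0 := by
    intro s
    have := congrFun (congrFun u (i, a)) s
    rwa [Matrix.mul_apply, Matrix.one_apply] at this
  simp only [this, ite_smul, one_smul, zero_smul, Finset.sum_ite_eq, Finset.mem_univ, if_true]

/-- Z -/
def ZZ (n : ℕ) (i a : Fin (2*n)) : Usp n := q • ∑ k, ∑ c, Rg n q⁻¹ (i, a) (k, c) • yy n c k

theorem zz_ZZ (i a : Fin (2*n)) : zz n i a = (if i = a then eps n i • 1 else 0) + zt • ZZ n i a := by
  rw [zz_eq, ZZ]
  simp only [sU_yy, smul_add, Finset.sum_add_distrib]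
  congr 1
  · have : ∀ k, ∑ c, Rg n q⁻¹ (i, a) (k, c) • (if c = k then eps n c • (1 : Usp n) else 0)
       = if i = k ∧ a = k then q⁻¹ • eps n k • (1 : Usp n) else 0 := by
      intro k
      rw [Finset.sum_eq_single k]
      · rw [if_pos rfl, Rg_kk qi_ne]; split_ifs <;> simp
      · intro b _ hb; rw [if_neg hb, smul_zero]
      · simp
    simp only [this]
    rw [Finset.sum_eq_single i]
    · by_cases h : i = a
      · rw [if_pos h, if_pos ⟨rfl, h.symm⟩, smul_smul, mul_inv_cancel₀ q_ne, one_smul]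
      · rw [if_neg h, if_neg (fun h2 => h h2.2.symm), smul_zero]
    · intro b _ hb; rw [if_neg (fun h => hb h.1.symm)]
    · simp
  · rw [smul_comm zt q]; congr 1
    rw [Finset.smul_sum]
    refine Finset.sum_congr rfl fun k _ => ?_
    rw [Finset.smul_sum]
    exact Finset.sum_congr rfl fun c _ => smul_comm _ _ _

theorem Rgi_yy_mem (i a k c : Fin (2*n)) {x : F} (hx : vv x ≤ 1)
    (h : ¬ (i = k ∧ a = c) → Rg n q⁻¹ (i, a) (k, c) = 0 → x = 0) :
    x • yy n c k ∈ Wm n (((a:ℕ):ℤ) - ((i:ℕ):ℤ)) 1 := by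
  by_cases h0 : x = 0
  · rw [h0, zero_smul]; exact zero_mem _
  by_cases hk : k < c
  swap
  · rw [yy_zero hk, smul_zero]; exact zero_mem _
  refine Wm_mono ?_ le_rfl (F_smul_mem hx (yy_mem c k))
  by_contra hn
  refine h0 (h ?_ ?_)
  · rintro ⟨rfl, rfl⟩; omega
  · rw [Rg_apply qi_ne, if_neg, if_neg, if_neg]
    · simp
    · rintro ⟨h1, rfl, rfl⟩; simp only [pr_val] at hn; omega
    · rintro ⟨h1, rfl, rfl⟩; omega
    · rintro ⟨rfl, rfl⟩; omega

theorem ZZ_diff (i a : Fin (2*n)) : ∃ m ∈ Wm n (((a:ℕ):ℤ) - ((i:ℕ):ℤ)) 1,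
    ZZ n i a = yy n a i + zt • m := by
  refine ⟨(zt⁻¹ * (q - 1)) • yy n a i + q • ∑ k, ∑ c,
    (zt⁻¹ * (Rg n q⁻¹ (i, a) (k, c) - if i = k ∧ a = c then 1 else 0)) • yy n c k, ?_, ?_⟩
  · refine add_mem (F_smul_mem ?_ (yy_mem a i)) (F_smul_mem vq.le (sum_mem fun k _ => sum_mem fun c _ => ?_))
    · simpa using vqm1 1
    · refine Rgi_yy_mem i a k c (vRgi1 i a k c) fun h1 h2 => ?_
      rw [h2, if_neg h1, sub_zero, mul_zero]
  · rw [smul_add, smul_smul, ← mul_assoc, mul_inv_cancel₀ zt_ne, one_mul, smul_comm]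
    simp only [Finset.smul_sum, smul_smul, ← mul_assoc, mul_inv_cancel₀ zt_ne, one_mul]
    simp only [← smul_smul, sub_smul, ← Finset.smul_sum, Finset.sum_sub_distrib, one_smul, mul_sub]
    have : ∑ k, ∑ c, (if i = k ∧ a = c then (1:F) else 0) • yy n c k = yy n a i := by
      rw [Finset.sum_eq_single i, Finset.sum_eq_single a]
      · rw [if_pos ⟨rfl, rfl⟩, one_smul]
      · intro b _ hb; rw [if_neg (fun h => hb h.2.symm), zero_smul]
      · simp
      · intro b _ hb; exact Finset.sum_eq_zero fun l _ => by rw [if_neg (fun h => hb h.1.symm), zero_smul]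
      · simp
    rw [this, ZZ]; abel

theorem ZZ_mem (i a : Fin (2*n)) : ZZ n i a ∈ Wm n (((a:ℕ):ℤ) - ((i:ℕ):ℤ)) 1 := by
  obtain ⟨m, hm, h⟩ := ZZ_diff i a
  rw [h]; exact add_mem (yy_mem a i) (F_smul_mem vzt.le hm)

theorem dd_pr (i : Fin (2*n)) : dd n (pr n i) = (dd n i)⁻¹ := by
  rw [dd, dd, bar_pr, zpow_neg]

theorem c2_rel (m l : Fin (2*n)) : ∑ k, ((dd n k)⁻¹ * eps n k) • (tU n (pr n k) m * tU n k l)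
    = if l = pr n m then -(dd n m * eps n m) • (1 : Usp n) else 0 := by
  have h : ∑ k, (dd n (pr n m) * (dd n k)⁻¹ * eps n (pr n (pr n m)) * eps n (pr n k)) •
              (tU n (pr n k) (pr n (pr n m)) * tU n k l) = if pr n m = l then 1 else 0 := by
    have := RingQuot.mkAlgHom_rel F (rel.cent_t2 (n := n) (pr n m) l)
    rw [map_sum] at this
    simp only [map_smul, map_mul] at this
    refine this.trans ?_
    split_ifs <;> simp
  rw [pr_pr] at h
  have h2 : ∑ k, (dd n (pr n m) * (dd n k)⁻¹ * eps n m * eps n (pr n k)) •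
              (tU n (pr n k) m * tU n k l) = (-(dd n m)⁻¹ * eps n m) •
              ∑ k, ((dd n k)⁻¹ * eps n k) • (tU n (pr n k) m * tU n k l) := by
    rw [Finset.smul_sum]
    refine Finset.sum_congr rfl fun k _ => ?_
    rw [smul_smul, eps_pr, dd_pr]; congr 1; ring
  rw [h2] at h
  have h3 := congrArg (fun x => (-(dd n m * eps n m)) • x) h
  simp only [smul_smul] at h3
  have e : -(dd n m * eps n m) * (-(dd n m)⁻¹ * eps n m) = 1 := by
    have := eps_mul_self m; have h2 := dd_ne m
    field_simp; rw [pow_two, this]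
  rw [e, one_smul] at h3
  rw [h3]
  by_cases hl : l = pr n m
  · rw [if_pos hl, if_pos hl.symm]
  · rw [if_neg hl, if_neg (fun h => hl h.symm), smul_zero]

theorem cb1_rel (i j : Fin (2*n)) : ∑ m, (dd n m * eps n (pr n m)) • (tbU n (pr n i) m * tbU n j (pr n m))
    = if i = j then (dd n (pr n j) * eps n j) • (1 : Usp n) else 0 := by
  have h : ∑ k, (dd n k * (dd n (pr n j))⁻¹ * eps n (pr n k) * eps n (pr n (pr n j))) •
              (tbU n (pr n i) k * tbU n (pr n (pr n j)) (pr n k)) = if pr n i = pr n j then 1 else 0 := by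
    have := RingQuot.mkAlgHom_rel F (rel.cent_tb1 (n := n) (pr n i) (pr n j))
    rw [map_sum] at this
    simp only [map_smul, map_mul] at this
    refine this.trans ?_
    split_ifs <;> simp
  rw [pr_pr] at h
  have h2 : ∑ k, (dd n k * (dd n (pr n j))⁻¹ * eps n (pr n k) * eps n j) •
              (tbU n (pr n i) k * tbU n j (pr n k)) = ((dd n (pr n j))⁻¹ * eps n j) •
      ∑ m, (dd n m * eps n (pr n m)) • (tbU n (pr n i) m * tbU n j (pr n m)) := by
    rw [Finset.smul_sum]
    refine Finset.sum_congr rfl fun k _ => ?_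
    rw [smul_smul]; congr 1; ring
  rw [h2] at h
  have h3 := congrArg (fun x => (dd n (pr n j) * eps n j) • x) h
  simp only [smul_smul] at h3
  have e : (dd n (pr n j) * eps n j) * ((dd n (pr n j))⁻¹ * eps n j) = 1 := by
    have := eps_mul_self j; have h2 := dd_ne (pr n j)
    field_simp; rw [pow_two, this]
  rw [e, one_smul] at h3
  rw [h3]
  by_cases hl : i = j
  · rw [if_pos hl, if_pos (by rw [hl])]
  · rw [if_neg hl, if_neg (fun h => hl (pr_inj.1 h)), smul_zero]

theorem nsm (c : F) (x : Usp n) : (-c) • x = -(c • x) := neg_smul c x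

theorem zs_rel (i j : Fin (2*n)) :
    ∑ k, ((dd n k)⁻¹ * eps n k) • (zz n (pr n i) (pr n k) * sU n k j)
     = if i = j then -((dd n i)⁻¹ * eps n i) • (1 : Usp n) else 0 := by
  have e : ∀ k, ((dd n k)⁻¹ * eps n k) • (zz n (pr n i) (pr n k) * sU n k j)
     = ∑ m, ∑ l, (eps n m * eps n l) • (tbU n (pr n i) m *
       (((dd n k)⁻¹ * eps n k) • (tU n (pr n k) m * tU n k l)) * tbU n j l) := by
    intro k
    rw [zz, sU_eq, Finset.sum_mul_sum, Finset.smul_sum]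
    refine Finset.sum_congr rfl fun m _ => ?_
    rw [Finset.smul_sum]
    refine Finset.sum_congr rfl fun l _ => ?_
    simp only [smul_mul_assoc, mul_smul_comm, smul_smul, mul_assoc]
    congr 1; ring
  simp only [e]
  rw [Finset.sum_comm]
  have e2 : ∀ m, ∑ k, ∑ l, (eps n m * eps n l) • (tbU n (pr n i) m *
       (((dd n k)⁻¹ * eps n k) • (tU n (pr n k) m * tU n k l)) * tbU n j l)
       = - (dd n m * eps n (pr n m)) • (tbU n (pr n i) m * tbU n j (pr n m)) := by
    intro m
    rw [Finset.sum_comm]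
    have : ∀ l, ∑ k, (eps n m * eps n l) • (tbU n (pr n i) m *
       (((dd n k)⁻¹ * eps n k) • (tU n (pr n k) m * tU n k l)) * tbU n j l)
       = (eps n m * eps n l) • (tbU n (pr n i) m * (if l = pr n m then -(dd n m * eps n m) • (1 : Usp n) else 0) * tbU n j l) := by
      intro l
      rw [← c2_rel, Finset.mul_sum, Finset.sum_mul, Finset.smul_sum]
    simp only [this]
    rw [Finset.sum_eq_single (pr n m)]
    · rw [if_pos rfl, mul_smul_comm, smul_mul_assoc, mul_one, smul_smul]
      congr 1
      have := eps_mul_self m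
      linear_combination (- eps n (pr n m) * dd n m) * this
    · intro b _ hb; rw [if_neg hb]; simp
    · simp
  rw [Finset.sum_congr rfl fun m _ => (e2 m).trans (nsm _ _)]
  rw [Finset.sum_neg_distrib, cb1_rel]
  split_ifs with h
  · rw [dd_pr, h, nsm]
  · simp

theorem yy_sym (i j : Fin (2*n)) : ∃ m ∈ Wm n (((i:ℕ):ℤ) - ((j:ℕ):ℤ)) 2,
    yy n i j - yy n (pr n j) (pr n i) = zt • m := by
  have h := zs_rel i j
  have e : ∑ k, ((dd n k)⁻¹ * eps n k) • (zz n (pr n i) (pr n k) * sU n k j)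
     = (if i = j then -((dd n i)⁻¹ * eps n i) • (1 : Usp n) else 0)
       + zt • (-(dd n i)⁻¹ • yy n i j + (dd n j)⁻¹ • ZZ n (pr n i) (pr n j)
         + zt • ∑ k, ((dd n k)⁻¹ * eps n k) • (ZZ n (pr n i) (pr n k) * yy n k j)) := by
    have e1 : ∀ k, ((dd n k)⁻¹ * eps n k) • (zz n (pr n i) (pr n k) * sU n k j)
      = (if i = k then (if i = j then -((dd n i)⁻¹ * eps n i) • (1 : Usp n) else 0) +
          zt • -(dd n i)⁻¹ • yy n i j else 0)
        + (if k = j then zt • (dd n j)⁻¹ • ZZ n (pr n i) (pr n j) else 0)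
        + zt • zt • ((dd n k)⁻¹ * eps n k) • (ZZ n (pr n i) (pr n k) * yy n k j) := by
      intro k
      rw [zz_ZZ, sU_yy]
      have hp : (pr n i = pr n k) ↔ i = k := ⟨fun h => pr_inj.1 h, fun h => by rw [h]⟩
      have he := eps_mul_self k
      simp only [hp]
      by_cases h1 : i = k
      · subst h1
        by_cases h2 : i = j
        · subst h2
          simp only [if_true, mul_add, add_mul, smul_mul_assoc, mul_smul_comm, one_mul, mul_one, smul_add, smul_smul, eps_pr]
          have a1 : (dd n i)⁻¹ * eps n i * (eps n i * -eps n i) = -((dd n i)⁻¹ * eps n i) := by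
            linear_combination (- (dd n i)⁻¹ * eps n i) * he
          have a2 : (dd n i)⁻¹ * eps n i * (zt * -eps n i) = zt * -(dd n i)⁻¹ := by
            linear_combination (- (dd n i)⁻¹ * zt) * he
          have a3 : (dd n i)⁻¹ * eps n i * (eps n i * zt) = zt * (dd n i)⁻¹ := by
            linear_combination ((dd n i)⁻¹ * zt) * he
          have a4 : (dd n i)⁻¹ * eps n i * (zt * zt) = zt * (zt * ((dd n i)⁻¹ * eps n i)) := by ring
          rw [a1, a2, a3, a4]
          abel
        · simp only [if_true, if_neg h2, zero_add, add_zero, mul_add, add_mul, smul_mul_assoc, mul_smul_comm, one_mul, mul_one, smul_add, smul_smul, eps_pr]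
          have a2 : (dd n i)⁻¹ * eps n i * (zt * -eps n i) = zt * -(dd n i)⁻¹ := by
            linear_combination (- (dd n i)⁻¹ * zt) * he
          have a4 : (dd n i)⁻¹ * eps n i * (zt * zt) = zt * (zt * ((dd n i)⁻¹ * eps n i)) := by ring
          rw [a2, a4]
      · by_cases h2 : k = j
        · subst h2
          simp only [if_true, if_neg h1, zero_add, add_zero, mul_add, add_mul, smul_mul_assoc, mul_smul_comm, one_mul, mul_one, smul_add, smul_smul, eps_pr]
          have a3 : (dd n k)⁻¹ * eps n k * (eps n k * zt) = zt * (dd n k)⁻¹ := by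
            linear_combination ((dd n k)⁻¹ * zt) * he
          have a4 : (dd n k)⁻¹ * eps n k * (zt * zt) = zt * (zt * ((dd n k)⁻¹ * eps n k)) := by ring
          rw [a3, a4]
        · simp only [if_true, if_neg h1, if_neg h2, zero_add, add_zero, mul_add, add_mul, smul_mul_assoc, mul_smul_comm, one_mul, mul_one, smul_add, smul_smul, eps_pr]
          have a4 : (dd n k)⁻¹ * eps n k * (zt * zt) = zt * (zt * ((dd n k)⁻¹ * eps n k)) := by ring
          rw [a4]
    simp only [e1]
    rw [Finset.sum_add_distrib, Finset.sum_add_distrib, Finset.sum_ite_eq, Finset.sum_ite_eq',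
      if_pos (Finset.mem_univ _), if_pos (Finset.mem_univ _)]
    simp only [← Finset.smul_sum, smul_add]
    abel
  rw [e] at h
  have h2 := smul_right_injective (Usp n) zt_ne
    ((add_eq_left.1 h).trans (smul_zero zt).symm)
  obtain ⟨m, hm, hZ⟩ := ZZ_diff (pr n i) (pr n j)
  have hd := dd_ne i
  have hdj := dd_ne j
  have h3 : yy n i j = (dd n i * (dd n j)⁻¹) • ZZ n (pr n i) (pr n j)
     + zt • dd n i • ∑ k, ((dd n k)⁻¹ * eps n k) • (ZZ n (pr n i) (pr n k) * yy n k j) := by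
    have h4 := congrArg (fun x => dd n i • x) h2
    simp only [smul_add, smul_zero, smul_smul] at h4
    rw [mul_neg, mul_inv_cancel₀ hd, neg_smul, one_smul] at h4
    rw [smul_smul, mul_comm zt]
    rw [← sub_eq_zero, ← neg_eq_zero, ← h4]
    abel
  refine ⟨(zt⁻¹ * (dd n i * (dd n j)⁻¹ - 1)) • ZZ n (pr n i) (pr n j) + m + dd n i • ∑ k, ((dd n k)⁻¹ * eps n k) • (ZZ n (pr n i) (pr n k) * yy n k j), ?_, ?_⟩
  · have p1 := pr_val i; have p2 := pr_val j
    have l1 := i.2; have l2 := j.2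
    refine add_mem (add_mem (F_smul_mem (vdd1 i j) ?_) ?_) (F_smul_mem (vdd _).le (sum_mem fun k _ => F_smul_mem ?_ ?_))
    · exact Wm_mono (by omega) (by omega) (ZZ_mem _ _)
    · exact Wm_mono (by omega) (by omega) hm
    · rw [map_mul, map_inv₀, vdd, veps]; simp
    · have p3 := pr_val k; have l3 := k.2
      exact Wm_mono (by omega) (by omega) (Wm_mul (ZZ_mem _ _) (yy_mem _ _))
  · rw [smul_add, smul_add, smul_smul, ← mul_assoc, mul_inv_cancel₀ zt_ne, one_mul, sub_smul, one_smul]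
    rw [h3]
    have : yy n (pr n j) (pr n i) = ZZ n (pr n i) (pr n j) - zt • m := by rw [hZ]; abel
    rw [this]; abel

end SymRel

section Span
variable {n : ℕ}

/-- PBW exponents. -/
abbrev Ix (n : ℕ) := {k : Fin (2*n) × Fin (2*n) → ℕ //
          ∀ p, ¬(p.2 < p.1 ∧ p.1 ≤ pr n p.2) → k p = 0}

/-- Index pairs. -/
def ip (p : Fin (2*n) × Fin (2*n)) : Prop := p.2 < p.1 ∧ p.1 ≤ pr n p.2

/-- The ordered word. -/
def om (k : Fin (2*n) × Fin (2*n) → ℕ) : Wd n :=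
  (List.finRange (2*n)).flatMap fun i => (List.finRange (2*n)).flatMap fun j =>
    if j < i ∧ i ≤ pr n j then List.replicate (k (i, j)) (i, j) else []

theorem om_ip {k : Fin (2*n) × Fin (2*n) → ℕ} {p} (h : p ∈ om k) : ip p := by
  simp only [om, List.mem_flatMap, List.mem_finRange, true_and] at h
  obtain ⟨i, j, h⟩ := h
  split_ifs at h with h1
  · rw [List.eq_of_mem_replicate h]; exact h1
  · simp at h

theorem count_flatMap_single {α β : Type*} [BEq α] [LawfulBEq α] [DecidableEq β] (l : List β) (hl : l.Nodup) (f : β → List α) (x : α) (b : β)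
    (hb : b ∈ l) (h : ∀ c, c ≠ b → (f c).count x = 0) : (l.flatMap f).count x = (f b).count x := by
  induction l with
  | nil => simp at hb
  | cons c l ih =>
    rw [List.flatMap_cons, List.count_append]
    rw [List.nodup_cons] at hl
    by_cases e : c = b
    · subst e
      have : (l.flatMap f).count x = 0 := by
        rw [List.count_eq_zero, List.mem_flatMap]
        rintro ⟨d, hd, hx⟩
        have : d ≠ c := fun e => hl.1 (e ▸ hd)
        exact (List.count_eq_zero.1 (h d this)) hx
      rw [this, add_zero]
    · rw [h c e, zero_add]
      refine ih hl.2 ?_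
      rcases List.mem_cons.1 hb with h | h
      · exact absurd h.symm e
      · exact h

theorem om_count (k : Ix n) (p : Fin (2*n) × Fin (2*n)) : (om k.1).count p = k.1 p := by
  by_cases hp : ip p
  swap
  · rw [k.2 p hp, List.count_eq_zero]; exact fun h => hp (om_ip h)
  obtain ⟨i, j⟩ := p
  rw [om, count_flatMap_single _ (List.nodup_finRange _) _ _ i (List.mem_finRange _),
    count_flatMap_single _ (List.nodup_finRange _) _ _ j (List.mem_finRange _)]
  · rw [if_pos (c := j < i ∧ i ≤ pr n j) hp]; simp
  · intro c hc
    split_ifs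
    · rw [List.count_eq_zero]; intro h; have := List.eq_of_mem_replicate h; simp at this
      exact hc this.symm
    · simp
  · intro c hc
    rw [List.count_eq_zero, List.mem_flatMap]
    rintro ⟨d, -, h⟩
    split_ifs at h
    · have := List.eq_of_mem_replicate h; simp at this
      exact hc this.1.symm
    · simp at h

theorem good_of_ip {w : Wd n} (h : ∀ p ∈ w, ip p) : good w := fun p hp => (h p hp).1

theorem om_good (k : Fin (2*n) × Fin (2*n) → ℕ) : good (om k) := good_of_ip fun _ h => om_ip h

theorem perm_om {w : Wd n} (h : ∀ p ∈ w, ip p) : ∃ k : Ix n, w.Perm (om k.1) := by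
  refine ⟨⟨fun p => w.count p, fun p hp => List.count_eq_zero.2 fun hm => hp (h p hm)⟩, ?_⟩
  rw [List.perm_iff_count]
  intro p; rw [om_count]

theorem wy_s {w : Wd n} (h : good w) : (w.map fun p => sU n p.1 p.2).prod = zt ^ w.length • wy w := by
  induction w with
  | nil => simp [wy_nil]
  | cons p w ih =>
    rw [List.map_cons, List.prod_cons, ih fun p hp => h p (List.mem_cons_of_mem _ hp), wy_cons,
      sU_yy' (h p List.mem_cons_self), List.length_cons, smul_mul_smul_comm, pow_succ']

theorem monomial_eq (k : Fin (2*n) × Fin (2*n) → ℕ) :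
    monomial n k = zt ^ (om k).length • wy (om k) := by
  rw [← wy_s (om_good k), om, monomial, List.map_flatMap, List.flatMap_def, List.prod_flatten, List.map_map]
  congr 1
  refine List.map_congr_left fun i _ => ?_
  rw [Function.comp_apply, List.map_flatMap, List.flatMap_def, List.prod_flatten, List.map_map]
  congr 1
  refine List.map_congr_left fun j _ => ?_
  rw [Function.comp_apply]
  split_ifs
  · rw [List.map_replicate, List.prod_replicate]
  · simp

/-- Span of ordered words. -/
def No (n : ℕ) (d : ℤ) : Submodule Oo (Usp n) :=
  Submodule.span Oo {x | ∃ k : Ix n, wt (om k.1) ≤ d ∧ wy (om k.1) = x}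

theorem No_mem (k : Ix n) {d : ℤ} (h : wt (om k.1) ≤ d) : wy (om k.1) ∈ No n d :=
  Submodule.subset_span ⟨k, h, rfl⟩

/-- ζ as an element of the local ring. -/
def zO : Oo := ⟨zt, vzt.le⟩

/-- The maximal ideal. -/
def mO : Ideal Oo := Ideal.span {zO}

theorem zsm_mem {d : ℤ} {x : Usp n} (h : x ∈ Md n d) : zt • x ∈ mO • Md n d :=
  Submodule.smul_mem_smul (r := zO) (Ideal.mem_span_singleton_self _) h

theorem jac : mO ≤ (⊥ : Ideal Oo).jacobson := by
  rw [mO, Ideal.span_le, Set.singleton_subset_iff, SetLike.mem_coe, Ideal.mem_jacobson_bot]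
  intro y
  have h1 : vv (zt * (y : F)) < 1 := by
    rw [map_mul]
    exact mul_lt_one_of_lt_of_le vzt y.2
  have h2 : vv (zt * (y : F) + 1) = 1 := by
    rw [add_comm]; exact Valuation.map_one_add_of_lt _ h1
  have h3 : zt * (y : F) + 1 ≠ 0 := fun h => by rw [h, map_zero] at h2; exact zero_ne_one h2
  refine IsUnit.of_mul_eq_one ⟨(zt * (y : F) + 1)⁻¹, ?_⟩ ?_
  · rw [mem_Oo, map_inv₀, h2, inv_one]
  · apply Subtype.ext; exact mul_inv_cancel₀ h3

theorem Md_fg (d : ℤ) : (Md n d).FG := by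
  have hf : {w : Wd n | good w ∧ wt w ≤ d}.Finite := by
    refine (List.finite_length_le (Fin (2*n) × Fin (2*n)) d.toNat).subset ?_
    rintro w ⟨h1, h2⟩
    have := len_le_wt w h1
    show w.length ≤ d.toNat
    omega
  have : Md n d = Submodule.span Oo (wy '' {w : Wd n | good w ∧ wt w ≤ d}) := by
    unfold Md; congr 1; ext x
    constructor
    · rintro ⟨w, a, b, c⟩; exact ⟨w, ⟨a, b⟩, c⟩
    · rintro ⟨w, ⟨a, b⟩, c⟩; exact ⟨w, a, b, c⟩
  rw [this]
  exact Submodule.fg_span (hf.image _)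

theorem Md_mono {d d' : ℤ} (h : d ≤ d') : Md n d ≤ Md n d' :=
  Submodule.span_mono fun _ ⟨w, h1, h2, h4⟩ => ⟨w, h1, h2.trans h, h4⟩

theorem wy_mem_Md {w : Wd n} (h : good w) {d : ℤ} (hd : wt w ≤ d) : wy w ∈ Md n d :=
  Submodule.subset_span ⟨w, h, hd, rfl⟩

theorem perm_good {w w' : Wd n} (h : w.Perm w') (hw : good w) : good w' :=
  fun p hp => hw p (h.mem_iff.2 hp)
theorem perm_wt {w w' : Wd n} (h : w.Perm w') : wt w = wt w' := (h.map _).sum_eq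

theorem perm_step {d : ℤ} {l : ℕ} (ih : ∀ l' < l, Wm n d l' ≤ No n d ⊔ mO • Md n d) {w w' : Wd n}
    (h : w.Perm w') : ∀ u, good (u ++ w) → wt (u ++ w) ≤ d → (u ++ w).length ≤ l →
      wy (u ++ w) - wy (u ++ w') ∈ No n d ⊔ mO • Md n d := by
  induction h with
  | nil => intro u _ _ _; rw [sub_self]; exact zero_mem _
  | @cons p w w' _ hi =>
    intro u h1 h2 h3
    have e : ∀ v : Wd n, u ++ p :: v = (u ++ [p]) ++ v := fun v => by simp
    rw [e w] at h1 h2 h3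
    rw [e w, e w']
    exact hi _ h1 h2 h3
  | swap p r w =>
    intro u h1 h2 h3
    obtain ⟨m1, hm1, m2, hm2, h⟩ := yy_comm r.1 p.1 r.2 p.2
    have e : wy (u ++ r :: p :: w) - wy (u ++ p :: r :: w)
       = wy u * m1 * wy w + zt • (wy u * m2 * wy w) := by
      rw [wy_append, wy_append, wy_cons, wy_cons, wy_cons, wy_cons, ← mul_sub, ← mul_assoc (yy n _ _),
        ← mul_assoc (yy n _ _), ← sub_mul, h, add_mul, mul_add, smul_mul_assoc, mul_smul_comm, mul_assoc, mul_assoc]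
    have gu : good u := fun p hp => h1 p (List.mem_append_left _ hp)
    have gw : good w := fun p hp => h1 p (by simp [hp])
    rw [wt_append, wt_cons, wt_cons] at h2
    simp only [List.length_append, List.length_cons] at h3
    rw [e]
    refine add_mem (ih (u.length + 1 + w.length) (by omega) ?_) (Submodule.mem_sup_right (zsm_mem ?_))
    · exact Wm_mono (by omega) le_rfl (Wm_mul (Wm_mul (wy_mem gu) hm1) (wy_mem gw))
    · refine Wm_le_Md d _ (Wm_mono (by omega) le_rfl (Wm_mul (Wm_mul (wy_mem gu) hm2) (wy_mem gw)))
  | @trans w1 w2 w3 p1 p2 h1 h2 =>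
    intro u a b c
    have pp := p1.append_left u
    have := add_mem (h1 u a b c) (h2 u (perm_good pp a) (by rw [← perm_wt pp]; exact b) (by rw [← pp.length_eq]; exact c))
    rwa [sub_add_sub_cancel] at this

/-- Letter normalization. -/
def nf (p : Fin (2*n) × Fin (2*n)) : Fin (2*n) × Fin (2*n) :=
  if p.1 ≤ pr n p.2 then p else (pr n p.2, pr n p.1)

theorem nf_ip {p : Fin (2*n) × Fin (2*n)} (h : p.2 < p.1) : ip (nf p) := by
  unfold nf; split_ifs with h1
  · exact ⟨h, h1⟩
  · refine ⟨pr_lt.2 h, ?_⟩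
    show pr n p.2 ≤ pr n (pr n p.1)
    rw [pr_pr]; exact (not_le.1 h1).le

theorem nf_wt (p : Fin (2*n) × Fin (2*n)) :
    (((nf p).1 : ℕ) : ℤ) - (((nf p).2 : ℕ) : ℤ) = ((p.1 : ℕ) : ℤ) - ((p.2 : ℕ) : ℤ) := by
  unfold nf; split_ifs with h1
  · rfl
  · simp only [pr_val]; have := p.1.2; have := p.2.2; omega

theorem nf_yy (p : Fin (2*n) × Fin (2*n)) : ∃ m ∈ Md n (((p.1 : ℕ) : ℤ) - ((p.2 : ℕ) : ℤ)),
    yy n p.1 p.2 - yy n (nf p).1 (nf p).2 = zt • m := by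
  unfold nf; split_ifs with h1
  · exact ⟨0, zero_mem _, by simp⟩
  · obtain ⟨m, hm, h⟩ := yy_sym p.1 p.2
    exact ⟨m, Wm_le_Md _ _ hm, h⟩

theorem wt_nf (w : Wd n) : wt (w.map nf) = wt w := by
  induction w with
  | nil => rfl
  | cons p w ih => rw [List.map_cons, wt_cons, wt_cons, ih, nf_wt]

theorem good_nf {w : Wd n} (h : good w) : ∀ p ∈ w.map nf, ip p := by
  intro p hp
  obtain ⟨r, hr, rfl⟩ := List.mem_map.1 hp
  exact nf_ip (h r hr)

theorem wy_nf {w : Wd n} (h : good w) : ∃ m ∈ Md n (wt w), wy w - wy (w.map nf) = zt • m := by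
  induction w with
  | nil => exact ⟨0, zero_mem _, by simp⟩
  | cons p w ih =>
    have hw : good w := fun p hp => h p (List.mem_cons_of_mem _ hp)
    obtain ⟨m, hm, e⟩ := ih hw
    obtain ⟨m', hm', e'⟩ := nf_yy p
    refine ⟨m' * wy w + yy n (nf p).1 (nf p).2 * m, ?_, ?_⟩
    · rw [wt_cons]
      refine add_mem (Md_mul hm' (wy_mem_Md hw le_rfl)) (Md_mul ?_ hm)
      have := Wm_le_Md _ _ (yy_mem (nf p).1 (nf p).2)
      rwa [nf_wt] at this
    · rw [List.map_cons, wy_cons, wy_cons, smul_add, ← smul_mul_assoc, ← e', ← mul_smul_comm, ← e, sub_mul, mul_sub]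
      abel

theorem Wm_le (d : ℤ) (l : ℕ) : Wm n d l ≤ No n d ⊔ mO • Md n d := by
  induction l using Nat.strong_induction_on with
  | _ l ih =>
  refine Submodule.span_le.2 ?_
  rintro _ ⟨w, h1, h2, h3, rfl⟩
  obtain ⟨m, hm, e⟩ := wy_nf h1
  obtain ⟨k, hk⟩ := perm_om (good_nf h1)
  have g := good_of_ip (good_nf h1)
  have e2 := perm_step ih hk [] g (by rw [List.nil_append, wt_nf]; exact h2) (by simpa using h3)
  rw [List.nil_append, List.nil_append] at e2
  have : wy w = zt • m + (wy (w.map nf) - wy (om k.1)) + wy (om k.1) := by rw [← e]; abel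
  rw [this]
  refine add_mem (add_mem (Submodule.mem_sup_right (zsm_mem ?_)) e2) (Submodule.mem_sup_left ?_)
  · exact Md_mono h2 hm
  · have hkd : wt (om k.1) ≤ d := by rw [← perm_wt hk, wt_nf]; exact h2
    exact No_mem k hkd

theorem Md_le (d : ℤ) : Md n d ≤ No n d := by
  refine Submodule.le_of_le_smul_of_le_jacobson_bot (Md_fg d) jac ?_
  refine Submodule.span_le.2 ?_
  rintro _ ⟨w, h1, h2, rfl⟩
  exact Wm_le d _ (Wm_mono h2 le_rfl (wy_mem h1))

theorem wy_span {w : Wd n} (h : good w) :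
    wy w ∈ Submodule.span F (Set.range (fun k : Ix n => monomial n k.1)) := by
  have h1 := Md_le _ (wy_mem_Md h le_rfl)
  refine Submodule.span_induction
    (p := fun x _ => x ∈ Submodule.span F (Set.range (fun k : Ix n => monomial n k.1))) ?_ ?_ ?_ ?_ h1
  · rintro _ ⟨k, _, rfl⟩
    have : wy (om k.1) = (zt ^ (om k.1).length)⁻¹ • monomial n k.1 := by
      rw [monomial_eq, smul_smul, inv_mul_cancel₀ (pow_ne_zero _ zt_ne), one_smul]
    rw [this]
    exact Submodule.smul_mem _ _ (Submodule.subset_span ⟨k, rfl⟩)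
  · exact zero_mem _
  · intro a b _ _ ha hb; exact add_mem ha hb
  · intro c a _ ha
    rw [Oo_smul_def]; exact Submodule.smul_mem _ _ ha

theorem span_part (n : ℕ) :
    Submodule.span F (Set.range (fun k : Ix n => monomial n k.1)) = Subalgebra.toSubmodule (Utw n) := by
  apply le_antisymm
  · refine Submodule.span_le.2 ?_
    rintro _ ⟨k, rfl⟩
    show monomial n k.1 ∈ Utw n
    refine Subalgebra.list_prod_mem _ fun x hx => ?_
    obtain ⟨i, _, rfl⟩ := List.mem_map.1 hx
    refine Subalgebra.list_prod_mem _ fun x hx => ?_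
    obtain ⟨j, _, rfl⟩ := List.mem_map.1 hx
    split_ifs
    · exact Subalgebra.pow_mem _ (Algebra.subset_adjoin (Set.mem_range_self (i, j))) _
    · exact one_mem _
  · have hV : ∀ x ∈ Utw n, x ∈ Submodule.span F (wy '' {w : Wd n | good w}) := by
      intro x hx
      have h1 : (1 : Usp n) ∈ Submodule.span F (wy '' {w : Wd n | good w}) :=
        Submodule.subset_span ⟨[], by simp [good], rfl⟩
      refine Algebra.adjoin_induction (p := fun x _ => x ∈ Submodule.span F (wy '' {w : Wd n | good w})) ?_ ?_ ?_ ?_ hx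
      · rintro _ ⟨⟨i, j⟩, rfl⟩
        dsimp only
        rw [sU_yy]
        refine add_mem ?_ (Submodule.smul_mem _ _ ?_)
        · split_ifs
          · exact Submodule.smul_mem _ _ h1
          · exact zero_mem _
        · by_cases h : j < i
          · exact Submodule.subset_span ⟨[(i, j)], by simpa [good] using h, by simp [wy]⟩
          · rw [yy_zero h]; exact zero_mem _
      · intro r; rw [Algebra.algebraMap_eq_smul_one]; exact Submodule.smul_mem _ _ h1
      · intro a b _ _ ha hb; exact add_mem ha hb
      · intro a b _ _ ha hb
        have := Submodule.mul_mem_mul ha hb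
        rw [Submodule.span_mul_span] at this
        refine Submodule.span_mono ?_ this
        rintro _ ⟨_, ⟨u, hu, rfl⟩, _, ⟨w, hw, rfl⟩, rfl⟩
        exact ⟨u ++ w, good_append hu hw, wy_append u w⟩
    intro x hx
    refine Submodule.span_le.2 ?_ (hV x hx)
    rintro _ ⟨w, hw, rfl⟩
    exact wy_span hw

end Span

section Cop
variable {n : ℕ}

def lT (n : ℕ) (i a m x : Fin (2*n)) : F :=
  zt⁻¹ * (Rg n q⁻¹ (m, i) (x, a) - if m = x ∧ i = a then 1 else 0)
def lTb (n : ℕ) (j b x r : Fin (2*n)) : F :=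
  zt⁻¹ * (Rg n q (j, x) (b, r) - if j = b ∧ x = r then 1 else 0)

theorem vlT (i a m x : Fin (2*n)) : vv (lT n i a m x) ≤ 1 := vRgi1 m i x a
theorem vlTb (i a m x : Fin (2*n)) : vv (lTb n i a m x) ≤ 1 := vRg1 i m a x

theorem rT_l (i a m x : Fin (2*n)) : rT n i a m x = (if m = x ∧ i = a then 1 else 0) + zt * lT n i a m x := by
  rw [rT_apply, lT, ← mul_assoc, mul_inv_cancel₀ zt_ne, one_mul]; ring
theorem rTb_l (j b x r : Fin (2*n)) : rTb n j b x r = (if j = b ∧ x = r then 1 else 0) + zt * lTb n j b x r := by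
  rw [rTb_apply, lTb, ← mul_assoc, mul_inv_cancel₀ zt_ne, one_mul]; ring

def pb (n : ℕ) (i j a b m r : Fin (2*n)) : F :=
  (if i = a then lTb n j b m r else 0) + (if j = b then lT n i a m r else 0)
    + zt * ∑ x, lT n i a m x * lTb n j b x r

theorem vpb (i j a b m r : Fin (2*n)) : vv (pb n i j a b m r) ≤ 1 := by
  refine Valuation.map_add_le _ (Valuation.map_add_le _ ?_ ?_) ?_
  · split_ifs
    · exact vlTb _ _ _ _
    · simp
  · split_ifs
    · exact vlT _ _ _ _
    · simp
  · rw [map_mul]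
    refine mul_le_one' vzt.le (Valuation.map_sum_le vv fun x _ => ?_)
    rw [map_mul]; exact mul_le_one' (vlT _ _ _ _) (vlTb _ _ _ _)

theorem PP_eq (i j a b m r : Fin (2*n)) : (rT n i a * rTb n j b) m r =
    (if i = a ∧ j = b ∧ m = r then 1 else 0) + zt * pb n i j a b m r := by
  rw [Matrix.mul_apply]
  have e : ∀ x, rT n i a m x * rTb n j b x r =
     (if m = x then (if i = a then (if j = b ∧ m = r then 1 else 0) + zt * lTb n j b m r else 0) else 0)
     + (if x = r then (if j = b then zt * lT n i a m r else 0) else 0)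
     + zt * (zt * (lT n i a m x * lTb n j b x r)) := by
    intro x
    rw [rT_l, rTb_l]
    by_cases h1 : m = x
    · subst h1
      by_cases h2 : m = r
      · subst h2
        by_cases h3 : i = a <;> by_cases h4 : j = b <;> simp [h3, h4] <;> ring
      · by_cases h3 : i = a <;> by_cases h4 : j = b <;> simp [h2, h3, h4] <;> ring
    · by_cases h2 : x = r
      · subst h2
        by_cases h3 : i = a <;> by_cases h4 : j = b <;> simp [h1, h3, h4] <;> ring
      · by_cases h3 : i = a <;> by_cases h4 : j = b <;> simp [h1, h2, h3, h4] <;> ring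
  simp only [e]
  rw [Finset.sum_add_distrib, Finset.sum_add_distrib, Finset.sum_ite_eq, Finset.sum_ite_eq',
      if_pos (Finset.mem_univ _), if_pos (Finset.mem_univ _), ← Finset.mul_sum, ← Finset.mul_sum, pb]
  by_cases h3 : i = a <;> by_cases h4 : j = b <;> simp [h3, h4] <;> ring

/-- The constant term of the coaction. -/
def alp (p s : Fin (2*n) × Fin (2*n)) : F := ∑ a, eps n a * pb n p.1 p.2 a a s.1 s.2

theorem val_le (p s : Fin (2*n) × Fin (2*n)) : vv (alp p s) ≤ 1 := by
  refine Valuation.map_sum_le vv fun a _ => ?_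
  rw [map_mul, veps, one_mul]; exact vpb _ _ _ _ _ _

theorem dlt_yy (i j m r : Fin (2*n)) : dlt n (yy n i j) m r =
    (if m = r then yy n i j else 0) + alp (i, j) (m, r) • 1
      + zt • ∑ a, ∑ b, pb n i j a b m r • yy n a b := by
  have h1 : dlt n (sU n i j) m r = (if m = r then sU n i j else 0)
     + zt • (alp (i, j) (m, r) • (1 : Usp n) + zt • ∑ a, ∑ b, pb n i j a b m r • yy n a b) := by
    rw [dlt_s_apply]
    have e : ∀ a b, (rT n i a * rTb n j b) m r • sU n a b =
       (if i = a then (if j = b then (if m = r then sU n a b else 0) else 0) else 0)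
       + (if a = b then (zt * (eps n a * pb n i j a a m r)) • (1 : Usp n) else 0)
       + zt • zt • pb n i j a b m r • yy n a b := by
      intro a b
      rw [PP_eq, add_smul]
      rw [add_assoc]; congr 1
      · by_cases h1 : i = a <;> by_cases h2 : j = b <;> by_cases h3 : m = r <;> simp [h1, h2, h3]
      · rw [sU_yy, smul_add]; congr 1
        · by_cases h : a = b
          · subst h; rw [if_pos rfl, if_pos rfl, smul_smul]; congr 1; ring
          · rw [if_neg h, if_neg h, smul_zero]
        · simp only [smul_smul]; congr 1; ring
    simp only [e, Finset.sum_add_distrib]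
    rw [add_assoc]; congr 1
    · rw [Finset.sum_eq_single i, Finset.sum_eq_single j]
      · rw [if_pos rfl, if_pos rfl]
      · intro b _ hb; rw [if_pos rfl, if_neg hb.symm]
      · simp
      · intro b _ hb; exact Finset.sum_eq_zero fun c _ => by rw [if_neg hb.symm]
      · simp
    · rw [smul_add]; congr 1
      · have : ∀ a, ∑ b, (if a = b then (zt * (eps n a * pb n i j a a m r)) • (1 : Usp n) else 0)
           = (zt * (eps n a * pb n i j a a m r)) • (1 : Usp n) := by
          intro a; rw [Finset.sum_ite_eq, if_pos (Finset.mem_univ _)]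
        simp only [this]
        rw [← Finset.sum_smul, ← Finset.mul_sum, smul_smul, alp]
      · simp only [Finset.smul_sum]
  have h2 : dlt n (if i = j then eps n i • 1 else 0) m r =
      if m = r then (if i = j then eps n i • (1 : Usp n) else 0) else 0 := by
    by_cases h : i = j
    · rw [if_pos h, map_smul, map_one, Matrix.smul_apply, Matrix.one_apply]
      split_ifs
      · rfl
      · rw [smul_zero]
    · rw [if_neg h, map_zero, Matrix.zero_apply]; split_ifs <;> rfl
  have h3 : dlt n (yy n i j) m r = zt⁻¹ • (dlt n (sU n i j) m r - dlt n (if i = j then eps n i • 1 else 0) m r) := by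
    rw [yy, map_smul, Matrix.smul_apply, map_sub, Matrix.sub_apply]
  rw [h3, h1, h2]
  have h4 : ∀ x : Usp n, zt⁻¹ • (zt • x) = x := fun x => by
    rw [smul_smul, inv_mul_cancel₀ zt_ne, one_smul]
  by_cases h : m = r
  · rw [if_pos h, if_pos h, if_pos h, add_sub_right_comm, smul_add, h4, ← add_assoc]; rfl
  · rw [if_neg h, if_neg h, if_neg h, sub_zero, zero_add, h4, zero_add]

/-- The unit c. -/
def cc (p : Fin (2*n) × Fin (2*n)) : F := if p.1 = pr n p.2 then 2 * eps n p.1 else eps n p.1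

theorem vcc (p : Fin (2*n) × Fin (2*n)) : vv (cc p) = 1 := by
  unfold cc; split_ifs
  · rw [map_mul, veps, mul_one]; simpa using vnat 2 two_ne_zero
  · exact veps _

theorem al_mod (p s : Fin (2*n) × Fin (2*n)) :
    vv (alp p s - (eps n p.1 * lTb n p.2 p.1 s.1 s.2 + eps n p.2 * lT n p.1 p.2 s.1 s.2)) < 1 := by
  have e : alp p s - (eps n p.1 * lTb n p.2 p.1 s.1 s.2 + eps n p.2 * lT n p.1 p.2 s.1 s.2)
    = zt * ∑ a, eps n a * ∑ x, lT n p.1 a s.1 x * lTb n p.2 a x s.2 := by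
    rw [alp]
    simp only [pb, mul_add, Finset.sum_add_distrib, mul_ite, mul_zero]
    rw [Finset.sum_ite_eq, Finset.sum_ite_eq, if_pos (Finset.mem_univ _), if_pos (Finset.mem_univ _)]
    rw [add_sub_cancel_left, Finset.mul_sum]
    refine Finset.sum_congr rfl fun a _ => ?_
    ring
  rw [e, map_mul]
  refine mul_lt_one_of_lt_of_le vzt (Valuation.map_sum_le vv fun a _ => ?_)
  rw [map_mul, veps, one_mul]
  refine Valuation.map_sum_le vv fun x _ => ?_
  rw [map_mul]; exact mul_le_one' (vlT _ _ _ _) (vlTb _ _ _ _)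

theorem al_ip {p s : Fin (2*n) × Fin (2*n)} (hp : ip p) (hs : ip s) :
    vv (alp p s - if p = s then cc p else 0) < 1 := by
  obtain ⟨i, j⟩ := p
  obtain ⟨m, r⟩ := s
  have hp1 : j < i := hp.1
  have hp2 : i ≤ pr n j := hp.2
  have hs1 : r < m := hs.1
  have hs2 : m ≤ pr n r := hs.2
  have h := al_mod (i, j) (m, r)
  have e1 : lT n i j m r = 0 := by
    rw [lT, Rg_apply qi_ne, if_neg, if_neg, if_neg, if_neg]
    · simp
    · rintro ⟨rfl, rfl⟩; omega
    · rintro ⟨h1, h2, h3⟩; omega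
    · rintro ⟨h1, rfl, rfl⟩; omega
    · rintro ⟨rfl, rfl⟩; omega
  dsimp only at h
  rw [e1, mul_zero, add_zero] at h
  have e2 : lTb n j i m r = (if i = m ∧ r = j then 1 else 0) +
      (if m = pr n j ∧ r = pr n i then pp n q j * pp n q (pr n i) else 0) := by
    rw [lTb, Rg_apply q_ne, if_neg (c := j = i ∧ m = r) (by rintro ⟨rfl, _⟩; exact lt_irrefl _ hp1),
      if_neg (c := j = i ∧ m = r) (by rintro ⟨rfl, _⟩; exact lt_irrefl _ hp1)]
    rw [show q - q⁻¹ = zt from rfl]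
    have hz := zt_ne
    have c1 : (j < m ∧ i = m ∧ r = j) ↔ (i = m ∧ r = j) := ⟨fun h => h.2, fun h => ⟨h.1 ▸ hp1, h⟩⟩
    have c2 : (j < i ∧ m = pr n j ∧ r = pr n i) ↔ (m = pr n j ∧ r = pr n i) := ⟨fun h => h.2, fun h => ⟨hp1, h⟩⟩
    simp only [c1, c2]
    split_ifs <;> field_simp <;> simp <;> ring
  rw [e2] at h
  have c2 : (m = pr n j ∧ r = pr n i) ↔ ((i, j) = (m, r) ∧ i = pr n j) := by
    constructor
    · rintro ⟨rfl, rfl⟩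
      rw [pr_pr] at hs2
      have := le_antisymm hp2 hs2
      refine ⟨?_, this⟩
      rw [Prod.mk.injEq]; refine ⟨this, ?_⟩
      rw [this, pr_pr]
    · rintro ⟨h1, h2⟩
      rw [Prod.mk.injEq] at h1
      obtain ⟨rfl, rfl⟩ := h1
      refine ⟨h2, ?_⟩; rw [h2, pr_pr]
  have c1 : (i = m ∧ r = j) ↔ ((i, j) = (m, r)) := by
    rw [Prod.mk.injEq]; constructor
    · rintro ⟨a, b⟩; exact ⟨a, b.symm⟩
    · rintro ⟨a, b⟩; exact ⟨a, b.symm⟩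
  simp only [c1, c2] at h
  by_cases hps : (i, j) = (m, r)
  · rw [if_pos hps]
    rw [if_pos hps] at h
    rw [cc]
    dsimp only
    by_cases hij : i = pr n j
    · rw [if_pos hij]
      rw [if_pos ⟨hps, hij⟩] at h
      have e3 : alp (i, j) (m, r) - 2 * eps n i = (alp (i, j) (m, r) - eps n i * (1 + pp n q j * pp n q (pr n i)))
        + eps n i * (pp n q j * pp n q (pr n i) - 1) := by ring
      rw [e3]
      refine Valuation.map_add_lt _ h ?_
      rw [map_mul, veps, one_mul, hij, pr_pr]
      have e4 : ∃ z : ℤ, pp n q j * pp n q j = q ^ z := by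
        have e6 : ∀ (e : F) (z : ℤ), e * e = 1 → (e * q ^ z) * (e * q ^ z) = q ^ (z + z) := by
          intro e z he
          rw [mul_mul_mul_comm, he, one_mul, ← zpow_add₀ q_ne]
        exact ⟨_, e6 _ _ (eps_mul_self _)⟩
      obtain ⟨z, hz⟩ := e4
      rw [hz]
      have := vqm1 z
      have e5 : q ^ z - 1 = zt * (zt⁻¹ * (q ^ z - 1)) := by
        rw [← mul_assoc, mul_inv_cancel₀ zt_ne, one_mul]
      rw [e5, map_mul]
      exact mul_lt_one_of_lt_of_le vzt this
    · rw [if_neg hij]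
      rw [if_neg (fun h => hij h.2), add_zero, mul_one] at h
      exact h
  · rw [if_neg hps]
    rw [if_neg hps, if_neg (fun h => hps h.1), add_zero, mul_zero] at h
    exact h

end Cop

section Ind
variable {n : ℕ}

/-- Integral span of short words. -/
def Lk (n : ℕ) (c l : ℕ) : Submodule Oo (Usp n) :=
  Submodule.span Oo {x | ∃ u : Wd n, u.length + c ≤ l ∧ x = wy u}

/-- The error terms. -/
def Er (n : ℕ) (l : ℕ) : Submodule Oo (Usp n) :=
  Submodule.span Oo {x | ∃ u : Wd n, (u.length + 2 ≤ l ∧ x = wy u) ∨ (u.length ≤ l ∧ x = zt • wy u)}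

theorem Lk_wy {c l : ℕ} {u : Wd n} (h : u.length + c ≤ l) : wy u ∈ Lk n c l :=
  Submodule.subset_span ⟨u, h, rfl⟩

theorem Er_wy {l : ℕ} {u : Wd n} (h : u.length + 2 ≤ l) : wy u ∈ Er n l :=
  Submodule.subset_span ⟨u, Or.inl ⟨h, rfl⟩⟩

theorem Er_zwy {l : ℕ} {u : Wd n} (h : u.length ≤ l) : zt • wy u ∈ Er n l :=
  Submodule.subset_span ⟨u, Or.inr ⟨h, rfl⟩⟩

theorem Lk_le {c l c' l' : ℕ} (h : l + c' ≤ l' + c) : Lk n c l ≤ Lk n c' l' := by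
  refine Submodule.span_le.2 ?_
  rintro _ ⟨u, h1, rfl⟩
  exact Lk_wy (by omega)

theorem Er_mono {l l' : ℕ} (h : l ≤ l') : Er n l ≤ Er n l' := by
  refine Submodule.span_le.2 ?_
  rintro _ ⟨u, ⟨h1, rfl⟩ | ⟨h1, rfl⟩⟩
  · exact Er_wy (by omega)
  · exact Er_zwy (by omega)

theorem Er_le {l : ℕ} : Er n l ≤ Lk n 0 l := by
  refine Submodule.span_le.2 ?_
  rintro _ ⟨u, ⟨h1, rfl⟩ | ⟨h1, rfl⟩⟩
  · exact Lk_wy (by omega)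
  · exact F_smul_mem vzt.le (Lk_wy (by omega))

theorem Lk_Er {l l' : ℕ} (h : l + 1 ≤ l') : Lk n 1 l ≤ Er n l' := by
  refine Submodule.span_le.2 ?_
  rintro _ ⟨u, h1, rfl⟩
  exact Er_wy (by omega)

/-- Multiplication by a letter maps spans to spans. -/
theorem span_lmul {S : Set (Usp n)} {M : Submodule Oo (Usp n)} (y : Usp n) (h : ∀ x ∈ S, y * x ∈ M)
    {x : Usp n} (hx : x ∈ Submodule.span Oo S) : y * x ∈ M := by
  refine Submodule.span_induction (p := fun x _ => y * x ∈ M) h ?_ ?_ ?_ hx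
  · rw [mul_zero]; exact M.zero_mem
  · intro a b _ _ ha hb; rw [mul_add]; exact M.add_mem ha hb
  · intro c a _ ha
    rw [Oo_smul_def, mul_smul_comm, ← Oo_smul_def]; exact M.smul_mem c ha

theorem yy_Lk {c l : ℕ} (i j : Fin (2*n)) {x : Usp n} (h : x ∈ Lk n c l) : yy n i j * x ∈ Lk n c (l+1) := by
  refine span_lmul _ ?_ h
  rintro _ ⟨u, h1, rfl⟩
  have := wy_cons (i, j) u
  dsimp only at this
  rw [← this]
  exact Lk_wy (by rw [List.length_cons]; omega)

theorem yy_Er {l : ℕ} (i j : Fin (2*n)) {x : Usp n} (h : x ∈ Er n l) : yy n i j * x ∈ Er n (l+1) := by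
  refine span_lmul _ ?_ h
  rintro _ ⟨u, ⟨h1, rfl⟩ | ⟨h1, rfl⟩⟩
  · have := wy_cons (i, j) u
    dsimp only at this
    rw [← this]
    exact Er_wy (by rw [List.length_cons]; omega)
  · have := wy_cons (i, j) u
    dsimp only at this
    rw [mul_smul_comm, ← this]
    exact Er_zwy (by rw [List.length_cons]; omega)

theorem zLk {l : ℕ} {x : Usp n} (h : x ∈ Lk n 0 l) : zt • x ∈ Er n l := by
  have e : zt • x = (zt • (1 : Usp n)) * x := by rw [smul_mul_assoc, one_mul]
  rw [e]
  refine span_lmul _ ?_ h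
  rintro _ ⟨u, h1, rfl⟩
  rw [smul_mul_assoc, one_mul]
  exact Er_zwy h1

/-- The derivation part of the coaction. -/
def Dd (s : Fin (2*n) × Fin (2*n)) : Wd n → Usp n
  | [] => 0
  | p :: w => alp p s • wy w + yy n p.1 p.2 * Dd s w

theorem Dd_Lk (s : Fin (2*n) × Fin (2*n)) (w : Wd n) : Dd s w ∈ Lk n 1 w.length := by
  induction w with
  | nil => exact Submodule.zero_mem _
  | cons p w ih =>
    exact Submodule.add_mem _ (F_smul_mem (val_le _ _) (Lk_wy (by rw [List.length_cons]))) (yy_Lk _ _ ih)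

theorem dlt_Lk_of {w : Wd n} {m r : Fin (2*n)}
    (h : dlt n (wy w) m r - (if m = r then wy w else 0) - Dd (m, r) w ∈ Er n w.length) :
    dlt n (wy w) m r ∈ Lk n 0 w.length := by
  have e : dlt n (wy w) m r = (dlt n (wy w) m r - (if m = r then wy w else 0) - Dd (m, r) w)
      + (if m = r then wy w else 0) + Dd (m, r) w := by abel
  rw [e]
  refine Submodule.add_mem _ (Submodule.add_mem _ (Er_le h) ?_) (Lk_le (by omega) (Dd_Lk _ _))
  split_ifs
  · exact Lk_wy le_rfl
  · exact Submodule.zero_mem _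

theorem dlt_wy (w : Wd n) (m r : Fin (2*n)) :
    dlt n (wy w) m r - (if m = r then wy w else 0) - Dd (m, r) w ∈ Er n w.length := by
  induction w generalizing m r with
  | nil =>
    rw [wy_nil, map_one, Matrix.one_apply, sub_self, Dd, sub_zero]
    exact Submodule.zero_mem _
  | cons p w ih =>
    obtain ⟨i, j⟩ := p
    rw [List.length_cons]
    have e : dlt n (wy ((i, j) :: w)) m r = yy n i j * dlt n (wy w) m r
        + ∑ x, alp (i, j) (m, x) • dlt n (wy w) x r
        + ∑ x, ∑ a, ∑ b, pb n i j a b m x • (yy n a b * (zt • dlt n (wy w) x r)) := by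
      rw [wy_cons, map_mul, Matrix.mul_apply]
      dsimp only
      have e1 : ∀ x, dlt n (yy n i j) m x * dlt n (wy w) x r =
          (if m = x then yy n i j * dlt n (wy w) x r else 0)
          + alp (i, j) (m, x) • dlt n (wy w) x r
          + ∑ a, ∑ b, pb n i j a b m x • (yy n a b * (zt • dlt n (wy w) x r)) := by
        intro x
        rw [dlt_yy, add_mul, add_mul, smul_mul_assoc, one_mul, smul_mul_assoc, Finset.sum_mul,
          Finset.smul_sum]
        congr 1
        · congr 1
          rw [ite_mul, zero_mul]
        · refine Finset.sum_congr rfl fun a _ => ?_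
          rw [Finset.sum_mul, Finset.smul_sum]
          refine Finset.sum_congr rfl fun b _ => ?_
          rw [smul_mul_assoc, mul_smul_comm, smul_comm]
      simp only [e1, Finset.sum_add_distrib]
      rw [Finset.sum_ite_eq, if_pos (Finset.mem_univ _)]
    have e2 : dlt n (wy ((i, j) :: w)) m r - (if m = r then wy ((i, j) :: w) else 0) - Dd (m, r) ((i, j) :: w)
        = yy n i j * (dlt n (wy w) m r - (if m = r then wy w else 0) - Dd (m, r) w)
        + ∑ x, alp (i, j) (m, x) • (dlt n (wy w) x r - (if x = r then wy w else 0))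
        + ∑ x, ∑ a, ∑ b, pb n i j a b m x • (yy n a b * (zt • dlt n (wy w) x r)) := by
      rw [e, Dd, wy_cons]
      dsimp only
      have e3 : ∑ x, alp (i, j) (m, x) • (dlt n (wy w) x r - (if x = r then wy w else 0))
         = ∑ x, alp (i, j) (m, x) • dlt n (wy w) x r - alp (i, j) (m, r) • wy w := by
        simp only [smul_sub, Finset.sum_sub_distrib, smul_ite, smul_zero]
        rw [Finset.sum_ite_eq', if_pos (Finset.mem_univ _)]
      rw [e3, mul_sub, mul_sub, mul_ite, mul_zero]
      abel
    rw [e2]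
    refine Submodule.add_mem _ (Submodule.add_mem _ (yy_Er _ _ (ih m r)) ?_) ?_
    · refine Submodule.sum_mem _ fun x _ => F_smul_mem (val_le _ _) ?_
      have e4 : dlt n (wy w) x r - (if x = r then wy w else 0) =
        (dlt n (wy w) x r - (if x = r then wy w else 0) - Dd (x, r) w) + Dd (x, r) w := by abel
      rw [e4]
      exact Submodule.add_mem _ (Er_mono (by omega) (ih x r)) (Lk_Er le_rfl (Dd_Lk _ _))
    · refine Submodule.sum_mem _ fun x _ => Submodule.sum_mem _ fun a _ => Submodule.sum_mem _ fun b _ => ?_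
      exact F_smul_mem (vpb _ _ _ _ _ _) (yy_Er _ _ (zLk (dlt_Lk_of (ih x r))))

theorem dlt_Lk (w : Wd n) (m r : Fin (2*n)) : dlt n (wy w) m r ∈ Lk n 0 w.length := dlt_Lk_of (dlt_wy w m r)

/-- Entry of the coaction, as a linear map. -/
def dl (s : Fin (2*n) × Fin (2*n)) : Usp n →ₗ[F] Usp n where
  toFun x := dlt n x s.1 s.2
  map_add' x y := by rw [map_add, Matrix.add_apply]
  map_smul' c x := by rw [map_smul, Matrix.smul_apply, RingHom.id_apply]

/-- The iterated functionals. -/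
def Lam : Wd n → (Usp n →ₗ[F] F)
  | [] => (cou n).toLinearMap
  | s :: L => (Lam L).comp (dl s)

theorem cou_yy (i j : Fin (2*n)) : cou n (yy n i j) = 0 := by
  rw [yy, map_smul, map_sub, cou_s]
  split_ifs
  · rw [map_smul, map_one, smul_eq_mul, smul_eq_mul, mul_one, sub_self, mul_zero]
  · rw [map_zero, sub_self, smul_zero]

theorem Lam_nil_wy (w : Wd n) : Lam [] (wy w) = if w = [] then 1 else 0 := by
  cases w with
  | nil => rw [wy_nil, if_pos rfl]; exact map_one (cou n)
  | cons p w =>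
    rw [if_neg (by simp)]
    change cou n _ = 0
    rw [wy_cons, map_mul, cou_yy, zero_mul]

theorem span_val {S : Set (Usp n)} (f : Usp n →ₗ[F] F) (h : ∀ x ∈ S, vv (f x) ≤ 1) {x : Usp n}
    (hx : x ∈ Submodule.span Oo S) : vv (f x) ≤ 1 := by
  refine Submodule.span_induction (p := fun x _ => vv (f x) ≤ 1) h ?_ ?_ ?_ hx
  · rw [map_zero, map_zero]; exact zero_le_one
  · intro a b _ _ ha hb; rw [map_add]; exact Valuation.map_add_le _ ha hb
  · intro c a _ ha
    rw [Oo_smul_def, map_smul, smul_eq_mul, map_mul]; exact mul_le_one' c.2 ha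

theorem span_vlt {S : Set (Usp n)} (f : Usp n →ₗ[F] F) (h : ∀ x ∈ S, vv (f x) < 1) {x : Usp n}
    (hx : x ∈ Submodule.span Oo S) : vv (f x) < 1 := by
  refine Submodule.span_induction (p := fun x _ => vv (f x) < 1) h ?_ ?_ ?_ hx
  · rw [map_zero, map_zero]; exact zero_lt_one
  · intro a b _ _ ha hb; rw [map_add]; exact Valuation.map_add_lt _ ha hb
  · intro c a _ ha
    rw [Oo_smul_def, map_smul, smul_eq_mul, map_mul]; rw [mul_comm]; exact mul_lt_one_of_lt_of_le ha c.2

theorem Lam_le (L w : Wd n) : vv (Lam L (wy w)) ≤ 1 := by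
  induction L generalizing w with
  | nil =>
    rw [Lam_nil_wy]; split_ifs
    · rw [map_one]
    · rw [map_zero]; exact zero_le_one
  | cons s L ih =>
    refine span_val (Lam L) ?_ (dlt_Lk w s.1 s.2)
    rintro _ ⟨u, _, rfl⟩; exact ih u

theorem Lam_Er {L : Wd n} {l : ℕ} (h : ∀ u : Wd n, u.length + 2 ≤ l → vv (Lam L (wy u)) < 1) {x : Usp n}
    (hx : x ∈ Er n l) : vv (Lam L x) < 1 := by
  refine span_vlt (Lam L) ?_ hx
  rintro _ ⟨u, ⟨h1, rfl⟩ | ⟨h1, rfl⟩⟩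
  · exact h u h1
  · rw [map_smul, smul_eq_mul, map_mul]; exact mul_lt_one_of_lt_of_le vzt (Lam_le _ _)

theorem Lam_Dd {s : Fin (2*n) × Fin (2*n)} {L w : Wd n} (hs : ip s)
    (h : ∀ u : Wd n, u.length + 2 ≤ w.length → vv (Lam L (wy u)) < 1) :
    vv (Lam (s :: L) (wy w) - Lam L (Dd s w)) < 1 := by
  have h1 := dlt_wy w s.1 s.2
  rw [if_neg (ne_of_gt hs.1), sub_zero] at h1
  have h2 := Lam_Er h h1
  rw [map_sub] at h2
  exact h2

theorem Lam_lt (L : Wd n) (hL : ∀ p ∈ L, ip p) (w : Wd n) (h : w.length < L.length) :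
    vv (Lam L (wy w)) < 1 := by
  induction L generalizing w with
  | nil => simp at h
  | cons s L ih =>
    have hL' : ∀ p ∈ L, ip p := fun p hp => hL p (List.mem_cons_of_mem _ hp)
    rw [List.length_cons] at h
    have h1 := Lam_Dd (w := w) (L := L) (hL s List.mem_cons_self) (fun u hu => ih hL' u (by omega))
    have h2 : vv (Lam L (Dd s w)) < 1 := by
      refine span_vlt (Lam L) ?_ (Dd_Lk s w)
      rintro _ ⟨u, hu, rfl⟩; exact ih hL' u (by omega)
    have := Valuation.map_add_lt vv h1 h2
    rwa [sub_add_cancel] at this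

/-- The diagonal pairing. -/
def uu : Wd n → F
  | [] => 1
  | s :: L => ((s :: L).count s : F) * cc s * uu L

theorem vuu (L : Wd n) : vv (uu L) = 1 := by
  induction L with
  | nil => exact map_one _
  | cons s L ih =>
    rw [uu, map_mul, map_mul, ih, vcc, vnat, one_mul, one_mul]
    rw [List.count_cons_self]; omega

theorem Lam_pre {s : Fin (2*n) × Fin (2*n)} {L : Wd n} (hs : ip s)
    (hC : ∀ w : Wd n, (∀ p ∈ w, ip p) → w.length = L.length →
      vv (Lam L (wy w) - if w.Perm L then uu L else 0) < 1)
    (w : Wd n) : ∀ v : Wd n, (∀ p ∈ v, ip p) → (∀ p ∈ w, ip p) → v.length + w.length = L.length + 1 →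
      vv (Lam L (wy v * Dd s w) - if (v ++ w).Perm (s :: L) then (w.count s : F) * cc s * uu L else 0) < 1 := by
  induction w with
  | nil =>
    intro v _ _ _
    rw [Dd, mul_zero, map_zero, List.count_nil, Nat.cast_zero, zero_mul, zero_mul, ite_self, sub_zero, map_zero]
    exact zero_lt_one
  | cons p w ih =>
    intro v hv hw hl
    rw [List.length_cons] at hl
    have hp : ip p := hw p List.mem_cons_self
    have hw' : ∀ p ∈ w, ip p := fun x hx => hw x (List.mem_cons_of_mem _ hx)
    have h1 := ih (v ++ [p]) (by
      intro x hx; rcases List.mem_append.1 hx with h | h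
      · exact hv x h
      · rw [List.mem_singleton] at h; rw [h]; exact hp) hw' (by
        rw [List.length_append, List.length_singleton]; omega)
    have e0 : v ++ [p] ++ w = v ++ p :: w := by simp
    rw [e0] at h1
    have e1 : wy v * Dd s (p :: w) = alp p s • wy (v ++ w) + wy (v ++ [p]) * Dd s w := by
      rw [Dd, mul_add, mul_smul_comm, wy_append, wy_append, wy_cons, wy_nil, mul_one, mul_assoc]
    rw [e1, map_add, map_smul, smul_eq_mul]
    have ha := al_ip hp hs
    have h2 := hC (v ++ w) (by
      intro x hx; rcases List.mem_append.1 hx with h | h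
      · exact hv x h
      · exact hw' x h) (by rw [List.length_append]; omega)
    have hle := Lam_le L (v ++ w)
    by_cases hps : p = s
    · subst hps
      rw [if_pos rfl] at ha
      have c : (v ++ p :: w).Perm (p :: L) ↔ (v ++ w).Perm L := by
        rw [← List.perm_cons (l₁ := v ++ w) p]
        exact ⟨fun h => (List.perm_middle.symm.trans h), fun h => List.perm_middle.trans h⟩
      simp only [c] at h1 ⊢
      rw [List.count_cons_self]
      have e2 : alp p p * Lam L (wy (v ++ w)) + Lam L (wy (v ++ [p]) * Dd p w)
          - (if (v ++ w).Perm L then ((w.count p + 1 : ℕ) : F) * cc p * uu L else 0)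
          = (alp p p - cc p) * Lam L (wy (v ++ w))
            + cc p * (Lam L (wy (v ++ w)) - if (v ++ w).Perm L then uu L else 0)
            + (Lam L (wy (v ++ [p]) * Dd p w) - if (v ++ w).Perm L then (w.count p : F) * cc p * uu L else 0) := by
        push_cast
        split_ifs <;> ring
      rw [e2]
      refine Valuation.map_add_lt _ (Valuation.map_add_lt _ ?_ ?_) h1
      · rw [map_mul]; exact mul_lt_one_of_lt_of_le ha hle
      · rw [map_mul, vcc, one_mul]; exact h2
    · rw [if_neg hps, sub_zero] at ha
      rw [List.count_cons_of_ne hps, add_sub_assoc]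
      refine Valuation.map_add_lt _ ?_ h1
      rw [map_mul]; exact mul_lt_one_of_lt_of_le ha hle

theorem Lam_eq (L : Wd n) (hL : ∀ p ∈ L, ip p) (w : Wd n) (hw : ∀ p ∈ w, ip p) (h : w.length = L.length) :
    vv (Lam L (wy w) - if w.Perm L then uu L else 0) < 1 := by
  induction L generalizing w with
  | nil =>
    rw [List.length_nil, List.length_eq_zero_iff] at h
    subst h
    rw [Lam_nil_wy, if_pos rfl, if_pos (List.Perm.refl _), uu, sub_self, map_zero]
    exact zero_lt_one
  | cons s L ih =>
    have hL' : ∀ p ∈ L, ip p := fun p hp => hL p (List.mem_cons_of_mem _ hp)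
    have hs := hL s List.mem_cons_self
    rw [List.length_cons] at h
    have h1 := Lam_Dd (w := w) (L := L) hs (fun u hu => Lam_lt L hL' u (by omega))
    have h2 := Lam_pre hs (ih hL') w [] (by simp) hw (by simpa using h)
    rw [wy_nil, one_mul, List.nil_append] at h2
    have e : (if w.Perm (s :: L) then (w.count s : F) * cc s * uu L else 0)
       = if w.Perm (s :: L) then uu (s :: L) else 0 := by
      by_cases hc : w.Perm (s :: L)
      · rw [if_pos hc, if_pos hc, uu, hc.count_eq]
      · rw [if_neg hc, if_neg hc]
    rw [e] at h2
    have := Valuation.map_add_lt vv h1 h2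
    rwa [sub_add_sub_cancel] at this

theorem om_inj {k k' : Ix n} (h : (om k.1).Perm (om k'.1)) : k = k' := by
  refine Subtype.ext (funext fun p => ?_)
  rw [← om_count k p, ← om_count k' p, h.count_eq]

theorem Lam_self (k : Ix n) : vv (Lam (om k.1) (wy (om k.1))) = 1 := by
  have h := Lam_eq (om k.1) (fun _ h => om_ip h) (om k.1) (fun _ h => om_ip h) rfl
  rw [if_pos (List.Perm.refl _)] at h
  have h2 := Valuation.map_add_eq_of_lt_right vv (x := Lam (om k.1) (wy (om k.1)) - uu (om k.1)) (y := uu (om k.1))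
    (by rw [vuu]; exact h)
  rw [sub_add_cancel, vuu] at h2
  exact h2

theorem Lam_other {k k' : Ix n} (hne : k' ≠ k) (hl : (om k'.1).length ≤ (om k.1).length) :
    vv (Lam (om k.1) (wy (om k'.1))) < 1 := by
  rcases hl.lt_or_eq with h | h
  · exact Lam_lt _ (fun _ h => om_ip h) _ h
  · have h := Lam_eq (om k.1) (fun _ h => om_ip h) (om k'.1) (fun _ h => om_ip h) h
    rwa [if_neg (fun hp => hne (om_inj hp)), sub_zero] at h

theorem indep_part (n : ℕ) : LinearIndependent F (fun k : Ix n => monomial n k.1) := by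
  classical
  rw [linearIndependent_iff']
  intro S g hg
  by_contra hcon
  push Not at hcon
  obtain ⟨k1, hk1, hgk1⟩ := hcon
  let h : Ix n → F := fun k => g k * zt ^ (om k.1).length
  have hh : ∑ k ∈ S, h k • wy (om k.1) = 0 := by
    rw [← hg]
    refine Finset.sum_congr rfl fun k _ => ?_
    rw [monomial_eq, smul_smul]
  obtain ⟨k2, hk2, hmax⟩ := Finset.exists_max_image S (fun k => vv (h k)) ⟨k1, hk1⟩
  obtain ⟨k0, hk0, hmax0⟩ := Finset.exists_max_image (S.filter fun k => vv (h k) = vv (h k2))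
    (fun k => (om k.1).length) ⟨k2, Finset.mem_filter.2 ⟨hk2, rfl⟩⟩
  rw [Finset.mem_filter] at hk0
  have hne : h k0 ≠ 0 := by
    intro h0
    have h1 := hmax k1 hk1
    rw [← hk0.2, h0, map_zero, le_zero_iff, map_eq_zero] at h1
    exact mul_ne_zero hgk1 (pow_ne_zero _ zt_ne) h1
  have hpos : 0 < vv (h k0) := zero_lt_iff.2 ((Valuation.ne_zero_iff _).2 hne)
  have hs : ∑ k ∈ S, h k * Lam (om k0.1) (wy (om k.1)) = 0 := by
    have := congrArg (Lam (om k0.1)) hh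
    rw [map_sum, map_zero] at this
    rw [← this]
    refine Finset.sum_congr rfl fun k _ => ?_
    rw [map_smul, smul_eq_mul]
  rw [← Finset.add_sum_erase _ _ hk0.1, add_eq_zero_iff_eq_neg] at hs
  have hb : vv (∑ k ∈ S.erase k0, h k * Lam (om k0.1) (wy (om k.1))) < vv (h k0) := by
    refine Valuation.map_sum_lt vv hpos.ne' fun k hk => ?_
    rw [Finset.mem_erase] at hk
    rw [map_mul]
    rcases (hmax k hk.2).lt_or_eq with h1 | h1
    · rw [← hk0.2] at h1
      exact lt_of_le_of_lt (mul_le_of_le_one_right' (Lam_le _ _)) h1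
    · have h2 := Lam_other hk.1 (hmax0 k (Finset.mem_filter.2 ⟨hk.2, h1⟩))
      rw [h1, ← hk0.2]
      exact mul_lt_of_lt_one_right hpos h2
  have ha := congrArg vv hs
  rw [Valuation.map_neg, map_mul, Lam_self, mul_one] at ha
  rw [← ha] at hb
  exact lt_irrefl _ hb

end Ind

/-- PBW theorem: the ordered monomials in the generators s_{ij},
    1 ≤ j < i ≤ j′, form a basis of U_q^{tw}(gl_n) as an F-vector space. -/
theorem monomials_basis (n : ℕ) (hn : 2 ≤ n) :
    LinearIndependent F
      (fun k : {k : Fin (2*n) × Fin (2*n) → ℕ //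
          ∀ p, ¬(p.2 < p.1 ∧ p.1 ≤ pr n p.2) → k p = 0} => monomial n k.1) ∧
    Submodule.span F
      (Set.range (fun k : {k : Fin (2*n) × Fin (2*n) → ℕ //
          ∀ p, ¬(p.2 < p.1 ∧ p.1 ≤ pr n p.2) → k p = 0} => monomial n k.1))
      = Subalgebra.toSubmodule (Utw n) := by
  exact ⟨indep_part n, span_part n⟩

end CI
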